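/- arXiv:2010.05604 — 2 statements merged into one kernel-verified Lean document; each statement's English description precedes it below -/
import Mathlib

section
/- Suppose G is a Finsler-type energy on ℝ^n and Φ defines a regular bounded domain Ω with constant δ₀. Let x ∈ Mf be a V⁻-critical curve for J on Mf. Then x has H^{2,∞}-regularity: ẋ is absolutely continuous and ẍ ∈ L^∞([0,1],ℝ^n). Moreover, setting C_x := {s ∈ [0,1] : Φ(x(s)) = 0}, there exists λ ∈ L^∞([0,1],ℝ) such that d_qG(x,ẋ) − (d/ds) d_vG(x,ẋ) = λ ∇Φ(x) holds almost everywhere on [0,1], with λ ≤ 0 a.e. on [0,1] and λ(s) = 0 for every s ∉ C_x. If in addition x is non-constant, then ẋ(s) ≠ 0 for every s ∈ [0,1]. -/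
open MeasureTheory Set Filter RealInnerProductSpace

noncomputable section

/-- Euclidean space `ℝ^n`. -/
abbrev Evec (n : ℕ) := EuclideanSpace ℝ (Fin n)

/-- An `H¹` curve on `[a,b]`: an absolutely continuous curve whose a.e. derivative is
square-integrable, encoded by a choice of (integrable, square-integrable) derivative
together with the fundamental theorem of calculus identity. -/
structure H1Curve (n : ℕ) (a b : ℝ) where
  toFun : ℝ → Evec n
  deriv : ℝ → Evec n
  deriv_integrable : IntegrableOn deriv (Icc a b)
  deriv_sq_integrable : IntegrableOn (fun s => ‖deriv s‖ ^ 2) (Icc a b)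
  eq_add_integral : ∀ t ∈ Icc a b, toFun t = toFun a + ∫ s in a..t, deriv s

/-- The partial differential `d_qG(q,v)` of `G` in the first variable. -/
def dqCLM {n : ℕ} (G : Evec n → Evec n → ℝ) (q v : Evec n) : Evec n →L[ℝ] ℝ :=
  fderiv ℝ (fun z => G z v) q

/-- The partial differential `d_vG(q,v)` of `G` in the second variable. -/
def dvCLM {n : ℕ} (G : Evec n → Evec n → ℝ) (q v : Evec n) : Evec n →L[ℝ] ℝ :=
  fderiv ℝ (fun w => G q w) v

/-- A Finsler-type energy on `ℝ^n` with constants `ℓ ≥ 1` and `α > 0`. -/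
structure IsFinslerEnergy (n : ℕ) (G : Evec n → Evec n → ℝ) (ℓ α : ℝ) : Prop where
  continuous : Continuous fun p : Evec n × Evec n => G p.1 p.2
  smooth : ContDiffOn ℝ 2 (fun p : Evec n × Evec n => G p.1 p.2) {p | p.2 ≠ 0}
  homog : ∀ (q v : Evec n) (lam : ℝ), 0 < lam → G q (lam • v) = lam ^ 2 * G q v
  one_le_ell : 1 ≤ ℓ
  alpha_pos : 0 < α
  lower : ∀ q v, (1 / ℓ) * ‖v‖ ^ 2 ≤ G q v
  upper : ∀ q v, G q v ≤ ℓ * ‖v‖ ^ 2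
  dq_bound : ∀ q v, ‖dqCLM G q v‖ ≤ ℓ * (1 + ‖v‖ ^ 2)
  dv_bound : ∀ q v, ‖dvCLM G q v‖ ≤ ℓ * (1 + ‖v‖)
  vv_convex : ∀ (q v : Evec n), v ≠ 0 → ∀ w : Evec n,
    α * ‖w‖ ^ 2 ≤ fderiv ℝ (fun u => dvCLM G q u w) v w

/-- `Φ` defines a regular bounded domain `Ω = Φ⁻¹((−∞,0))` with constant `δ₀`. -/
structure IsRegularDomain (n : ℕ) (Φ : Evec n → ℝ) (δ₀ : ℝ) : Prop where
  smooth : ContDiff ℝ 2 Φ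
  nonempty : (Φ ⁻¹' Iio 0).Nonempty
  bounded : Bornology.IsBounded (Φ ⁻¹' Iio 0)
  boundary_eq : frontier (Φ ⁻¹' Iio 0) = Φ ⁻¹' {0}
  delta0_pos : 0 < δ₀
  grad_ne_zero : ∀ q : Evec n, |Φ q| ≤ δ₀ → gradient Φ q ≠ 0
  sublevel_compact : ∀ δ ∈ Icc (0:ℝ) δ₀, IsCompact (Φ ⁻¹' Iic δ)

/-- Membership in `Mf`: curves in `Ω̄` with endpoints on `∂Ω`. -/
def MemMf {n : ℕ} (Φ : Evec n → ℝ) (x : H1Curve n 0 1) : Prop :=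
  (∀ s ∈ Icc (0:ℝ) 1, Φ (x.toFun s) ≤ 0) ∧ Φ (x.toFun 0) = 0 ∧ Φ (x.toFun 1) = 0

/-- Membership in `V⁻(x,Mf)`. -/
def MemVminus {n : ℕ} (Φ : Evec n → ℝ) (x ξ : H1Curve n 0 1) : Prop :=
  ⟪gradient Φ (x.toFun 0), ξ.toFun 0⟫ = 0 ∧
  ⟪gradient Φ (x.toFun 1), ξ.toFun 1⟫ = 0 ∧
  ∀ s ∈ Ioo (0:ℝ) 1, Φ (x.toFun s) = 0 → ⟪gradient Φ (x.toFun s), ξ.toFun s⟫ ≤ 0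

/-- Membership in `W⁻(x,Mf)`: as `V⁻` but with strict inequality at interior touching points. -/
def MemWminus {n : ℕ} (Φ : Evec n → ℝ) (x ξ : H1Curve n 0 1) : Prop :=
  MemVminus Φ x ξ ∧
  ∀ s ∈ Ioo (0:ℝ) 1, Φ (x.toFun s) = 0 → ⟪gradient Φ (x.toFun s), ξ.toFun s⟫ < 0

/-- The energy functional `J(x) = (1/2)∫₀¹ G(x,ẋ)`. -/
def energy {n : ℕ} (G : Evec n → Evec n → ℝ) (x : H1Curve n 0 1) : ℝ :=
  (1 / 2) * ∫ s in (0:ℝ)..1, G (x.toFun s) (x.deriv s)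

/-- The differential `dJ(x)[ξ]`. -/
def dJ {n : ℕ} (G : Evec n → Evec n → ℝ) (x ξ : H1Curve n 0 1) : ℝ :=
  (1 / 2) * ∫ s in (0:ℝ)..1,
    (dqCLM G (x.toFun s) (x.deriv s) (ξ.toFun s) + dvCLM G (x.toFun s) (x.deriv s) (ξ.deriv s))

/-- `x` is a `V⁻`-critical curve for `J` on `Mf`. -/
def IsVCritical {n : ℕ} (G : Evec n → Evec n → ℝ) (Φ : Evec n → ℝ) (x : H1Curve n 0 1) : Prop :=
  MemMf Φ x ∧ ∀ ξ : H1Curve n 0 1, MemVminus Φ x ξ → 0 ≤ dJ G x ξ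

/-- The norm `‖ξ‖_*`. -/
def starNorm {n : ℕ} (ξ : H1Curve n 0 1) : ℝ :=
  max ‖ξ.toFun 0‖ ‖ξ.toFun 1‖ + Real.sqrt (∫ s in (0:ℝ)..1, ‖ξ.deriv s‖ ^ 2)

/-- The distance `dist_*`. -/
def starDist {n : ℕ} (x y : H1Curve n 0 1) : ℝ :=
  max ‖x.toFun 0 - y.toFun 0‖ ‖x.toFun 1 - y.toFun 1‖ +
    Real.sqrt (∫ s in (0:ℝ)..1, ‖x.deriv s - y.deriv s‖ ^ 2)

/-- The penalization function `χ_δ`. -/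
def chi (δ t : ℝ) : ℝ := if t ≤ 0 then 0 else t ^ 2 / (δ - t) ^ 2

/-- Membership in `C_δ = C([a,b],p,q,Ω_δ)`. -/
def MemC {n : ℕ} (Φ : Evec n → ℝ) (δ a b : ℝ) (p q : Evec n) (γ : H1Curve n a b) : Prop :=
  (∀ s ∈ Icc a b, Φ (γ.toFun s) < δ) ∧ γ.toFun a = p ∧ γ.toFun b = q

/-- The penalized functional `J_δ`. -/
def Jpen {n : ℕ} (G : Evec n → Evec n → ℝ) (Φ : Evec n → ℝ) (δ a b : ℝ)
    (γ : H1Curve n a b) : ℝ :=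
  (1 / 2) * (∫ s in a..b, G (γ.toFun s) (γ.deriv s)) + ∫ s in a..b, chi δ (Φ (γ.toFun s))

/-- `y` represents the backward parametrization `ℛx` of `x` (on `[0,1]`). -/
def RevRep {n : ℕ} (x y : H1Curve n 0 1) : Prop :=
  (∀ s, y.toFun s = x.toFun (1 - s)) ∧ (∀ s, y.deriv s = -x.deriv (1 - s))


namespace Fins

/-! ### Part A: properties of Finsler-type energies -/

section PartA
variable {n : ℕ} {G : Evec n → Evec n → ℝ} {ℓ α : ℝ}

theorem dv_homog (hG : IsFinslerEnergy n G ℓ α) (q v : Evec n) {c : ℝ} (hc : 0 < c) :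
    dvCLM G q (c • v) = c • dvCLM G q v := by
  have h1 : fderiv ℝ (fun u => G q (c • u)) v = c • fderiv ℝ (fun u => G q u) (c • v) :=
    fderiv_comp_smul (f := fun u => G q u) c
  have h2 : (fun u => G q (c • u)) = (c ^ 2) • (fun u => G q u) := by
    funext u; simp [hG.homog q u c hc]
  rw [h2, fderiv_const_smul_field] at h1
  unfold dvCLM
  have h3 : c • (fderiv ℝ (fun u => G q u) (c • v)) = c • (c • fderiv ℝ (fun u => G q u) v) := by
    rw [← h1, smul_smul, ← sq]; rfl
  exact smul_right_injective _ hc.ne' h3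

theorem dq_homog (hG : IsFinslerEnergy n G ℓ α) (q v : Evec n) {c : ℝ} (hc : 0 < c) :
    dqCLM G q (c • v) = (c ^ 2) • dqCLM G q v := by
  have h2 : (fun z => G z (c • v)) = (c ^ 2) • (fun z => G z v) := by
    funext u; simp [hG.homog u v c hc]
  unfold dqCLM
  rw [h2, fderiv_const_smul_field]; rfl

theorem ell_pos (hG : IsFinslerEnergy n G ℓ α) : 0 < ℓ := lt_of_lt_of_le one_pos hG.one_le_ell

theorem dv_le (hG : IsFinslerEnergy n G ℓ α) (q v : Evec n) : ‖dvCLM G q v‖ ≤ ℓ * ‖v‖ := by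
  have hl := ell_pos hG
  refine le_of_forall_pos_le_add fun ε hε => ?_
  have hc : 0 < ℓ / ε := by positivity
  have h := hG.dv_bound q ((ℓ / ε) • v)
  rw [dv_homog hG q v hc, norm_smul, norm_smul, Real.norm_of_nonneg hc.le] at h
  have h2 : (ℓ / ε) * ‖dvCLM G q v‖ ≤ (ℓ / ε) * (ℓ * ‖v‖ + ε) := by
    calc _ ≤ _ := h
      _ = _ := by field_simp; ring
  exact le_of_mul_le_mul_left h2 hc

theorem dq_le (hG : IsFinslerEnergy n G ℓ α) (q v : Evec n) : ‖dqCLM G q v‖ ≤ ℓ * ‖v‖ ^ 2 := by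
  have hl := ell_pos hG
  refine le_of_forall_pos_le_add fun ε hε => ?_
  have hc' : 0 < ℓ / ε := by positivity
  have hc : 0 < Real.sqrt (ℓ / ε) := Real.sqrt_pos.2 hc'
  have h := hG.dq_bound q ((Real.sqrt (ℓ / ε)) • v)
  rw [dq_homog hG q v hc, norm_smul, norm_smul, mul_pow, norm_pow,
    Real.norm_of_nonneg hc.le, Real.sq_sqrt hc'.le] at h
  have h2 : (ℓ / ε) * ‖dqCLM G q v‖ ≤ (ℓ / ε) * (ℓ * ‖v‖ ^ 2 + ε) := by
    calc _ ≤ _ := h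
      _ = _ := by field_simp; ring
  exact le_of_mul_le_mul_left h2 hc'

theorem dv_zero (hG : IsFinslerEnergy n G ℓ α) (q : Evec n) : dvCLM G q 0 = 0 := by
  have := dv_le hG q 0
  simpa using this

theorem dq_zero (hG : IsFinslerEnergy n G ℓ α) (q : Evec n) : dqCLM G q 0 = 0 := by
  have := dq_le hG q 0
  simpa using this

theorem G_zero (hG : IsFinslerEnergy n G ℓ α) (q : Evec n) : G q 0 = 0 := by
  have h1 := hG.lower q 0
  have h2 := hG.upper q 0
  simp at h1 h2
  linarith

theorem isOpen_ne : IsOpen {p : Evec n × Evec n | p.2 ≠ 0} :=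
  isOpen_ne_fun continuous_snd continuous_const

theorem diffAt (hG : IsFinslerEnergy n G ℓ α) {q v : Evec n} (hv : v ≠ 0) :
    DifferentiableAt ℝ (fun p : Evec n × Evec n => G p.1 p.2) (q, v) :=
  (hG.smooth.contDiffAt (isOpen_ne.mem_nhds hv)).differentiableAt (by norm_num)

theorem dv_eq (hG : IsFinslerEnergy n G ℓ α) {q v : Evec n} (hv : v ≠ 0) :
    dvCLM G q v = (fderiv ℝ (fun p : Evec n × Evec n => G p.1 p.2) (q, v)).comp
      (ContinuousLinearMap.inr ℝ (Evec n) (Evec n)) := by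
  have h := (diffAt hG (q := q) hv).hasFDerivAt
  have h2 : HasFDerivAt (fun w : Evec n => (q, w)) (ContinuousLinearMap.inr ℝ (Evec n) (Evec n)) v :=
    hasFDerivAt_prodMk_right q v
  exact (HasFDerivAt.comp v h h2).fderiv

theorem dq_eq (hG : IsFinslerEnergy n G ℓ α) {q v : Evec n} (hv : v ≠ 0) :
    dqCLM G q v = (fderiv ℝ (fun p : Evec n × Evec n => G p.1 p.2) (q, v)).comp
      (ContinuousLinearMap.inl ℝ (Evec n) (Evec n)) := by
  have h := (diffAt hG (q := q) hv).hasFDerivAt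
  have h2 : HasFDerivAt (fun w : Evec n => (w, v)) (ContinuousLinearMap.inl ℝ (Evec n) (Evec n)) q :=
    hasFDerivAt_prodMk_left q v
  exact (HasFDerivAt.comp q h h2).fderiv

theorem fderiv_contDiffAt (hG : IsFinslerEnergy n G ℓ α) {q v : Evec n} (hv : v ≠ 0) :
    ContDiffAt ℝ 1 (fderiv ℝ (fun p : Evec n × Evec n => G p.1 p.2)) (q, v) :=
  (hG.smooth.fderiv_of_isOpen isOpen_ne (by norm_num)).contDiffAt (isOpen_ne.mem_nhds hv)

theorem dv_contDiffAt (hG : IsFinslerEnergy n G ℓ α) {q v : Evec n} (hv : v ≠ 0) :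
    ContDiffAt ℝ 1 (fun p : Evec n × Evec n => dvCLM G p.1 p.2) (q, v) := by
  have h1 : ContDiffAt ℝ 1 (fun p : Evec n × Evec n =>
      (fderiv ℝ (fun p : Evec n × Evec n => G p.1 p.2) p).comp
      (ContinuousLinearMap.inr ℝ (Evec n) (Evec n))) (q, v) :=
    (fderiv_contDiffAt hG hv).clm_comp contDiffAt_const
  refine h1.congr_of_eventuallyEq ?_
  filter_upwards [isOpen_ne.mem_nhds (show (q, v) ∈ {p : Evec n × Evec n | p.2 ≠ 0} from hv)]
    with p hp
  exact dv_eq hG hp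

theorem dv_continuous (hG : IsFinslerEnergy n G ℓ α) :
    Continuous (fun p : Evec n × Evec n => dvCLM G p.1 p.2) := by
  rw [continuous_iff_continuousAt]
  rintro ⟨q, v⟩
  by_cases hv : v = 0
  · subst hv
    have h0 : Tendsto (fun p : Evec n × Evec n => ℓ * ‖p.2‖) (nhds (q, 0)) (nhds 0) := by
      have : Continuous (fun p : Evec n × Evec n => ℓ * ‖p.2‖) := by fun_prop
      simpa using this.tendsto (q, (0 : Evec n))
    unfold ContinuousAt
    simp only [dv_zero hG]
    exact squeeze_zero_norm (fun p => dv_le hG p.1 p.2) h0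
  · exact (dv_contDiffAt hG hv).continuousAt

theorem dq_continuous (hG : IsFinslerEnergy n G ℓ α) :
    Continuous (fun p : Evec n × Evec n => dqCLM G p.1 p.2) := by
  rw [continuous_iff_continuousAt]
  rintro ⟨q, v⟩
  by_cases hv : v = 0
  · subst hv
    have h0 : Tendsto (fun p : Evec n × Evec n => ℓ * ‖p.2‖ ^ 2) (nhds (q, 0)) (nhds 0) := by
      have : Continuous (fun p : Evec n × Evec n => ℓ * ‖p.2‖ ^ 2) := by fun_prop
      simpa using this.tendsto (q, (0 : Evec n))
    unfold ContinuousAt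
    simp only [dq_zero hG]
    exact squeeze_zero_norm (fun p => dq_le hG p.1 p.2) h0
  · have h1 : ContinuousAt (fun p : Evec n × Evec n =>
      (fderiv ℝ (fun p : Evec n × Evec n => G p.1 p.2) p).comp
      (ContinuousLinearMap.inl ℝ (Evec n) (Evec n))) (q, v) :=
      ((fderiv_contDiffAt hG hv).clm_comp contDiffAt_const).continuousAt
    refine h1.congr ?_
    filter_upwards [isOpen_ne.mem_nhds (show (q, v) ∈ {p : Evec n × Evec n | p.2 ≠ 0} from hv)]
      with p hp
    exact (dq_eq hG hp).symm

theorem euler (hG : IsFinslerEnergy n G ℓ α) (q v : Evec n) :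
    dvCLM G q v v = 2 * G q v := by
  by_cases hv : v = 0
  · subst hv; simp [G_zero hG]
  have hd : HasFDerivAt (fun w => G q w) (dvCLM G q v) ((1 : ℝ) • v) := by
    rw [one_smul]
    have h := (diffAt hG (q := q) hv).hasFDerivAt
    have h2 : HasFDerivAt (fun w : Evec n => (q, w))
      (ContinuousLinearMap.inr ℝ (Evec n) (Evec n)) v := hasFDerivAt_prodMk_right q v
    exact (HasFDerivAt.comp v h h2).differentiableAt.hasFDerivAt
  have h1 : HasDerivAt (fun c : ℝ => c • v) v 1 := by
    simpa using (hasDerivAt_id (1 : ℝ)).smul_const v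
  have h2 : HasDerivAt (fun c : ℝ => G q (c • v)) (dvCLM G q v v) 1 :=
    hd.comp_hasDerivAt (1 : ℝ) h1
  have h3 : HasDerivAt (fun c : ℝ => c ^ 2 * G q v) (2 * G q v) 1 := by
    simpa using (hasDerivAt_pow 2 (1 : ℝ)).mul_const (G q v)
  have h4 : (fun c : ℝ => G q (c • v)) =ᶠ[nhds 1] (fun c : ℝ => c ^ 2 * G q v) := by
    filter_upwards [lt_mem_nhds (show (0 : ℝ) < 1 by norm_num)] with c hc
    exact hG.homog q v c hc
  exact h2.unique (h3.congr_of_eventuallyEq h4)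

theorem mono_avoid (hG : IsFinslerEnergy n G ℓ α) (q v₁ v₂ : Evec n)
    (h0 : ∀ τ ∈ Icc (0 : ℝ) 1, v₁ + τ • (v₂ - v₁) ≠ 0) :
    α * ‖v₂ - v₁‖ ^ 2 ≤ (dvCLM G q v₂ - dvCLM G q v₁) (v₂ - v₁) := by
  set w := v₂ - v₁ with hw
  have hd : ∀ τ ∈ Icc (0 : ℝ) 1, HasDerivAt (fun τ : ℝ => dvCLM G q (v₁ + τ • w) w)
      (fderiv ℝ (fun u => dvCLM G q u w) (v₁ + τ • w) w) τ := by
    intro τ hτ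
    have e1 : DifferentiableAt ℝ (fun u => dvCLM G q u w) (v₁ + τ • w) := by
      have := (dv_contDiffAt hG (q := q) (h0 τ hτ)).differentiableAt (by norm_num)
      have h2 : DifferentiableAt ℝ (fun u : Evec n => (q, u)) (v₁ + τ • w) := by fun_prop
      have h3 : DifferentiableAt ℝ (fun u => dvCLM G q u) (v₁ + τ • w) :=
        DifferentiableAt.comp (g := fun p : Evec n × Evec n => dvCLM G p.1 p.2)
          (f := fun u : Evec n => (q, u)) (v₁ + τ • w) this h2
      exact h3.clm_apply (differentiableAt_const w)
    have e2 : HasDerivAt (fun τ : ℝ => v₁ + τ • w) w τ := by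
      simpa using ((hasDerivAt_id τ).smul_const w).const_add v₁
    exact e1.hasFDerivAt.comp_hasDerivAt τ e2
  have := (convex_Icc (0 : ℝ) 1).mul_sub_le_image_sub_of_le_deriv
    (f := fun τ : ℝ => dvCLM G q (v₁ + τ • w) w) (C := α * ‖w‖ ^ 2)
    (fun τ hτ => (hd τ hτ).continuousAt.continuousWithinAt)
    (fun τ hτ => (hd τ (interior_subset hτ)).differentiableAt.differentiableWithinAt)
    (fun τ hτ => by
      rw [(hd τ (interior_subset hτ)).deriv]
      exact hG.vv_convex q _ (h0 τ (interior_subset hτ)) w)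
    0 (by simp) 1 (by simp) (by norm_num)
  simp only [sub_zero, mul_one, one_smul, zero_smul, add_zero] at this
  rw [show v₁ + w = v₂ by rw [hw]; abel] at this
  simpa using this

theorem alpha_le (hG : IsFinslerEnergy n G ℓ α) (q v : Evec n) :
    α * ‖v‖ ^ 2 ≤ dvCLM G q v v := by
  by_cases hv : v = 0
  · subst hv; simp
  have h := mono_avoid hG q v ((2 : ℝ) • v) (by
    intro τ hτ h
    have : v + τ • ((2 : ℝ) • v - v) = (1 + τ) • v := by module
    rw [this, smul_eq_zero] at h
    rcases h with h | h
    · linarith [hτ.1]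
    · exact hv h)
  rw [dv_homog hG q v two_pos] at h
  have e : (2 : ℝ) • v - v = v := by module
  rw [e] at h
  have e2 : ((2 : ℝ) • dvCLM G q v - dvCLM G q v) v = dvCLM G q v v := by
    simp; ring
  rwa [e2] at h

theorem mono_strong (hG : IsFinslerEnergy n G ℓ α) (q v₁ v₂ : Evec n) :
    α * ‖v₂ - v₁‖ ^ 2 ≤ (dvCLM G q v₂ - dvCLM G q v₁) (v₂ - v₁) := by
  by_cases h0 : ∀ τ ∈ Icc (0 : ℝ) 1, v₁ + τ • (v₂ - v₁) ≠ 0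
  · exact mono_avoid hG q v₁ v₂ h0
  push Not at h0
  obtain ⟨τ, hτ, h⟩ := h0
  set w := v₂ - v₁ with hw
  have e1 : v₁ = -(τ • w) := eq_neg_of_add_eq_zero_left h
  have e2 : v₂ = (1 - τ) • w := by
    have : v₂ = v₁ + w := by rw [hw]; abel
    rw [this]; nth_rewrite 1 [e1]; module
  -- v₂ side
  have k2 : α * (1 - τ) * ‖w‖ ^ 2 ≤ dvCLM G q v₂ w := by
    rcases eq_or_lt_of_le hτ.2 with h1 | h1
    · have : v₂ = 0 := by rw [e2, h1]; simp
      rw [this, dv_zero hG, h1]; simp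
    · have hp : 0 < 1 - τ := by linarith
      have := alpha_le hG q v₂
      nth_rewrite 3 [e2] at this
      rw [e2, norm_smul, map_smul, Real.norm_of_nonneg hp.le, smul_eq_mul, ← e2] at this
      refine le_of_mul_le_mul_left ?_ hp
      calc _ = α * ((1 - τ) * ‖w‖) ^ 2 := by ring
        _ ≤ _ := this
  have k1 : α * τ * ‖w‖ ^ 2 ≤ - dvCLM G q v₁ w := by
    rcases eq_or_lt_of_le hτ.1 with h1 | h1
    · have : v₁ = 0 := by rw [e1, ← h1]; simp
      rw [this, dv_zero hG, ← h1]; simp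
    · have := alpha_le hG q v₁
      nth_rewrite 3 [e1] at this
      rw [e1, norm_neg, norm_smul, map_neg, map_smul, Real.norm_of_nonneg h1.le, smul_eq_mul,
        ← e1] at this
      refine le_of_mul_le_mul_left ?_ h1
      calc _ = α * (τ * ‖w‖) ^ 2 := by ring
        _ ≤ _ := this
        _ = _ := by ring
  rw [sub_apply]
  nlinarith

/-- Lipschitz estimate for `d_vG` on bounded sets of base points. -/
theorem dv_lip (hG : IsFinslerEnergy n G ℓ α) (R : ℝ) :
    ∃ C : ℝ, 0 ≤ C ∧ ∀ q₁ q₂ v₁ v₂ : Evec n, ‖q₁‖ ≤ R → ‖q₂‖ ≤ R →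
      ‖dvCLM G q₁ v₁ - dvCLM G q₂ v₂‖ ≤ C * ‖v₁ - v₂‖ + C * ‖v₂‖ * ‖q₁ - q₂‖ := by
  have hl := ell_pos hG
  have hK : IsCompact (Metric.closedBall (0 : Evec n) R ×ˢ Metric.sphere (0 : Evec n) 1) :=
    (isCompact_closedBall _ _).prod (isCompact_sphere _ _)
  obtain ⟨L, hL⟩ := LocallyLipschitzOn.exists_lipschitzOnWith_of_compact
    (f := fun p : Evec n × Evec n => dvCLM G p.1 p.2) hK (by
      rintro ⟨q, v⟩ ⟨_, hv⟩
      have hv0 : v ≠ 0 := by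
        rintro rfl; simp at hv
      obtain ⟨K, t, ht, h⟩ := (dv_contDiffAt hG (q := q) hv0).exists_lipschitzOnWith
      exact ⟨K, t, mem_nhdsWithin_of_mem_nhds ht, h⟩)
  refine ⟨ℓ + 2 * L, by positivity, ?_⟩
  intro q₁ q₂ v₁ v₂ hq₁ hq₂
  have hLn : (0 : ℝ) ≤ L := L.2
  by_cases h1 : v₁ = 0
  · subst h1
    rw [dv_zero hG, zero_sub, norm_neg, zero_sub, norm_neg]
    have := dv_le hG q₂ v₂
    have : 0 ≤ (ℓ + 2 * L) * ‖v₂‖ * ‖q₁ - q₂‖ := by positivity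
    have : 0 ≤ L * ‖v₂‖ := by positivity
    nlinarith
  by_cases h2 : v₂ = 0
  · subst h2
    rw [dv_zero hG, sub_zero, sub_zero]
    have := dv_le hG q₁ v₁
    have : 0 ≤ L * ‖v₁‖ := by positivity
    simp only [norm_zero, mul_zero, zero_mul, add_zero]
    nlinarith
  have r1 : 0 < ‖v₁‖ := norm_pos_iff.2 h1
  have r2 : 0 < ‖v₂‖ := norm_pos_iff.2 h2
  set u₁ := (‖v₁‖⁻¹) • v₁ with hu₁
  set u₂ := (‖v₂‖⁻¹) • v₂ with hu₂
  have n1 : ‖u₁‖ = 1 := by rw [hu₁, norm_smul]; simp; field_simp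
  have n2 : ‖u₂‖ = 1 := by rw [hu₂, norm_smul]; simp; field_simp
  have e1 : v₁ = ‖v₁‖ • u₁ := by rw [hu₁, smul_smul]; field_simp; simp
  have e2 : v₂ = ‖v₂‖ • u₂ := by rw [hu₂, smul_smul]; field_simp; simp
  have p1 : dvCLM G q₁ v₁ = ‖v₁‖ • dvCLM G q₁ u₁ := by
    nth_rewrite 1 [e1]; exact dv_homog hG _ _ r1
  have p2 : dvCLM G q₂ v₂ = ‖v₂‖ • dvCLM G q₂ u₂ := by
    nth_rewrite 1 [e2]; exact dv_homog hG _ _ r2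
  have hlip : ‖dvCLM G q₁ u₁ - dvCLM G q₂ u₂‖ ≤ L * (‖q₁ - q₂‖ + ‖u₁ - u₂‖) := by
    have := hL.dist_le_mul (q₁, u₁) ⟨by simpa using hq₁, by simpa using n1⟩
      (q₂, u₂) ⟨by simpa using hq₂, by simpa using n2⟩
    rw [dist_eq_norm] at this
    refine this.trans ?_
    gcongr
    rw [Prod.dist_eq, dist_eq_norm, dist_eq_norm]
    exact max_le (by simp) (by simp)
  have hu : ‖v₂‖ * ‖u₁ - u₂‖ ≤ 2 * ‖v₁ - v₂‖ := by
    have : ‖v₂‖ * ‖u₁ - u₂‖ = ‖‖v₂‖ • (u₁ - u₂)‖ := by rw [norm_smul]; simp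
    rw [this]
    have : ‖v₂‖ • (u₁ - u₂) = (‖v₂‖ - ‖v₁‖) • u₁ + (v₁ - v₂) := by
      have e3 : v₁ - v₂ = ‖v₁‖ • u₁ - ‖v₂‖ • u₂ := by rw [← e1, ← e2]
      rw [e3]; module
    rw [this]
    calc _ ≤ ‖(‖v₂‖ - ‖v₁‖) • u₁‖ + ‖v₁ - v₂‖ := norm_add_le _ _
      _ = |‖v₂‖ - ‖v₁‖| + ‖v₁ - v₂‖ := by rw [norm_smul, n1, mul_one, Real.norm_eq_abs]
      _ ≤ ‖v₁ - v₂‖ + ‖v₁ - v₂‖ := by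
        gcongr; rw [norm_sub_rev]; exact abs_norm_sub_norm_le _ _
      _ = _ := by ring
  have hdec : dvCLM G q₁ v₁ - dvCLM G q₂ v₂ = (‖v₁‖ - ‖v₂‖) • dvCLM G q₁ u₁
      + ‖v₂‖ • (dvCLM G q₁ u₁ - dvCLM G q₂ u₂) := by
    rw [p1, p2]; module
  have hb1 : ‖dvCLM G q₁ u₁‖ ≤ ℓ := by have := dv_le hG q₁ u₁; rwa [n1, mul_one] at this
  rw [hdec]
  calc _ ≤ ‖(‖v₁‖ - ‖v₂‖) • dvCLM G q₁ u₁‖ + ‖‖v₂‖ • (dvCLM G q₁ u₁ - dvCLM G q₂ u₂)‖ :=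
        norm_add_le _ _
    _ ≤ ‖v₁ - v₂‖ * ℓ + ‖v₂‖ * (L * (‖q₁ - q₂‖ + ‖u₁ - u₂‖)) := by
        rw [norm_smul, norm_smul, norm_norm, Real.norm_eq_abs]
        gcongr
        exact abs_norm_sub_norm_le _ _
    _ = ‖v₁ - v₂‖ * ℓ + L * (‖v₂‖ * ‖u₁ - u₂‖) + L * ‖v₂‖ * ‖q₁ - q₂‖ := by ring
    _ ≤ ‖v₁ - v₂‖ * ℓ + L * (2 * ‖v₁ - v₂‖) + (ℓ + 2 * L) * ‖v₂‖ * ‖q₁ - q₂‖ := by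
        gcongr
        linarith
    _ = _ := by ring

end PartA


/-! ### Part B: absolutely continuous curves -/

section PartB
set_option linter.unusedSectionVars false
variable {X Y : Type*} [NormedAddCommGroup X] [NormedSpace ℝ X]
  [NormedAddCommGroup Y] [NormedSpace ℝ Y]

/-- `y` is absolutely continuous on `[0,1]` with derivative `u`. -/
def IsAC (y u : ℝ → X) : Prop :=
  IntervalIntegrable u volume 0 1 ∧ ∀ t ∈ Icc (0:ℝ) 1, y t = y 0 + ∫ s in (0:ℝ)..t, u s

theorem ac_of_dist_le {h : ℝ → X} {k : ℝ → Y} {a b C : ℝ} (hC : 0 ≤ C)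
    (hd : ∀ s ∈ uIcc a b, ∀ t ∈ uIcc a b, dist (h s) (h t) ≤ C * dist (k s) (k t))
    (hk : AbsolutelyContinuousOnInterval k a b) : AbsolutelyContinuousOnInterval h a b := by
  rw [absolutelyContinuousOnInterval_iff] at hk ⊢
  intro ε hε
  obtain ⟨δ, hδ, H⟩ := hk (ε / (C + 1)) (by positivity)
  refine ⟨δ, hδ, fun E hE hE2 => ?_⟩
  have h1 := H E hE hE2
  calc _ ≤ ∑ i ∈ Finset.range E.1, C * dist (k (E.2 i).1) (k (E.2 i).2) := by
        apply Finset.sum_le_sum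
        intro i hi
        exact hd _ (hE.left i hi).left _ (hE.left i hi).right
    _ = C * ∑ i ∈ Finset.range E.1, dist (k (E.2 i).1) (k (E.2 i).2) := by
        rw [Finset.mul_sum]
    _ ≤ C * (ε / (C + 1)) := by gcongr
    _ < (C + 1) * (ε / (C + 1)) := by gcongr; linarith
    _ = ε := by field_simp

theorem sub_Icc {s t : ℝ} (hs : s ∈ Icc (0:ℝ) 1) (ht : t ∈ Icc (0:ℝ) 1) :
    uIcc s t ⊆ uIcc (0:ℝ) 1 := by
  rw [uIcc_of_le (zero_le_one' ℝ)]
  exact uIcc_subset_Icc hs ht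

theorem IsAC.intble {y u : ℝ → X} (h : IsAC y u) {s t : ℝ} (hs : s ∈ Icc (0:ℝ) 1)
    (ht : t ∈ Icc (0:ℝ) 1) : IntervalIntegrable u volume s t :=
  h.1.mono_set (sub_Icc hs ht)

theorem IsAC.sub_eq {y u : ℝ → X} (h : IsAC y u) {s t : ℝ} (hs : s ∈ Icc (0:ℝ) 1)
    (ht : t ∈ Icc (0:ℝ) 1) : y t - y s = ∫ r in s..t, u r := by
  have h0 : (0:ℝ) ∈ Icc (0:ℝ) 1 := by simp
  rw [h.2 t ht, h.2 s hs, ← intervalIntegral.integral_interval_sub_left (h.intble h0 ht)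
    (h.intble h0 hs)]
  abel

theorem IsAC.ac {y u : ℝ → X} (h : IsAC y u) : AbsolutelyContinuousOnInterval y 0 1 := by
  have h1 : IntervalIntegrable (fun s => ‖u s‖) volume 0 1 := h.1.norm
  have h2 := h1.absolutelyContinuousOnInterval_intervalIntegral (c := 0) (by simp)
  refine ac_of_dist_le (C := 1) zero_le_one ?_ h2
  intro s hs t ht
  rw [uIcc_of_le (zero_le_one' ℝ)] at hs ht
  have h0 : (0:ℝ) ∈ Icc (0:ℝ) 1 := by simp
  rw [one_mul, dist_comm, dist_eq_norm, h.sub_eq hs ht, dist_comm, dist_eq_norm,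
    intervalIntegral.integral_interval_sub_left (h1.mono_set (sub_Icc h0 ht))
      (h1.mono_set (sub_Icc h0 hs)), Real.norm_eq_abs]
  exact intervalIntegral.norm_integral_le_abs_integral_norm

theorem IsAC.continuousOn {y u : ℝ → X} (h : IsAC y u) : ContinuousOn y (Icc 0 1) := by
  have := h.ac.continuousOn
  rwa [uIcc_of_le (zero_le_one' ℝ)] at this

theorem ae_Ioo : ∀ᵐ s : ℝ, s ∈ Icc (0:ℝ) 1 → s ∈ Ioo (0:ℝ) 1 := by
  have h0 : ∀ᵐ s : ℝ, s ≠ 0 := by simp [ae_iff]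
  have h1 : ∀ᵐ s : ℝ, s ≠ 1 := by simp [ae_iff]
  filter_upwards [h0, h1] with s h0 h1 hs
  exact ⟨lt_of_le_of_ne hs.1 h0.symm, lt_of_le_of_ne hs.2 h1⟩

theorem IsAC.ae_hasDerivAt [CompleteSpace X] {y u : ℝ → X} (h : IsAC y u) :
    ∀ᵐ s : ℝ, s ∈ Icc (0:ℝ) 1 → HasDerivAt y (u s) s := by
  filter_upwards [h.1.ae_hasDerivAt_integral, ae_Ioo] with s hs hs2 hs3
  have hs' := hs2 hs3
  have h1 := (hs (by rwa [uIcc_of_le (zero_le_one' ℝ)]) 0 (by simp)).const_add (y 0)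
  refine h1.congr_of_eventuallyEq ?_
  filter_upwards [Icc_mem_nhds hs'.1 hs'.2] with t ht
  exact h.2 t ht

theorem isAC_of_ac [CompleteSpace X] {y u : ℝ → X} (h : AbsolutelyContinuousOnInterval y 0 1)
    (hu : IntervalIntegrable u volume 0 1)
    (hd : ∀ᵐ s : ℝ, s ∈ Icc (0:ℝ) 1 → HasDerivAt y (u s) s) : IsAC y u := by
  have hI : IsAC (fun t => ∫ s in (0:ℝ)..t, u s) u := ⟨hu, fun t _ => by simp⟩
  have h1 := h.sub hI.ac
  obtain ⟨C, hC⟩ := h1.const_of_ae_hasDerivAt_zero (by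
    filter_upwards [hd, hI.ae_hasDerivAt] with s h1 h2 hs
    rw [uIcc_of_le (zero_le_one' ℝ)] at hs
    simpa using (h1 hs).sub (h2 hs))
  refine ⟨hu, fun t ht => ?_⟩
  rw [uIcc_of_le (zero_le_one' ℝ)] at hC
  have e1 := hC t ht
  have e0 := hC 0 (by simp)
  simp only [Pi.sub_apply, intervalIntegral.integral_same, sub_zero] at e0 e1
  rw [e0, ← e1]; abel

theorem IsAC.bounded {y u : ℝ → X} (h : IsAC y u) : ∃ R, ∀ s ∈ Icc (0:ℝ) 1, ‖y s‖ ≤ R :=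
  isCompact_Icc.exists_bound_of_continuousOn h.continuousOn

/-- Chain rule. -/
theorem IsAC.comp [FiniteDimensional ℝ X] [CompleteSpace Y] {y u : ℝ → X} (h : IsAC y u)
    {F : X → Y} (hF : ContDiff ℝ 1 F)
    (hi : IntervalIntegrable (fun s => fderiv ℝ F (y s) (u s)) volume 0 1) :
    IsAC (fun s => F (y s)) (fun s => fderiv ℝ F (y s) (u s)) := by
  have : CompleteSpace X := FiniteDimensional.complete ℝ X
  have : ProperSpace X := FiniteDimensional.proper ℝ X
  obtain ⟨R, hR⟩ := h.bounded
  obtain ⟨K, hK⟩ := (hF.contDiffOn (s := Metric.closedBall (0:X) R)).exists_lipschitzOnWith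
    (by norm_num) (convex_closedBall _ _) (isCompact_closedBall _ _)
  refine isAC_of_ac (ac_of_dist_le (C := K) K.2 ?_ h.ac) hi ?_
  · intro s hs t ht
    rw [uIcc_of_le (zero_le_one' ℝ)] at hs ht
    exact hK.dist_le_mul _ (by simpa using hR s hs) _ (by simpa using hR t ht)
  · filter_upwards [h.ae_hasDerivAt] with s hs hs'
    exact ((hF.differentiable (by norm_num)) (y s)).hasFDerivAt.comp_hasDerivAt s (hs hs')

theorem IsAC.lip {y u : ℝ → X} (h : IsAC y u) {K : ℝ}
    (hb : ∀ᵐ s : ℝ, s ∈ Icc (0:ℝ) 1 → ‖u s‖ ≤ K) :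
    ∀ s ∈ Icc (0:ℝ) 1, ∀ t ∈ Icc (0:ℝ) 1, ‖y t - y s‖ ≤ K * |t - s| := by
  intro s hs t ht
  rw [h.sub_eq hs ht]
  refine intervalIntegral.norm_integral_le_of_norm_le_const_ae ?_
  filter_upwards [hb] with r hr hr2
  have := sub_Icc hs ht (uIoc_subset_uIcc hr2)
  rw [uIcc_of_le (zero_le_one' ℝ)] at this
  exact hr this

/-! Trapezoid test functions -/

def ramp (s ε r : ℝ) : ℝ := ε⁻¹ * max 0 (min r (s + ε) - s)

def dramp (s ε r : ℝ) : ℝ := (Ioc s (s + ε)).indicator (fun _ => ε⁻¹) r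

theorem dramp_integral {F : Type*} [NormedAddCommGroup F] [NormedSpace ℝ F] (b : ℝ → F)
    {s ε T : ℝ} (hs : 0 ≤ s) (hε : 0 < ε) (hT : s + ε ≤ T) :
    ∫ r in (0:ℝ)..T, dramp s ε r • b r = ε⁻¹ • ∫ r in s..(s + ε), b r := by
  have : ∀ r, dramp s ε r • b r = (Ioc s (s + ε)).indicator (fun r => ε⁻¹ • b r) r := by
    intro r
    unfold dramp
    by_cases hr : r ∈ Ioc s (s + ε) <;> simp [hr]
  simp_rw [this]
  rw [intervalIntegral.integral_of_le (by linarith), setIntegral_indicator measurableSet_Ioc,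
    inter_eq_right.2 (Ioc_subset_Ioc hs hT), integral_smul,
    intervalIntegral.integral_of_le (by linarith)]

theorem dramp_meas (s ε : ℝ) : Measurable (dramp s ε) :=
  measurable_const.indicator measurableSet_Ioc

theorem dramp_bound {s ε : ℝ} (hε : 0 < ε) (r : ℝ) : ‖dramp s ε r‖ ≤ ε⁻¹ := by
  have h : 0 < ε⁻¹ := by positivity
  unfold dramp
  by_cases hr : r ∈ Ioc s (s + ε)
  · simp [hr, abs_of_pos hε]
  · simp [hr, hε.le]

theorem dramp_smul_intble {F : Type*} [NormedAddCommGroup F] [NormedSpace ℝ F] {b : ℝ → F}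
    {s ε : ℝ} (hε : 0 < ε) (hb : IntervalIntegrable b volume 0 1) :
    IntervalIntegrable (fun r => dramp s ε r • b r) volume 0 1 := by
  rw [intervalIntegrable_iff] at hb ⊢
  exact Integrable.bdd_smul hb ε⁻¹ (dramp_meas s ε).aestronglyMeasurable
    (ae_of_all _ fun r => dramp_bound hε r)

theorem ramp_isAC {s ε : ℝ} (hs : 0 ≤ s) (hε : 0 < ε) :
    IsAC (ramp s ε) (dramp s ε) := by
  refine ⟨?_, fun t ht => ?_⟩
  · have := dramp_smul_intble (s := s) (b := fun _ => (1:ℝ)) hε (by simp)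
    simpa using this
  · have h0 : ramp s ε 0 = 0 := by
      unfold ramp; rw [min_eq_left (by linarith), max_eq_left (by linarith), mul_zero]
    rw [h0, zero_add]
    unfold dramp ramp
    rw [intervalIntegral.integral_of_le ht.1, setIntegral_indicator measurableSet_Ioc,
      Ioc_inter_Ioc, setIntegral_const, sup_eq_right.2 hs]
    simp only [measureReal_def, Real.volume_Ioc, smul_eq_mul, ENNReal.toReal_ofReal']
    rw [mul_comm, max_comm]

theorem ramp_eq_zero {s ε r : ℝ} (hr : r ≤ s) : ramp s ε r = 0 := by
  unfold ramp
  rw [max_eq_left, mul_zero]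
  linarith [min_le_left r (s + ε)]

theorem ramp_eq_one {s ε r : ℝ} (hε : 0 < ε) (hr : s + ε ≤ r) : ramp s ε r = 1 := by
  unfold ramp
  rw [min_eq_right hr, max_eq_right (by linarith)]
  field_simp; ring

theorem ramp_nonneg {s ε r : ℝ} (hε : 0 < ε) : 0 ≤ ramp s ε r := by
  unfold ramp; positivity

theorem ramp_le_one {s ε r : ℝ} (hε : 0 < ε) : ramp s ε r ≤ 1 := by
  unfold ramp
  rw [inv_mul_le_iff₀ hε, mul_one]
  refine max_le hε.le ?_
  linarith [min_le_right r (s + ε)]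

theorem ramp_anti {s t ε r : ℝ} (hε : 0 < ε) (hst : s ≤ t) : ramp t ε r ≤ ramp s ε r := by
  unfold ramp
  have : min r (t + ε) - t ≤ min r (s + ε) - s := by
    rcases le_total r (s + ε) with h | h
    · rw [min_eq_left h, min_eq_left (by linarith)]; linarith
    · rw [min_eq_right h]; linarith [min_le_right r (t + ε)]
  gcongr

def trap (s t ε r : ℝ) : ℝ := ramp s ε r - ramp t ε r
def dtrap (s t ε r : ℝ) : ℝ := dramp s ε r - dramp t ε r

theorem IsAC.sub {y u z w : ℝ → X} (h : IsAC y u) (h' : IsAC z w) :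
    IsAC (fun t => y t - z t) (fun t => u t - w t) := by
  have h0 : (0:ℝ) ∈ Icc (0:ℝ) 1 := by simp
  refine ⟨h.1.sub h'.1, fun t ht => ?_⟩
  rw [intervalIntegral.integral_sub (h.intble h0 ht) (h'.intble h0 ht)]
  simp only [h.2 t ht, h'.2 t ht]
  abel

theorem trap_isAC {s t ε : ℝ} (hs : 0 ≤ s) (ht : 0 ≤ t) (hε : 0 < ε) :
    IsAC (trap s t ε) (dtrap s t ε) := (ramp_isAC hs hε).sub (ramp_isAC ht hε)

theorem trap_nonneg {s t ε r : ℝ} (hε : 0 < ε) (hst : s ≤ t) : 0 ≤ trap s t ε r :=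
  sub_nonneg.2 (ramp_anti hε hst)

theorem trap_le_one {s t ε r : ℝ} (hε : 0 < ε) : trap s t ε r ≤ 1 := by
  have := ramp_le_one (s := s) (r := r) hε
  have := ramp_nonneg (s := t) (r := r) hε
  unfold trap; linarith

theorem trap_zero {s t ε r : ℝ} (hε : 0 < ε) (hst : s ≤ t) (hr : r ∉ Icc s (t + ε)) :
    trap s t ε r = 0 := by
  unfold trap
  rw [mem_Icc, not_and_or] at hr
  rcases hr with h | h
  · push Not at h
    rw [ramp_eq_zero h.le, ramp_eq_zero (by linarith), sub_zero]
  · push Not at h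
    rw [ramp_eq_one hε (by linarith), ramp_eq_one hε h.le, sub_self]

theorem trap_meas (s t ε : ℝ) : Continuous (trap s t ε) := by
  unfold trap ramp; fun_prop

theorem trap_tendsto (s t r : ℝ) (hst : s < t) :
    Tendsto (fun ε => trap s t ε r) (nhdsWithin 0 (Ioi 0))
      (nhds ((Ioc s t).indicator (fun _ => (1:ℝ)) r)) := by
  refine tendsto_const_nhds.congr' ?_
  by_cases hr : r ∈ Ioc s t
  · have h1 : ∀ᶠ ε in nhdsWithin (0:ℝ) (Ioi 0), ε < r - s :=
      nhdsWithin_le_nhds (gt_mem_nhds (by linarith [hr.1]))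
    filter_upwards [h1, self_mem_nhdsWithin] with ε h1 h2
    unfold trap
    rw [ramp_eq_one h2 (by linarith), ramp_eq_zero hr.2]
    simp [hr]
  · simp only [hr, not_false_eq_true, indicator_of_notMem]
    by_cases h : r ≤ s
    · filter_upwards with ε
      unfold trap
      rw [ramp_eq_zero h, ramp_eq_zero (by linarith), sub_zero]
    · have hr2 : t < r := by
        by_contra h3
        exact hr ⟨not_le.1 h, not_lt.1 h3⟩
      have h1 : ∀ᶠ ε in nhdsWithin (0:ℝ) (Ioi 0), ε < r - t :=
        nhdsWithin_le_nhds (gt_mem_nhds (by linarith))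
      filter_upwards [h1, self_mem_nhdsWithin] with ε h1 h2
      rw [trap_zero h2 hst.le]
      rintro ⟨_, h4⟩
      linarith

/-- du Bois-Reymond limit. -/
theorem dbr {F : Type*} [NormedAddCommGroup F] [NormedSpace ℝ F] {a b : ℝ → F} {s t : ℝ}
    (ha : IntervalIntegrable a volume 0 1) (hb : IntervalIntegrable b volume 0 1)
    (hs : 0 < s) (hst : s < t) (ht : t < 1)
    (hbs : HasDerivAt (fun r => ∫ z in (0:ℝ)..r, b z) (b s) s)
    (hbt : HasDerivAt (fun r => ∫ z in (0:ℝ)..r, b z) (b t) t) :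
    Tendsto (fun ε => ∫ r in (0:ℝ)..1, (trap s t ε r • a r + dtrap s t ε r • b r))
      (nhdsWithin 0 (Ioi 0)) (nhds ((∫ r in s..t, a r) + (b s - b t))) := by
  have hs1 : s ∈ Icc (0:ℝ) 1 := ⟨hs.le, by linarith⟩
  have ht1 : t ∈ Icc (0:ℝ) 1 := ⟨by linarith, ht.le⟩
  have h0 : (0:ℝ) ∈ Icc (0:ℝ) 1 := by simp
  have T1 : Tendsto (fun ε => ∫ r in (0:ℝ)..1, trap s t ε r • a r)
      (nhdsWithin 0 (Ioi 0)) (nhds (∫ r in s..t, a r)) := by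
    have e : ∫ r in s..t, a r = ∫ r in (0:ℝ)..1, (Ioc s t).indicator (fun _ => (1:ℝ)) r • a r := by
      rw [intervalIntegral.integral_of_le hst.le, intervalIntegral.integral_of_le zero_le_one]
      have : ∀ r, (Ioc s t).indicator (fun _ => (1:ℝ)) r • a r = (Ioc s t).indicator a r := by
        intro r
        by_cases hr : r ∈ Ioc s t <;> simp [hr]
      simp_rw [this]
      rw [setIntegral_indicator measurableSet_Ioc, inter_eq_right.2 (Ioc_subset_Ioc hs.le ht.le)]
    rw [e]
    refine intervalIntegral.tendsto_integral_filter_of_dominated_convergence (fun r => ‖a r‖)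
      ?_ ?_ ha.norm ?_
    · filter_upwards with ε
      exact (trap_meas s t ε).aestronglyMeasurable.smul
        (intervalIntegrable_iff.1 ha).aestronglyMeasurable
    · filter_upwards [self_mem_nhdsWithin] with ε hε
      refine ae_of_all _ fun r _ => ?_
      rw [norm_smul, Real.norm_of_nonneg (trap_nonneg hε hst.le)]
      exact mul_le_of_le_one_left (norm_nonneg _) (trap_le_one hε)
    · exact ae_of_all _ fun r _ => (trap_tendsto s t r hst).smul_const (a r)
  have T2 : ∀ z ∈ Ioo (0:ℝ) 1, HasDerivAt (fun r => ∫ z in (0:ℝ)..r, b z) (b z) z →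
      Tendsto (fun ε => ∫ r in (0:ℝ)..1, dramp z ε r • b r)
      (nhdsWithin 0 (Ioi 0)) (nhds (b z)) := by
    intro z hz hd
    have := hd.tendsto_slope_zero_right
    refine this.congr' ?_
    have h1 : ∀ᶠ ε in nhdsWithin (0:ℝ) (Ioi 0), ε < 1 - z :=
      nhdsWithin_le_nhds (gt_mem_nhds (by linarith [hz.2]))
    filter_upwards [h1, self_mem_nhdsWithin] with ε h1 h2
    have h2' : 0 < ε := h2
    rw [dramp_integral b hz.1.le h2 (by linarith),
      intervalIntegral.integral_interval_sub_left]
    · exact hb.mono_set (sub_Icc h0 ⟨by linarith [hz.1], by linarith⟩)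
    · exact hb.mono_set (sub_Icc h0 ⟨hz.1.le, hz.2.le⟩)
  refine (T1.add ((T2 s ⟨hs, by linarith⟩ hbs).sub (T2 t ⟨by linarith, ht⟩ hbt))).congr' ?_
  filter_upwards [self_mem_nhdsWithin] with ε hε
  have i1 := dramp_smul_intble (s := s) hε hb
  have i2 := dramp_smul_intble (s := t) hε hb
  have i3 : IntervalIntegrable (fun r => trap s t ε r • a r) volume 0 1 := by
    rw [intervalIntegrable_iff] at ha ⊢
    refine Integrable.bdd_smul ha 1 (trap_meas s t ε).aestronglyMeasurable
      (ae_of_all _ fun r => ?_)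
    rw [Real.norm_of_nonneg (trap_nonneg hε hst.le)]
    exact trap_le_one hε
  rw [← intervalIntegral.integral_sub i1 i2, ← intervalIntegral.integral_add i3 (i1.sub i2)]
  refine intervalIntegral.integral_congr fun r _ => ?_
  simp only [dtrap, sub_smul]

end PartB


/-! ### Part C: test fields -/

section PartC
set_option linter.unusedSectionVars false
variable {n : ℕ} {G : Evec n → Evec n → ℝ} {ℓ α : ℝ} {Φ : Evec n → ℝ} {δ₀ : ℝ}

theorem x_isAC (x : H1Curve n 0 1) : IsAC x.toFun x.deriv := by
  refine ⟨?_, x.eq_add_integral⟩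
  rw [intervalIntegrable_iff_integrableOn_Icc_of_le zero_le_one]
  exact x.deriv_integrable

theorem x_sq (x : H1Curve n 0 1) : IntervalIntegrable (fun s => ‖x.deriv s‖ ^ 2) volume 0 1 := by
  rw [intervalIntegrable_iff_integrableOn_Icc_of_le zero_le_one]
  exact x.deriv_sq_integrable

theorem x_meas (x : H1Curve n 0 1) :
    AEStronglyMeasurable (fun s => (x.toFun s, x.deriv s)) (volume.restrict (Ioc 0 1)) := by
  have h1 := ((x_isAC x).continuousOn.mono Ioc_subset_Icc_self).aestronglyMeasurable
    (μ := volume) measurableSet_Ioc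
  exact h1.prodMk (x.deriv_integrable.mono_set Ioc_subset_Icc_self).aestronglyMeasurable

theorem intble_of (x : H1Curve n 0 1) {F : Type*} [NormedAddCommGroup F] [NormedSpace ℝ F]
    {Ψ : Evec n × Evec n → F} (hΨ : Continuous Ψ) {C R : ℝ}
    (hR : ∀ s ∈ Icc (0:ℝ) 1, ‖x.toFun s‖ ≤ R)
    (hb : ∀ q v, ‖q‖ ≤ R → ‖Ψ (q, v)‖ ≤ C * (‖v‖ + ‖v‖ ^ 2)) :
    IntervalIntegrable (fun s => Ψ (x.toFun s, x.deriv s)) volume 0 1 := by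
  have h1 : IntervalIntegrable (fun s => C * (‖x.deriv s‖ + ‖x.deriv s‖ ^ 2)) volume 0 1 :=
    ((x_isAC x).1.norm.add (x_sq x)).const_mul C
  rw [intervalIntegrable_iff, uIoc_of_le zero_le_one] at h1 ⊢
  refine Integrable.mono' h1 (hΨ.comp_aestronglyMeasurable (x_meas x)) ?_
  rw [ae_restrict_iff' measurableSet_Ioc]
  exact ae_of_all _ fun s hs => hb _ _ (hR s (Ioc_subset_Icc_self hs))

theorem IsAC.smul {X : Type*} [NormedAddCommGroup X] [NormedSpace ℝ X] [CompleteSpace X]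
    {c d : ℝ → ℝ} {y u : ℝ → X} (hc : IsAC c d)
    (hy : IsAC y u) : IsAC (fun t => c t • y t) (fun t => c t • u t + d t • y t) := by
  refine isAC_of_ac (hc.ac.smul hy.ac) ?_ ?_
  · refine IntervalIntegrable.add ?_ ?_
    · exact hy.1.continuousOn_smul (by rw [uIcc_of_le zero_le_one]; exact hc.continuousOn)
    · exact hc.1.smul_continuousOn (by rw [uIcc_of_le zero_le_one]; exact hy.continuousOn)
  · filter_upwards [hc.ae_hasDerivAt, hy.ae_hasDerivAt] with s h1 h2 hs
    exact (h1 hs).smul (h2 hs)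

theorem bound_ball {X F : Type*} [NormedAddCommGroup X] [NormedSpace ℝ X] [FiniteDimensional ℝ X]
    [NormedAddCommGroup F] {f : X → F} (hf : Continuous f) (R : ℝ) :
    ∃ C, 0 ≤ C ∧ ∀ q, ‖q‖ ≤ R → ‖f q‖ ≤ C := by
  have : ProperSpace X := FiniteDimensional.proper ℝ X
  obtain ⟨C, hC⟩ := (isCompact_closedBall (0:X) R).exists_bound_of_continuousOn hf.continuousOn
  exact ⟨max C 0, le_max_right _ _, fun q hq => (hC q (by simpa using hq)).trans (le_max_left _ _)⟩

theorem fderiv_cont {X F : Type*} [NormedAddCommGroup X] [NormedSpace ℝ X]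
    [NormedAddCommGroup F] [NormedSpace ℝ F] {f : X → F} (hf : ContDiff ℝ 1 f) :
    Continuous (fderiv ℝ f) := hf.continuous_fderiv (by norm_num)

theorem comp_isAC (x : H1Curve n 0 1) {F : Type*} [NormedAddCommGroup F] [NormedSpace ℝ F]
    [CompleteSpace F] {V : Evec n → F} (hV : ContDiff ℝ 1 V) :
    IsAC (fun s => V (x.toFun s)) (fun s => fderiv ℝ V (x.toFun s) (x.deriv s)) := by
  obtain ⟨R, hR⟩ := (x_isAC x).bounded
  obtain ⟨C, hC0, hC⟩ := bound_ball (fderiv_cont hV) R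
  have hcont := fderiv_cont hV
  refine (x_isAC x).comp hV (intble_of x (Ψ := fun p => fderiv ℝ V p.1 p.2) (C := C) (R := R)
    (by fun_prop) hR ?_)
  intro q v hq
  calc _ ≤ ‖fderiv ℝ V q‖ * ‖v‖ := ContinuousLinearMap.le_opNorm _ _
    _ ≤ C * ‖v‖ := by gcongr; exact hC q hq
    _ ≤ _ := by gcongr; simp

def aV (G : Evec n → Evec n → ℝ) (V : Evec n → Evec n) (q v : Evec n) : ℝ :=
  dqCLM G q v (V q) + dvCLM G q v (fderiv ℝ V q v)

theorem aV_cont (hG : IsFinslerEnergy n G ℓ α) {V : Evec n → Evec n} (hV : ContDiff ℝ 1 V) :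
    Continuous (fun p : Evec n × Evec n => aV G V p.1 p.2) := by
  have h1 := dq_continuous hG
  have h2 := dv_continuous hG
  have h3 := fderiv_cont hV
  have h4 := hV.continuous
  unfold aV
  fun_prop

theorem aV_bound (hG : IsFinslerEnergy n G ℓ α) {V : Evec n → Evec n} (hV : ContDiff ℝ 1 V)
    (R : ℝ) : ∃ C, 0 ≤ C ∧ ∀ q v : Evec n, ‖q‖ ≤ R → ‖aV G V q v‖ ≤ C * (‖v‖ + ‖v‖ ^ 2) := by
  have hl := ell_pos hG
  obtain ⟨C1, hC1, H1⟩ := bound_ball hV.continuous R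
  obtain ⟨C2, hC2, H2⟩ := bound_ball (fderiv_cont hV) R
  refine ⟨ℓ * C1 + ℓ * C2, by positivity, fun q v hq => ?_⟩
  unfold aV
  calc _ ≤ ‖dqCLM G q v (V q)‖ + ‖dvCLM G q v (fderiv ℝ V q v)‖ := norm_add_le _ _
    _ ≤ ‖dqCLM G q v‖ * ‖V q‖ + ‖dvCLM G q v‖ * (‖fderiv ℝ V q‖ * ‖v‖) := by
      gcongr
      · exact ContinuousLinearMap.le_opNorm _ _
      · exact (ContinuousLinearMap.le_opNorm _ _).trans (by
          gcongr; exact ContinuousLinearMap.le_opNorm _ _)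
    _ ≤ (ℓ * ‖v‖ ^ 2) * C1 + (ℓ * ‖v‖) * (C2 * ‖v‖) := by
      gcongr
      · exact dq_le hG q v
      · exact H1 q hq
      · exact dv_le hG q v
      · exact H2 q hq
    _ = (ℓ * C1 + ℓ * C2) * ‖v‖ ^ 2 := by ring
    _ ≤ _ := by gcongr; simp

theorem bV_cont (hG : IsFinslerEnergy n G ℓ α) {V : Evec n → Evec n} (hV : Continuous V) :
    Continuous (fun p : Evec n × Evec n => dvCLM G p.1 p.2 (V p.1)) := by
  have h2 := dv_continuous hG
  fun_prop

theorem bV_bound (hG : IsFinslerEnergy n G ℓ α) {V : Evec n → Evec n} (hV : Continuous V)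
    (R : ℝ) : ∃ C, 0 ≤ C ∧ ∀ q v : Evec n, ‖q‖ ≤ R → ‖dvCLM G q v (V q)‖ ≤ C * ‖v‖ := by
  have hl := ell_pos hG
  obtain ⟨C1, hC1, H1⟩ := bound_ball hV R
  refine ⟨ℓ * C1, by positivity, fun q v hq => ?_⟩
  calc _ ≤ ‖dvCLM G q v‖ * ‖V q‖ := ContinuousLinearMap.le_opNorm _ _
    _ ≤ (ℓ * ‖v‖) * C1 := by
      gcongr
      · exact dv_le hG q v
      · exact H1 q hq
    _ = _ := by ring

theorem inner_grad (hΦ : IsRegularDomain n Φ δ₀) (q w : Evec n) :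
    ⟪gradient Φ q, w⟫ = fderiv ℝ Φ q w := by
  simp [gradient]

theorem aV_intble (hG : IsFinslerEnergy n G ℓ α) (x : H1Curve n 0 1)
    {V : Evec n → Evec n} (hV : ContDiff ℝ 1 V) :
    IntervalIntegrable (fun r => aV G V (x.toFun r) (x.deriv r)) volume 0 1 := by
  obtain ⟨R, hR⟩ := (x_isAC x).bounded
  obtain ⟨C, hC0, hC⟩ := aV_bound hG hV R
  exact intble_of x (Ψ := fun p => aV G V p.1 p.2) (aV_cont hG hV) hR hC

theorem bV_intble (hG : IsFinslerEnergy n G ℓ α) (x : H1Curve n 0 1)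
    {V : Evec n → Evec n} (hV : Continuous V) :
    IntervalIntegrable (fun r => dvCLM G (x.toFun r) (x.deriv r) (V (x.toFun r))) volume 0 1 := by
  obtain ⟨R, hR⟩ := (x_isAC x).bounded
  obtain ⟨C, hC0, hC⟩ := bV_bound hG hV R
  refine intble_of x (Ψ := fun p => dvCLM G p.1 p.2 (V p.1)) (bV_cont hG hV) hR
    (fun q v hq => (hC q v hq).trans ?_) (C := C)
  gcongr; simp

theorem dtrap_bound {s t ε : ℝ} (hε : 0 < ε) (r : ℝ) : ‖dtrap s t ε r‖ ≤ 2 * ε⁻¹ := by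
  have h1 := dramp_bound (s := s) hε r
  have h2 := dramp_bound (s := t) hε r
  unfold dtrap
  linarith [norm_sub_le (dramp s ε r) (dramp t ε r)]

theorem test (hG : IsFinslerEnergy n G ℓ α) (hΦ : IsRegularDomain n Φ δ₀) {x : H1Curve n 0 1}
    (hx : IsVCritical G Φ x) {V : Evec n → Evec n} (hV : ContDiff ℝ 1 V) {s t ε : ℝ}
    (hs : 0 < s) (hst : s < t) (hε : 0 < ε) (ht : t + ε < 1)
    (hc : ∀ r ∈ Icc s (t + ε), Φ (x.toFun r) = 0 → fderiv ℝ Φ (x.toFun r) (V (x.toFun r)) ≤ 0) :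
    0 ≤ ∫ r in (0:ℝ)..1, (trap s t ε r • aV G V (x.toFun r) (x.deriv r) +
      dtrap s t ε r • dvCLM G (x.toFun r) (x.deriv r) (V (x.toFun r))) := by
  have hac := (trap_isAC hs.le (hs.trans hst).le hε).smul (comp_isAC x hV)
  obtain ⟨R, hR⟩ := (x_isAC x).bounded
  obtain ⟨C1, hC1, H1⟩ := bound_ball hV.continuous R
  obtain ⟨C2, hC2, H2⟩ := bound_ball (fderiv_cont hV) R
  have hi := hac.1
  have hsq : IntegrableOn (fun r => ‖trap s t ε r • fderiv ℝ V (x.toFun r) (x.deriv r) +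
      dtrap s t ε r • V (x.toFun r)‖ ^ 2) (Icc 0 1) := by
    have hb : IntegrableOn (fun r => 2 * (C2 ^ 2 * ‖x.deriv r‖ ^ 2) + 2 * (2 * ε⁻¹ * C1) ^ 2)
        (Icc 0 1) := by
      refine Integrable.add ?_ ?_
      · exact (x.deriv_sq_integrable.const_mul (C2 ^ 2)).const_mul 2
      · exact integrable_const _
    refine Integrable.mono' hb ?_ ?_
    · rw [intervalIntegrable_iff_integrableOn_Icc_of_le zero_le_one] at hi
      exact hi.aestronglyMeasurable.norm.pow 2
    · rw [ae_restrict_iff' measurableSet_Icc]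
      refine ae_of_all _ fun r hr => ?_
      have e1 : ‖trap s t ε r • fderiv ℝ V (x.toFun r) (x.deriv r)‖ ≤ C2 * ‖x.deriv r‖ := by
        rw [norm_smul, Real.norm_of_nonneg (trap_nonneg hε hst.le)]
        calc _ ≤ 1 * (‖fderiv ℝ V (x.toFun r)‖ * ‖x.deriv r‖) := by
              gcongr
              · exact trap_le_one hε
              · exact ContinuousLinearMap.le_opNorm _ _
          _ ≤ _ := by rw [one_mul]; gcongr; exact H2 _ (hR r hr)
      have e2 : ‖dtrap s t ε r • V (x.toFun r)‖ ≤ 2 * ε⁻¹ * C1 := by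
        rw [norm_smul]
        gcongr
        · exact dtrap_bound hε r
        · exact H1 _ (hR r hr)
      rw [norm_pow, norm_norm]
      have e3 := norm_add_le (trap s t ε r • fderiv ℝ V (x.toFun r) (x.deriv r))
        (dtrap s t ε r • V (x.toFun r))
      calc _ ≤ (C2 * ‖x.deriv r‖ + 2 * ε⁻¹ * C1) ^ 2 := by gcongr; linarith
        _ ≤ _ := by nlinarith [sq_nonneg (C2 * ‖x.deriv r‖ - 2 * ε⁻¹ * C1)]
  let ξ : H1Curve n 0 1 :=
    { toFun := fun r => trap s t ε r • V (x.toFun r)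
      deriv := fun r => trap s t ε r • fderiv ℝ V (x.toFun r) (x.deriv r) +
        dtrap s t ε r • V (x.toFun r)
      deriv_integrable := by
        rw [intervalIntegrable_iff_integrableOn_Icc_of_le zero_le_one] at hi
        exact hi
      deriv_sq_integrable := hsq
      eq_add_integral := hac.2 }
  have hmem : MemVminus Φ x ξ := by
    refine ⟨?_, ?_, ?_⟩
    · have : trap s t ε 0 = 0 := trap_zero hε hst.le (fun h => by linarith [h.1])
      simp [ξ, this]
    · have : trap s t ε 1 = 0 := trap_zero hε hst.le (fun h => by linarith [h.2])
      simp [ξ, this]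
    · intro r hr h0
      change ⟪gradient Φ (x.toFun r), trap s t ε r • V (x.toFun r)⟫ ≤ 0
      rw [inner_smul_right, inner_grad hΦ]
      by_cases h : r ∈ Icc s (t + ε)
      · exact mul_nonpos_of_nonneg_of_nonpos (trap_nonneg hε hst.le) (hc r h h0)
      · rw [trap_zero hε hst.le h, zero_mul]
  have := hx.2 ξ hmem
  unfold dJ at this
  have h2 : 0 ≤ ∫ r in (0:ℝ)..1, (dqCLM G (x.toFun r) (x.deriv r) (ξ.toFun r) +
      dvCLM G (x.toFun r) (x.deriv r) (ξ.deriv r)) := by linarith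
  convert h2 using 1
  refine intervalIntegral.integral_congr fun r _ => ?_
  simp only [ξ, aV, map_add, map_smul, smul_eq_mul]
  ring

/-- Limit of the test inequality. -/
theorem test_lim (hG : IsFinslerEnergy n G ℓ α) (hΦ : IsRegularDomain n Φ δ₀) {x : H1Curve n 0 1}
    (hx : IsVCritical G Φ x) {V : Evec n → Evec n} (hV : ContDiff ℝ 1 V) {s t : ℝ}
    (hs : 0 < s) (hst : s < t) (ht : t < 1)
    (hbs : HasDerivAt (fun r => ∫ z in (0:ℝ)..r, dvCLM G (x.toFun z) (x.deriv z) (V (x.toFun z)))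
      (dvCLM G (x.toFun s) (x.deriv s) (V (x.toFun s))) s)
    (hbt : HasDerivAt (fun r => ∫ z in (0:ℝ)..r, dvCLM G (x.toFun z) (x.deriv z) (V (x.toFun z)))
      (dvCLM G (x.toFun t) (x.deriv t) (V (x.toFun t))) t)
    (hc : ∀ᶠ ε in nhdsWithin (0:ℝ) (Ioi 0), ∀ r ∈ Icc s (t + ε), Φ (x.toFun r) = 0 →
      fderiv ℝ Φ (x.toFun r) (V (x.toFun r)) ≤ 0) :
    dvCLM G (x.toFun t) (x.deriv t) (V (x.toFun t)) -
      dvCLM G (x.toFun s) (x.deriv s) (V (x.toFun s)) ≤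
      ∫ r in s..t, aV G V (x.toFun r) (x.deriv r) := by
  have h := dbr (aV_intble hG x hV) (bV_intble hG x hV.continuous) hs hst ht hbs hbt
  have h1 : ∀ᶠ ε in nhdsWithin (0:ℝ) (Ioi 0), ε < 1 - t :=
    nhdsWithin_le_nhds (gt_mem_nhds (by linarith))
  have h2 := ge_of_tendsto h (b := 0) (by
    filter_upwards [h1, hc, self_mem_nhdsWithin] with ε h1 h2 h3
    exact test hG hΦ hx hV hs hst h3 (by linarith) h2)
  linarith

/-! The normal field -/

def nf (Φ : Evec n → ℝ) (q : Evec n) : Evec n :=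
  (‖gradient Φ q‖ ^ 2 + Φ q ^ 2)⁻¹ • gradient Φ q

theorem dPhi_contDiff (hΦ : IsRegularDomain n Φ δ₀) : ContDiff ℝ 1 (fderiv ℝ Φ) :=
  hΦ.smooth.fderiv_right (by norm_num)

theorem grad_contDiff (hΦ : IsRegularDomain n Φ δ₀) : ContDiff ℝ 1 (gradient Φ) := by
  have : gradient Φ = fun q => (InnerProductSpace.toDual ℝ (Evec n)).symm (fderiv ℝ Φ q) := rfl
  rw [this]
  exact (LinearIsometryEquiv.contDiff _).comp (dPhi_contDiff hΦ)

theorem nf_contDiff (hΦ : IsRegularDomain n Φ δ₀) : ContDiff ℝ 1 (nf Φ) := by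
  have h1 := grad_contDiff hΦ
  have h2 : ContDiff ℝ 1 Φ := hΦ.smooth.of_le (by norm_num)
  unfold nf
  refine ContDiff.smul (ContDiff.inv ((h1.norm_sq ℝ).add (h2.pow 2)) ?_) h1
  intro q
  by_cases hq : Φ q = 0
  · have := hΦ.grad_ne_zero q (by rw [hq, abs_zero]; exact hΦ.delta0_pos.le)
    have : 0 < ‖gradient Φ q‖ := norm_pos_iff.2 this
    positivity
  · positivity

theorem dPhi_nf (hΦ : IsRegularDomain n Φ δ₀) {q : Evec n} (hq : Φ q = 0) :
    fderiv ℝ Φ q (nf Φ q) = 1 := by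
  have := hΦ.grad_ne_zero q (by rw [hq, abs_zero]; exact hΦ.delta0_pos.le)
  have : 0 < ‖gradient Φ q‖ := norm_pos_iff.2 this
  unfold nf
  rw [map_smul, ← inner_grad hΦ, real_inner_self_eq_norm_sq, hq, smul_eq_mul]
  field_simp
  simp

end PartC


/-! ### Part D: structure of the momentum -/

section PartD
set_option linter.unusedSectionVars false
set_option linter.unusedVariables false
variable {n : ℕ} {G : Evec n → Evec n → ℝ} {ℓ α : ℝ} {Φ : Evec n → ℝ} {δ₀ : ℝ}

def pN (G : Evec n → Evec n → ℝ) (x : H1Curve n 0 1) (s : ℝ) : Evec n →L[ℝ] ℝ :=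
  dvCLM G (x.toFun s) (x.deriv s)
def bN (G : Evec n → Evec n → ℝ) (Φ : Evec n → ℝ) (x : H1Curve n 0 1) (s : ℝ) : ℝ :=
  dvCLM G (x.toFun s) (x.deriv s) (nf Φ (x.toFun s))
def aN (G : Evec n → Evec n → ℝ) (Φ : Evec n → ℝ) (x : H1Curve n 0 1) (s : ℝ) : ℝ :=
  aV G (nf Φ) (x.toFun s) (x.deriv s)
def AN (G : Evec n → Evec n → ℝ) (Φ : Evec n → ℝ) (x : H1Curve n 0 1) (t : ℝ) : ℝ :=
  ∫ s in (0:ℝ)..t, aN G Φ x s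
def gN (G : Evec n → Evec n → ℝ) (Φ : Evec n → ℝ) (x : H1Curve n 0 1) (s : ℝ) : ℝ :=
  bN G Φ x s - AN G Φ x s
def dP (Φ : Evec n → ℝ) (x : H1Curve n 0 1) (s : ℝ) : Evec n →L[ℝ] ℝ :=
  fderiv ℝ Φ (x.toFun s)
def aPq (G : Evec n → Evec n → ℝ) (Φ : Evec n → ℝ) (q v : Evec n) : Evec n →L[ℝ] ℝ :=
  dqCLM G q v - aV G (nf Φ) q v • fderiv ℝ Φ q -
    dvCLM G q v (nf Φ q) • fderiv ℝ (fderiv ℝ Φ) q v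
def aP (G : Evec n → Evec n → ℝ) (Φ : Evec n → ℝ) (x : H1Curve n 0 1) (s : ℝ) :
    Evec n →L[ℝ] ℝ := aPq G Φ (x.toFun s) (x.deriv s)
def piN (G : Evec n → Evec n → ℝ) (Φ : Evec n → ℝ) (x : H1Curve n 0 1) (s : ℝ) :
    Evec n →L[ℝ] ℝ := pN G x s - bN G Φ x s • dP Φ x s

theorem AN_isAC (hG : IsFinslerEnergy n G ℓ α) (hΦ : IsRegularDomain n Φ δ₀) (x : H1Curve n 0 1) :
    IsAC (AN G Φ x) (aN G Φ x) :=
  ⟨aV_intble hG x (nf_contDiff hΦ), fun t _ => by simp [AN]⟩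

theorem aPq_bound (hG : IsFinslerEnergy n G ℓ α) (hΦ : IsRegularDomain n Φ δ₀) (R : ℝ) :
    ∃ C, 0 ≤ C ∧ ∀ q v : Evec n, ‖q‖ ≤ R → ‖aPq G Φ q v‖ ≤ C * (‖v‖ + ‖v‖ ^ 2) := by
  have hl := ell_pos hG
  obtain ⟨C1, hC1, H1⟩ := aV_bound hG (nf_contDiff hΦ) R
  obtain ⟨C2, hC2, H2⟩ := bound_ball (dPhi_contDiff hΦ).continuous R
  obtain ⟨C3, hC3, H3⟩ := bV_bound hG (nf_contDiff hΦ).continuous R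
  obtain ⟨C4, hC4, H4⟩ := bound_ball (fderiv_cont (dPhi_contDiff hΦ)) R
  refine ⟨ℓ + C1 * C2 + C3 * C4, by positivity, fun q v hq => ?_⟩
  unfold aPq
  have e1 := dq_le hG q v
  have e2 : ‖aV G (nf Φ) q v • fderiv ℝ Φ q‖ ≤ C1 * (‖v‖ + ‖v‖ ^ 2) * C2 := by
    rw [norm_smul]
    have := H1 q v hq
    have := H2 q hq
    gcongr
  have e3 : ‖dvCLM G q v (nf Φ q) • fderiv ℝ (fderiv ℝ Φ) q v‖ ≤ (C3 * ‖v‖) * (C4 * ‖v‖) := by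
    rw [norm_smul]
    have := H3 q v hq
    have := H4 q hq
    have h5 := (fderiv ℝ (fderiv ℝ Φ) q).le_opNorm v
    gcongr
    exact h5.trans (by gcongr)
  have e4 := norm_sub_le (dqCLM G q v - aV G (nf Φ) q v • fderiv ℝ Φ q)
    (dvCLM G q v (nf Φ q) • fderiv ℝ (fderiv ℝ Φ) q v)
  have e5 := norm_sub_le (dqCLM G q v) (aV G (nf Φ) q v • fderiv ℝ Φ q)
  have e6 : 0 ≤ C3 * C4 * ‖v‖ := by positivity
  have e7 : 0 ≤ ℓ * ‖v‖ := by positivity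
  nlinarith

theorem aPq_cont (hG : IsFinslerEnergy n G ℓ α) (hΦ : IsRegularDomain n Φ δ₀) :
    Continuous (fun p : Evec n × Evec n => aPq G Φ p.1 p.2) := by
  have h1 := dq_continuous hG
  have h2 := dv_continuous hG
  have h3 := aV_cont hG (nf_contDiff hΦ)
  have h4 := (dPhi_contDiff hΦ).continuous
  have h5 := fderiv_cont (dPhi_contDiff hΦ)
  have h6 := (nf_contDiff hΦ).continuous
  unfold aPq
  fun_prop

theorem aP_intble (hG : IsFinslerEnergy n G ℓ α) (hΦ : IsRegularDomain n Φ δ₀)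
    (x : H1Curve n 0 1) : IntervalIntegrable (aP G Φ x) volume 0 1 := by
  obtain ⟨R, hR⟩ := (x_isAC x).bounded
  obtain ⟨C, hC0, hC⟩ := aPq_bound hG hΦ R
  exact intble_of x (Ψ := fun p => aPq G Φ p.1 p.2) (aPq_cont hG hΦ) hR hC

theorem bN_intble (hG : IsFinslerEnergy n G ℓ α) (hΦ : IsRegularDomain n Φ δ₀)
    (x : H1Curve n 0 1) : IntervalIntegrable (bN G Φ x) volume 0 1 :=
  bV_intble hG x (nf_contDiff hΦ).continuous

theorem piN_intble (hG : IsFinslerEnergy n G ℓ α) (hΦ : IsRegularDomain n Φ δ₀)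
    (x : H1Curve n 0 1) : IntervalIntegrable (piN G Φ x) volume 0 1 := by
  have hl := ell_pos hG
  obtain ⟨R, hR⟩ := (x_isAC x).bounded
  have h1 : IntervalIntegrable (pN G x) volume 0 1 := by
    refine intble_of x (Ψ := fun p => dvCLM G p.1 p.2) (dv_continuous hG) hR
      (fun q v hq => (dv_le hG q v).trans ?_) (C := ℓ)
    gcongr; simp
  have h2 : IntervalIntegrable (fun s => bN G Φ x s • dP Φ x s) volume 0 1 := by
    refine (bN_intble hG hΦ x).smul_continuousOn ?_
    rw [uIcc_of_le zero_le_one]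
    exact (dPhi_contDiff hΦ).continuous.comp_continuousOn (x_isAC x).continuousOn
  exact h1.sub h2

/-- good points -/
def Sset (G : Evec n → Evec n → ℝ) (Φ : Evec n → ℝ) (x : H1Curve n 0 1) : Set ℝ :=
  {s | s ∈ Ioo (0:ℝ) 1 ∧ HasDerivAt (fun r => ∫ z in (0:ℝ)..r, bN G Φ x z) (bN G Φ x s) s ∧
    HasDerivAt (fun r => ∫ z in (0:ℝ)..r, piN G Φ x z) (piN G Φ x s) s}

theorem Sset_ae (hG : IsFinslerEnergy n G ℓ α) (hΦ : IsRegularDomain n Φ δ₀)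
    (x : H1Curve n 0 1) : ∀ᵐ s, s ∈ Icc (0:ℝ) 1 → s ∈ Sset G Φ x := by
  have h1 := (bN_intble hG hΦ x).ae_hasDerivAt_integral
  have h2 := (piN_intble hG hΦ x).ae_hasDerivAt_integral
  rw [uIcc_of_le zero_le_one] at h1 h2
  filter_upwards [h1, h2, ae_Ioo] with s h1 h2 h3 hs
  exact ⟨h3 hs, h1 hs 0 (by simp), h2 hs 0 (by simp)⟩

def noC (Φ : Evec n → ℝ) (x : H1Curve n 0 1) (s t : ℝ) : Prop :=
  ∀ r ∈ Icc s t, Φ (x.toFun r) ≠ 0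

theorem phi_cont (hΦ : IsRegularDomain n Φ δ₀) (x : H1Curve n 0 1) :
    ContinuousOn (fun r => Φ (x.toFun r)) (Icc 0 1) :=
  hΦ.smooth.continuous.comp_continuousOn (x_isAC x).continuousOn

theorem noC_ext (hΦ : IsRegularDomain n Φ δ₀) {x : H1Curve n 0 1} {s t : ℝ} (hs : 0 < s)
    (hst : s < t) (ht : t < 1) (h : noC Φ x s t) :
    ∀ᶠ ε in nhdsWithin (0:ℝ) (Ioi 0), noC Φ x s (t + ε) := by
  have h1 : ContinuousAt (fun r => Φ (x.toFun r)) t :=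
    (phi_cont hΦ x).continuousAt (Icc_mem_nhds (by linarith) ht)
  have h2 := h1.eventually_ne (h t ⟨hst.le, le_rfl⟩)
  obtain ⟨η, hη, h3⟩ := Metric.eventually_nhds_iff.1 h2
  have h4 : ∀ᶠ ε in nhdsWithin (0:ℝ) (Ioi 0), ε < η := nhdsWithin_le_nhds (gt_mem_nhds hη)
  filter_upwards [h4] with ε h4 r hr
  by_cases hrt : r ≤ t
  · exact h r ⟨hr.1, hrt⟩
  · refine h3 ?_
    rw [Real.dist_eq, abs_of_pos (by linarith)]
    linarith [hr.2]

theorem dvNeg (V : Evec n → Evec n) (q v : Evec n) :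
    aV G (fun q => - V q) q v = - aV G V q v := by
  unfold aV
  rw [show fderiv ℝ (fun q => - V q) q = - fderiv ℝ V q from fderiv_neg]
  simp
  ring

theorem g_sub {x : H1Curve n 0 1} (hG : IsFinslerEnergy n G ℓ α) (hΦ : IsRegularDomain n Φ δ₀)
    {s t : ℝ} (hs : s ∈ Icc (0:ℝ) 1) (ht : t ∈ Icc (0:ℝ) 1) :
    gN G Φ x t - gN G Φ x s = bN G Φ x t - bN G Φ x s - ∫ r in s..t, aN G Φ x r := by
  rw [← (AN_isAC hG hΦ x).sub_eq hs ht]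
  unfold gN; ring

theorem g_mono (hG : IsFinslerEnergy n G ℓ α) (hΦ : IsRegularDomain n Φ δ₀) {x : H1Curve n 0 1}
    (hx : IsVCritical G Φ x) {s t : ℝ} (hs : s ∈ Sset G Φ x) (ht : t ∈ Sset G Φ x)
    (hst : s ≤ t) : gN G Φ x s ≤ gN G Φ x t := by
  rcases hst.eq_or_lt with rfl | hst
  · exact le_rfl
  have h := test_lim hG hΦ hx (V := fun q => - nf Φ q) (nf_contDiff hΦ).neg hs.1.1 hst ht.1.2
    (by simp only [map_neg, intervalIntegral.integral_neg]; exact hs.2.1.neg)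
    (by simp only [map_neg, intervalIntegral.integral_neg]; exact ht.2.1.neg)
    (Eventually.of_forall fun ε r hr h0 => by rw [map_neg, dPhi_nf hΦ h0]; norm_num)
  have h2 := g_sub (x := x) hG hΦ (Ioo_subset_Icc_self hs.1) (Ioo_subset_Icc_self ht.1)
  simp only [dvNeg, map_neg, intervalIntegral.integral_neg] at h
  simp only [bN, aN] at h2
  linarith

theorem g_const (hG : IsFinslerEnergy n G ℓ α) (hΦ : IsRegularDomain n Φ δ₀) {x : H1Curve n 0 1}
    (hx : IsVCritical G Φ x) {s t : ℝ} (hs : s ∈ Sset G Φ x) (ht : t ∈ Sset G Φ x)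
    (hst : s ≤ t) (hc : noC Φ x s t) : gN G Φ x s = gN G Φ x t := by
  rcases hst.eq_or_lt with rfl | hst'
  · rfl
  refine le_antisymm (g_mono hG hΦ hx hs ht hst) ?_
  have h := test_lim hG hΦ hx (V := nf Φ) (nf_contDiff hΦ) hs.1.1 hst' ht.1.2
    hs.2.1 ht.2.1 (by
      filter_upwards [noC_ext hΦ hs.1.1 hst' ht.1.2 hc] with ε h r hr h0
      exact absurd h0 (h r hr))
  have h2 := g_sub (x := x) hG hΦ (Ioo_subset_Icc_self hs.1) (Ioo_subset_Icc_self ht.1)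
  simp only [bN, aN] at h2
  linarith

def Ve (Φ : Evec n → ℝ) (e q : Evec n) : Evec n := e - fderiv ℝ Φ q e • nf Φ q

theorem Ve_contDiff (hΦ : IsRegularDomain n Φ δ₀) (e : Evec n) : ContDiff ℝ 1 (Ve Φ e) := by
  have h1 := dPhi_contDiff hΦ
  have h2 := nf_contDiff hΦ
  unfold Ve
  exact contDiff_const.sub ((h1.clm_apply contDiff_const).smul h2)

theorem Ve_fderiv (hΦ : IsRegularDomain n Φ δ₀) (e q u : Evec n) :
    fderiv ℝ (Ve Φ e) q u =
      - (fderiv ℝ Φ q e • fderiv ℝ (nf Φ) q u + fderiv ℝ (fderiv ℝ Φ) q u e • nf Φ q) := by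
  have h1 : HasFDerivAt (fderiv ℝ Φ) (fderiv ℝ (fderiv ℝ Φ) q) q :=
    ((dPhi_contDiff hΦ).differentiable (by norm_num) q).hasFDerivAt
  have h2 : HasFDerivAt (nf Φ) (fderiv ℝ (nf Φ) q) q :=
    ((nf_contDiff hΦ).differentiable (by norm_num) q).hasFDerivAt
  have h3 := h1.clm_apply (hasFDerivAt_const e q)
  have h4 := (h3.smul h2).const_sub e
  have h5 : fderiv ℝ (Ve Φ e) q = _ := h4.fderiv
  rw [h5]
  simp

theorem Ve_b (e : Evec n) (x : H1Curve n 0 1) (s : ℝ) :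
    dvCLM G (x.toFun s) (x.deriv s) (Ve Φ e (x.toFun s)) = piN G Φ x s e := by
  simp [Ve, piN, pN, bN, dP]
  ring

theorem Ve_a (hΦ : IsRegularDomain n Φ δ₀) (e q v : Evec n) :
    aV G (Ve Φ e) q v = aPq G Φ q v e := by
  unfold aV
  rw [Ve_fderiv hΦ]
  simp [Ve, aPq, aV]
  ring

theorem pi_le (hG : IsFinslerEnergy n G ℓ α) (hΦ : IsRegularDomain n Φ δ₀) {x : H1Curve n 0 1}
    (hx : IsVCritical G Φ x) {s t : ℝ} (hs : s ∈ Sset G Φ x) (ht : t ∈ Sset G Φ x)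
    (hst : s < t) (e : Evec n) :
    piN G Φ x t e - piN G Φ x s e ≤ (∫ r in s..t, aP G Φ x r) e := by
  have key : ∀ {s}, s ∈ Sset G Φ x → HasDerivAt (fun r => ∫ z in (0:ℝ)..r, dvCLM G (x.toFun z)
      (x.deriv z) (Ve Φ e (x.toFun z))) (dvCLM G (x.toFun s) (x.deriv s) (Ve Φ e (x.toFun s))) s := by
    intro s hs
    simp only [Ve_b]
    have h1 := ((ContinuousLinearMap.apply ℝ ℝ e).hasFDerivAt (x := ∫ z in (0:ℝ)..s, piN G Φ x z)).comp_hasDerivAt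
      s hs.2.2
    refine h1.congr_of_eventuallyEq ?_
    filter_upwards [Icc_mem_nhds hs.1.1 hs.1.2] with r hr
    have := ContinuousLinearMap.intervalIntegral_apply ((piN_intble hG hΦ x).mono_set
      (sub_Icc (s := 0) (t := r) (by simp) hr)) e
    simp [this]
  have h := test_lim hG hΦ hx (V := Ve Φ e) (Ve_contDiff hΦ e) hs.1.1 hst ht.1.2
    (key hs) (key ht)
    (Eventually.of_forall fun ε r hr h0 => by simp [Ve, dPhi_nf hΦ h0])
  simp only [Ve_b, Ve_a hΦ] at h
  rw [ContinuousLinearMap.intervalIntegral_apply ((aP_intble hG hΦ x).mono_set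
      (sub_Icc (Ioo_subset_Icc_self hs.1) (Ioo_subset_Icc_self ht.1)))]
  exact h

theorem pi_eq (hG : IsFinslerEnergy n G ℓ α) (hΦ : IsRegularDomain n Φ δ₀) {x : H1Curve n 0 1}
    (hx : IsVCritical G Φ x) {s t : ℝ} (hs : s ∈ Sset G Φ x) (ht : t ∈ Sset G Φ x)
    (hst : s < t) : piN G Φ x t - piN G Φ x s = ∫ r in s..t, aP G Φ x r := by
  ext e
  refine le_antisymm (pi_le hG hΦ hx hs ht hst e) ?_
  have := pi_le hG hΦ hx hs ht hst (-e)
  simp only [map_neg] at this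
  simp
  linarith

theorem Sset_nonempty_Ioo (hG : IsFinslerEnergy n G ℓ α) (hΦ : IsRegularDomain n Φ δ₀)
    (x : H1Curve n 0 1) {P : ℝ → Prop} (hP : ∀ᵐ s, s ∈ Icc (0:ℝ) 1 → P s) {a b : ℝ}
    (h : a < b) (h0 : a < 1) (h1 : 0 < b) :
    ∃ s ∈ Sset G Φ x, s ∈ Ioo a b ∧ P s := by
  by_contra hcon
  push Not at hcon
  have hlt : max a 0 < min b 1 := by simp [h, h0, h1]
  have h2 : ∀ᵐ s, s ∉ Ioo (max a 0) (min b 1) := by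
    filter_upwards [Sset_ae hG hΦ x, hP] with s hs hp hm
    have hs' : s ∈ Icc (0:ℝ) 1 :=
      ⟨(le_max_right _ _).trans hm.1.le, hm.2.le.trans (min_le_right _ _)⟩
    exact hcon s (hs hs') ⟨(le_max_left _ _).trans_lt hm.1, hm.2.trans_le (min_le_left _ _)⟩ (hp hs')
  have h3 : volume (Ioo (max a 0) (min b 1)) = 0 := by
    rw [ae_iff] at h2
    simpa only [not_not, Set.ofPred_mem_eq] using h2
  rw [Real.volume_Ioo, ENNReal.ofReal_eq_zero] at h3
  linarith

theorem exists_Z (hG : IsFinslerEnergy n G ℓ α) (hΦ : IsRegularDomain n Φ δ₀) {x : H1Curve n 0 1}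
    (hx : IsVCritical G Φ x) : ∃ Z : ℝ → Evec n →L[ℝ] ℝ, IsAC Z (aP G Φ x) ∧
      ∀ s ∈ Sset G Φ x, pN G x s = Z s + bN G Φ x s • dP Φ x s := by
  obtain ⟨s0, hs0, -⟩ := Sset_nonempty_Ioo hG hΦ x (P := fun _ => True) (by simp)
    (zero_lt_one' ℝ) zero_lt_one zero_lt_one
  have hInt := aP_intble hG hΦ x
  set z0 := piN G Φ x s0 - ∫ r in (0:ℝ)..s0, aP G Φ x r with hz
  let Z : ℝ → Evec n →L[ℝ] ℝ := fun t => z0 + ∫ r in (0:ℝ)..t, aP G Φ x r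
  have hZ : IsAC Z (aP G Φ x) := ⟨hInt, fun t _ => by simp [Z]⟩
  refine ⟨Z, hZ, fun s hs => ?_⟩
  have h0 : Z s0 = piN G Φ x s0 := by simp [Z, hz]
  have h1 : Z s = piN G Φ x s := by
    rcases lt_trichotomy s0 s with h | h | h
    · have e1 := pi_eq hG hΦ hx hs0 hs h
      rw [← hZ.sub_eq (Ioo_subset_Icc_self hs0.1) (Ioo_subset_Icc_self hs.1), h0] at e1
      exact (sub_left_inj.1 e1).symm
    · rw [← h, h0]
    · have e1 := pi_eq hG hΦ hx hs hs0 h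
      rw [← hZ.sub_eq (Ioo_subset_Icc_self hs.1) (Ioo_subset_Icc_self hs0.1), h0] at e1
      exact (sub_right_inj.1 e1).symm
  rw [h1]
  simp [piN]

end PartD


/-! ### Part E: contact points and boundedness -/

section PartE
set_option linter.unusedSectionVars false
set_option linter.unusedVariables false
variable {n : ℕ} {G : Evec n → Evec n → ℝ} {ℓ α : ℝ} {Φ : Evec n → ℝ} {δ₀ : ℝ}

theorem exists_deriv_nonneg {S : Set ℝ} (hS : ∀ᵐ s, s ∈ Icc (0:ℝ) 1 → s ∈ S) {y u : ℝ → ℝ}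
    (h : IsAC y u) {a b : ℝ} (ha : a ∈ Icc (0:ℝ) 1) (hb : b ∈ Icc (0:ℝ) 1) (hab : a < b)
    (hy : y a ≤ y b) : ∃ s ∈ S, s ∈ Ioo a b ∧ 0 ≤ u s := by
  classical
  by_contra hcon
  push Not at hcon
  let w : ℝ → ℝ := fun s => if s ∈ S then - u s else 1
  have hw : ∀ᵐ s, s ∈ uIoc a b → (-u s) = w s := by
    filter_upwards [hS] with s hs hm
    have hm' : s ∈ Icc (0:ℝ) 1 := by
      rw [uIoc_of_le hab.le] at hm
      exact ⟨ha.1.trans hm.1.le, hm.2.trans hb.2⟩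
    simp [w, hs hm']
  have hi := (h.intble ha hb).neg
  have hwi : IntervalIntegrable w volume a b := by
    refine hi.congr_ae ?_
    rw [Filter.EventuallyEq, ae_restrict_iff' measurableSet_uIoc]
    exact hw
  have h1 := intervalIntegral.intervalIntegral_pos_of_pos_on hwi (fun s hs => by
    by_cases h2 : s ∈ S
    · simpa [w, h2] using hcon s h2 hs
    · simp [w, h2]) hab
  rw [← intervalIntegral.integral_congr_ae hw, intervalIntegral.integral_neg, ← h.sub_eq ha hb] at h1
  linarith

theorem IsAC.neg {y u : ℝ → ℝ} (h : IsAC y u) : IsAC (fun s => - y s) (fun s => - u s) := by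
  refine ⟨h.1.neg, fun t ht => ?_⟩
  change - y t = - y 0 + ∫ s in (0:ℝ)..t, - u s
  rw [h.2 t ht, intervalIntegral.integral_neg]
  ring

theorem exists_deriv_nonpos {S : Set ℝ} (hS : ∀ᵐ s, s ∈ Icc (0:ℝ) 1 → s ∈ S) {y u : ℝ → ℝ}
    (h : IsAC y u) {a b : ℝ} (ha : a ∈ Icc (0:ℝ) 1) (hb : b ∈ Icc (0:ℝ) 1) (hab : a < b)
    (hy : y b ≤ y a) : ∃ s ∈ S, s ∈ Ioo a b ∧ u s ≤ 0 := by
  obtain ⟨s, h1, h2, h3⟩ := exists_deriv_nonneg hS h.neg ha hb hab (by simpa using hy)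
  exact ⟨s, h1, h2, by linarith⟩

def sig (Φ : Evec n → ℝ) (x : H1Curve n 0 1) (s : ℝ) : ℝ := dP Φ x s (x.deriv s)

theorem phi_isAC (hΦ : IsRegularDomain n Φ δ₀) (x : H1Curve n 0 1) :
    IsAC (fun s => Φ (x.toFun s)) (sig Φ x) :=
  comp_isAC x (hΦ.smooth.of_le (by norm_num))

theorem contact_right (hG : IsFinslerEnergy n G ℓ α) (hΦ : IsRegularDomain n Φ δ₀)
    {x : H1Curve n 0 1} (hx : IsVCritical G Φ x) {c ε : ℝ} (hc : c ∈ Ioo (0:ℝ) 1)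
    (h0 : Φ (x.toFun c) = 0) (hε : 0 < ε) :
    ∃ t ∈ Sset G Φ x, c < t ∧ t < c + ε ∧ sig Φ x t ≤ 0 := by
  have hm : min (c + ε) 1 ∈ Icc (0:ℝ) 1 := ⟨le_min (by linarith [hc.1]) zero_le_one, min_le_right _ _⟩
  obtain ⟨t, h1, h2, h3⟩ := exists_deriv_nonpos (Sset_ae hG hΦ x) (phi_isAC hΦ x)
    (a := c) (b := min (c + ε) 1) (Ioo_subset_Icc_self hc) hm
    (lt_min (by linarith) hc.2) (by
      rw [h0]; exact hx.1.1 _ hm)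
  exact ⟨t, h1, h2.1, h2.2.trans_le (min_le_left _ _), h3⟩

theorem contact_left (hG : IsFinslerEnergy n G ℓ α) (hΦ : IsRegularDomain n Φ δ₀)
    {x : H1Curve n 0 1} (hx : IsVCritical G Φ x) {c ε : ℝ} (hc : c ∈ Ioo (0:ℝ) 1)
    (h0 : Φ (x.toFun c) = 0) (hε : 0 < ε) :
    ∃ s ∈ Sset G Φ x, s < c ∧ c - ε < s ∧ 0 ≤ sig Φ x s := by
  have hm : max (c - ε) 0 ∈ Icc (0:ℝ) 1 := ⟨le_max_right _ _, max_le (by linarith [hc.2]) zero_le_one⟩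
  obtain ⟨t, h1, h2, h3⟩ := exists_deriv_nonneg (Sset_ae hG hΦ x) (phi_isAC hΦ x)
    (a := max (c - ε) 0) (b := c) hm (Ioo_subset_Icc_self hc)
    (max_lt (by linarith) hc.1) (by
      rw [h0]; exact hx.1.1 _ hm)
  exact ⟨t, h1, h2.2, (le_max_left _ _).trans_lt h2.1, h3⟩

theorem contact_compact (hΦ : IsRegularDomain n Φ δ₀) (x : H1Curve n 0 1) {s t : ℝ}
    (hs : 0 ≤ s) (ht : t ≤ 1) : IsCompact {r ∈ Icc s t | Φ (x.toFun r) = 0} := by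
  have h : ContinuousOn (fun r => Φ (x.toFun r)) (Icc s t) :=
    (phi_cont hΦ x).mono (Icc_subset_Icc hs ht)
  have := h.preimage_isClosed_of_isClosed isClosed_Icc (isClosed_singleton (x := (0:ℝ)))
  exact isCompact_Icc.of_isClosed_subset this inter_subset_left

theorem lemU (hG : IsFinslerEnergy n G ℓ α) (hΦ : IsRegularDomain n Φ δ₀)
    {x : H1Curve n 0 1} (hx : IsVCritical G Φ x) {c t ε : ℝ} (hc : 0 < c) (ht : t ∈ Sset G Φ x)
    (hct : c ≤ t) (h0 : Φ (x.toFun c) = 0) (hε : 0 < ε) :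
    ∃ t' ∈ Sset G Φ x, c < t' ∧ t' < t + ε ∧ gN G Φ x t ≤ gN G Φ x t' ∧ sig Φ x t' ≤ 0 := by
  obtain ⟨c1, hc1, hmax⟩ := (contact_compact hΦ x hc.le ht.1.2.le).exists_isGreatest
    ⟨c, ⟨le_rfl, hct⟩, h0⟩
  obtain ⟨t', h1, h2, h3, h4⟩ := contact_right hG hΦ hx
    (c := c1) ⟨hc.trans_le hc1.1.1, hc1.1.2.trans_lt ht.1.2⟩ hc1.2 hε
  refine ⟨t', h1, hc1.1.1.trans_lt h2, by linarith [hc1.1.2], ?_, h4⟩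
  rcases le_total t t' with h | h
  · exact g_mono hG hΦ hx ht h1 h
  · refine (g_const hG hΦ hx h1 ht h fun r hr hr0 => ?_).ge
    have := hmax ⟨⟨hc1.1.1.trans (h2.le.trans hr.1), hr.2⟩, hr0⟩
    linarith [hr.1]

theorem lemU' (hG : IsFinslerEnergy n G ℓ α) (hΦ : IsRegularDomain n Φ δ₀)
    {x : H1Curve n 0 1} (hx : IsVCritical G Φ x) {c s ε : ℝ} (hc : c < 1) (hs : s ∈ Sset G Φ x)
    (hct : s ≤ c) (h0 : Φ (x.toFun c) = 0) (hε : 0 < ε) :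
    ∃ s' ∈ Sset G Φ x, s' < c ∧ s - ε < s' ∧ gN G Φ x s' ≤ gN G Φ x s ∧ 0 ≤ sig Φ x s' := by
  obtain ⟨c1, hc1, hmin⟩ := (contact_compact hΦ x hs.1.1.le hc.le).exists_isLeast
    ⟨c, ⟨hct, le_rfl⟩, h0⟩
  obtain ⟨s', h1, h2, h3, h4⟩ := contact_left hG hΦ hx
    (c := c1) ⟨hs.1.1.trans_le hc1.1.1, hc1.1.2.trans_lt hc⟩ hc1.2 hε
  refine ⟨s', h1, h2.trans_le hc1.1.2, by linarith [hc1.1.1], ?_, h4⟩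
  rcases le_total s' s with h | h
  · exact g_mono hG hΦ hx h1 hs h
  · refine (g_const hG hΦ hx hs h1 h fun r hr hr0 => ?_).ge
    have := hmin ⟨⟨hr.1, hr.2.trans (h2.le.trans hc1.1.2)⟩, hr0⟩
    linarith [hr.2]

theorem vel_le (hG : IsFinslerEnergy n G ℓ α) {q v : Evec n} {K : ℝ}
    (h : dvCLM G q v v ≤ K * ‖v‖) (hK : 0 ≤ K) : ‖v‖ ≤ ℓ * K := by
  have hl := ell_pos hG
  rw [euler hG] at h
  have h1 := hG.lower q v
  rcases (norm_nonneg v).eq_or_lt with h0 | h0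
  · rw [← h0]; positivity
  have h2 : 2 * (1 / ℓ * ‖v‖) ≤ K := by
    have : (2 * (1 / ℓ * ‖v‖)) * ‖v‖ ≤ K * ‖v‖ := by nlinarith
    exact le_of_mul_le_mul_right this h0
  have h3 : 1 / ℓ * ‖v‖ ≤ K := by
    have : 0 ≤ 1 / ℓ * ‖v‖ := by positivity
    linarith
  rw [one_div, inv_mul_le_iff₀ hl] at h3
  exact h3

theorem dP_isAC (hΦ : IsRegularDomain n Φ δ₀) (x : H1Curve n 0 1) :
    IsAC (dP Φ x) (fun s => fderiv ℝ (fderiv ℝ Φ) (x.toFun s) (x.deriv s)) :=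
  comp_isAC x (dPhi_contDiff hΦ)

theorem g_bounded (hG : IsFinslerEnergy n G ℓ α) (hΦ : IsRegularDomain n Φ δ₀)
    {x : H1Curve n 0 1} (hx : IsVCritical G Φ x) :
    ∃ K, 0 ≤ K ∧ ∀ s ∈ Sset G Φ x, |gN G Φ x s| ≤ K := by
  have hl := ell_pos hG
  obtain ⟨Z, hZ, hpZ⟩ := exists_Z hG hΦ hx
  obtain ⟨KZ, hKZ⟩ := hZ.bounded
  obtain ⟨KA, hKA⟩ := (AN_isAC hG hΦ x).bounded
  obtain ⟨KP, hKP⟩ := (dP_isAC hΦ x).bounded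
  obtain ⟨R, hR⟩ := (x_isAC x).bounded
  obtain ⟨C3, hC3, H3⟩ := bV_bound hG (nf_contDiff hΦ).continuous R
  have m0 : (0:ℝ) ∈ Icc (0:ℝ) 1 := by simp
  have kz := (norm_nonneg _).trans (hKZ 0 m0)
  have ka := (norm_nonneg _).trans (hKA 0 m0)
  have kp := (norm_nonneg _).trans (hKP 0 m0)
  set K := C3 * (ℓ * (KZ + KA * KP)) + KA with hK
  have hK0 : 0 ≤ K := by positivity
  have key : ∀ t ∈ Sset G Φ x, gN G Φ x t * sig Φ x t ≤ 0 → |gN G Φ x t| ≤ K := by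
    intro t ht h
    have htI := Ioo_subset_Icc_self ht.1
    have hb : bN G Φ x t = gN G Φ x t + AN G Φ x t := by simp [gN]
    have h1 : pN G x t (x.deriv t) ≤ (KZ + KA * KP) * ‖x.deriv t‖ := by
      rw [hpZ t ht, hb]
      simp only [_root_.add_apply, _root_.smul_apply, smul_eq_mul]
      have e1 := (Real.le_norm_self _).trans ((Z t).le_opNorm (x.deriv t))
      have e2 := (Real.le_norm_self _).trans ((AN G Φ x t • dP Φ x t).le_opNorm (x.deriv t))
      rw [norm_smul] at e2
      simp only [_root_.smul_apply, smul_eq_mul] at e2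
      have e3 : ‖AN G Φ x t‖ * ‖dP Φ x t‖ ≤ KA * KP := by
        have := hKA t htI; have := hKP t htI
        gcongr
      have e4 := mul_le_mul_of_nonneg_right e3 (norm_nonneg (x.deriv t))
      have e5 := mul_le_mul_of_nonneg_right (hKZ t htI) (norm_nonneg (x.deriv t))
      unfold sig at h
      linarith
    have h2 := vel_le hG h1 (by positivity)
    have h3 := H3 _ (x.deriv t) (hR t htI)
    have h4 : gN G Φ x t = bN G Φ x t - AN G Φ x t := rfl
    rw [h4]
    have h5 : |bN G Φ x t| ≤ C3 * (ℓ * (KZ + KA * KP)) := h3.trans (by gcongr)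
    exact (abs_sub _ _).trans (add_le_add h5 (hKA t htI))
  by_cases hex : ∃ c ∈ Ioo (0:ℝ) 1, Φ (x.toFun c) = 0
  · obtain ⟨c, hc, h0⟩ := hex
    refine ⟨K, hK0, fun t ht => abs_le.2 ⟨?_, ?_⟩⟩
    · have : ∃ t' ∈ Sset G Φ x, gN G Φ x t' ≤ gN G Φ x t ∧ 0 ≤ sig Φ x t' := by
        rcases le_total t c with h | h
        · obtain ⟨t', h1, h2, h3, h4, h5⟩ := lemU' hG hΦ hx hc.2 ht h h0 one_pos
          exact ⟨t', h1, h4, h5⟩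
        · obtain ⟨t', h1, h2, h3, h4⟩ := contact_left hG hΦ hx hc h0 one_pos
          exact ⟨t', h1, g_mono hG hΦ hx h1 ht (h2.le.trans h), h4⟩
      obtain ⟨t', h1, h2, h3⟩ := this
      rcases le_total 0 (gN G Φ x t') with h | h
      · linarith
      · have := (abs_le.1 (key t' h1 (mul_nonpos_of_nonpos_of_nonneg h h3))).1
        linarith
    · have : ∃ t' ∈ Sset G Φ x, gN G Φ x t ≤ gN G Φ x t' ∧ sig Φ x t' ≤ 0 := by
        rcases le_total c t with h | h
        · obtain ⟨t', h1, h2, h3, h4, h5⟩ := lemU hG hΦ hx hc.1 ht h h0 one_pos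
          exact ⟨t', h1, h4, h5⟩
        · obtain ⟨t', h1, h2, h3, h4⟩ := contact_right hG hΦ hx hc h0 one_pos
          exact ⟨t', h1, g_mono hG hΦ hx ht h1 (h.trans h2.le), h4⟩
      obtain ⟨t', h1, h2, h3⟩ := this
      rcases le_total (gN G Φ x t') 0 with h | h
      · linarith
      · have := (abs_le.1 (key t' h1 (mul_nonpos_of_nonneg_of_nonpos h h3))).2
        linarith
  · push Not at hex
    obtain ⟨s0, hs0, -⟩ := Sset_nonempty_Ioo hG hΦ x (P := fun _ => True) (by simp)
      (zero_lt_one' ℝ) zero_lt_one zero_lt_one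
    refine ⟨|gN G Φ x s0|, abs_nonneg _, fun t ht => le_of_eq ?_⟩
    rcases le_total s0 t with h | h
    · rw [g_const hG hΦ hx hs0 ht h fun r hr => hex r ⟨hs0.1.1.trans_le hr.1, hr.2.trans_lt ht.1.2⟩]
    · rw [g_const hG hΦ hx ht hs0 h fun r hr => hex r ⟨ht.1.1.trans_le hr.1, hr.2.trans_lt hs0.1.2⟩]

theorem vel_bounded (hG : IsFinslerEnergy n G ℓ α) (hΦ : IsRegularDomain n Φ δ₀)
    {x : H1Curve n 0 1} (hx : IsVCritical G Φ x) :
    ∃ K, 0 ≤ K ∧ ∀ s ∈ Sset G Φ x, ‖x.deriv s‖ ≤ K := by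
  have hl := ell_pos hG
  obtain ⟨Z, hZ, hpZ⟩ := exists_Z hG hΦ hx
  obtain ⟨KZ, hKZ⟩ := hZ.bounded
  obtain ⟨KA, hKA⟩ := (AN_isAC hG hΦ x).bounded
  obtain ⟨KP, hKP⟩ := (dP_isAC hΦ x).bounded
  obtain ⟨Kg, hKg0, hKg⟩ := g_bounded hG hΦ hx
  have m0 : (0:ℝ) ∈ Icc (0:ℝ) 1 := by simp
  have kz := (norm_nonneg _).trans (hKZ 0 m0)
  have ka := (norm_nonneg _).trans (hKA 0 m0)
  have kp := (norm_nonneg _).trans (hKP 0 m0)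
  refine ⟨ℓ * (KZ + (Kg + KA) * KP), by positivity, fun t ht => ?_⟩
  have htI := Ioo_subset_Icc_self ht.1
  refine vel_le hG (q := x.toFun t) ?_ (by positivity)
  refine (Real.le_norm_self _).trans ((ContinuousLinearMap.le_opNorm _ _).trans ?_)
  gcongr
  change ‖pN G x t‖ ≤ _
  rw [hpZ t ht]
  refine (norm_add_le _ _).trans ?_
  rw [norm_smul]
  have hb : bN G Φ x t = gN G Φ x t + AN G Φ x t := by simp [gN]
  have h1 : ‖bN G Φ x t‖ ≤ Kg + KA := by
    rw [hb]; exact (norm_add_le _ _).trans (add_le_add (hKg t ht) (hKA t htI))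
  have := hKZ t htI
  have := hKP t htI
  gcongr

end PartE


/-! ### Part F: Lipschitz estimates -/

section PartF
set_option linter.unusedSectionVars false
set_option linter.unusedVariables false
variable {n : ℕ} {G : Evec n → Evec n → ℝ} {ℓ α : ℝ} {Φ : Evec n → ℝ} {δ₀ : ℝ}

structure Pack (G : Evec n → Evec n → ℝ) (Φ : Evec n → ℝ) (x : H1Curve n 0 1)
    (Z : ℝ → Evec n →L[ℝ] ℝ) (C : ℝ) : Prop where
  nonneg : 0 ≤ C
  p_eq : ∀ s ∈ Sset G Φ x, pN G x s = Z s + bN G Φ x s • dP Φ x s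
  x_lip : ∀ s ∈ Icc (0:ℝ) 1, ∀ t ∈ Icc (0:ℝ) 1, ‖x.toFun t - x.toFun s‖ ≤ C * |t - s|
  Z_lip : ∀ s ∈ Icc (0:ℝ) 1, ∀ t ∈ Icc (0:ℝ) 1, ‖Z t - Z s‖ ≤ C * |t - s|
  A_lip : ∀ s ∈ Icc (0:ℝ) 1, ∀ t ∈ Icc (0:ℝ) 1, ‖AN G Φ x t - AN G Φ x s‖ ≤ C * |t - s|
  dP_lip : ∀ s ∈ Icc (0:ℝ) 1, ∀ t ∈ Icc (0:ℝ) 1, ‖dP Φ x t - dP Φ x s‖ ≤ C * |t - s|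
  N_lip : ∀ s ∈ Icc (0:ℝ) 1, ∀ t ∈ Icc (0:ℝ) 1,
    ‖nf Φ (x.toFun t) - nf Φ (x.toFun s)‖ ≤ C * |t - s|
  A_bd : ∀ s ∈ Icc (0:ℝ) 1, ‖AN G Φ x s‖ ≤ C
  dP_bd : ∀ s ∈ Icc (0:ℝ) 1, ‖dP Φ x s‖ ≤ C
  N_bd : ∀ s ∈ Icc (0:ℝ) 1, ‖nf Φ (x.toFun s)‖ ≤ C
  g_bd : ∀ s ∈ Sset G Φ x, |gN G Φ x s| ≤ C
  u_bd : ∀ s ∈ Sset G Φ x, ‖x.deriv s‖ ≤ C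
  p_bd : ∀ s ∈ Sset G Φ x, ‖pN G x s‖ ≤ C
  dv_lip : ∀ s ∈ Icc (0:ℝ) 1, ∀ t ∈ Icc (0:ℝ) 1, ∀ v₁ v₂ : Evec n,
    ‖dvCLM G (x.toFun s) v₁ - dvCLM G (x.toFun t) v₂‖ ≤
      C * ‖v₁ - v₂‖ + C * ‖v₂‖ * ‖x.toFun s - x.toFun t‖

theorem pack_exists (hG : IsFinslerEnergy n G ℓ α) (hΦ : IsRegularDomain n Φ δ₀)
    {x : H1Curve n 0 1} (hx : IsVCritical G Φ x) : ∃ Z C, IsAC Z (aP G Φ x) ∧ Pack G Φ x Z C := by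
  have hl := ell_pos hG
  obtain ⟨Z, hZ, hpZ⟩ := exists_Z hG hΦ hx
  obtain ⟨KA, hKA⟩ := (AN_isAC hG hΦ x).bounded
  obtain ⟨KP, hKP⟩ := (dP_isAC hΦ x).bounded
  obtain ⟨KN, hKN⟩ := (comp_isAC x (nf_contDiff hΦ)).bounded
  obtain ⟨Kg, hKg0, hKg⟩ := g_bounded hG hΦ hx
  obtain ⟨K, hK0, hK⟩ := vel_bounded hG hΦ hx
  obtain ⟨R, hR⟩ := (x_isAC x).bounded
  obtain ⟨C1, hC1, H1⟩ := aPq_bound hG hΦ R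
  obtain ⟨C2, hC2, H2⟩ := aV_bound hG (nf_contDiff hΦ) R
  obtain ⟨C3, hC3, H3⟩ := bound_ball (fderiv_cont (dPhi_contDiff hΦ)) R
  obtain ⟨C4, hC4, H4⟩ := bound_ball (fderiv_cont (nf_contDiff hΦ)) R
  obtain ⟨C5, hC5, H5⟩ := dv_lip hG R
  have m0 : (0:ℝ) ∈ Icc (0:ℝ) 1 := by simp
  have ka := (norm_nonneg _).trans (hKA 0 m0)
  have kp := (norm_nonneg _).trans (hKP 0 m0)
  have kn := (norm_nonneg _).trans (hKN 0 m0)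
  have hae : ∀ᵐ s, s ∈ Icc (0:ℝ) 1 → ‖x.deriv s‖ ≤ K := by
    filter_upwards [Sset_ae hG hΦ x] with s h hs using hK s (h hs)
  have LX := (x_isAC x).lip hae
  have LZ := hZ.lip (K := C1 * (K + K ^ 2)) (by
    filter_upwards [hae] with s h hs
    refine (H1 _ _ (hR s hs)).trans ?_
    have := h hs
    gcongr)
  have LA := (AN_isAC hG hΦ x).lip (K := C2 * (K + K ^ 2)) (by
    filter_upwards [hae] with s h hs
    refine (H2 _ _ (hR s hs)).trans ?_
    have := h hs
    gcongr)
  have LP := (dP_isAC hΦ x).lip (K := C3 * K) (by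
    filter_upwards [hae] with s h hs
    refine (ContinuousLinearMap.le_opNorm _ _).trans ?_
    have := h hs
    have := H3 _ (hR s hs)
    gcongr)
  have LN := (comp_isAC x (nf_contDiff hΦ)).lip (K := C4 * K) (by
    filter_upwards [hae] with s h hs
    refine (ContinuousLinearMap.le_opNorm _ _).trans ?_
    have := h hs
    have := H4 _ (hR s hs)
    gcongr)
  obtain ⟨C, hC⟩ : ∃ C, C = K + C1 * (K + K ^ 2) + C2 * (K + K ^ 2) + C3 * K + C4 * K + KA + KP +
    KN + Kg + ℓ * K + C5 := ⟨_, rfl⟩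
  have p1 : 0 ≤ C1 * (K + K ^ 2) := by positivity
  have p2 : 0 ≤ C2 * (K + K ^ 2) := by positivity
  have p3 : 0 ≤ C3 * K := by positivity
  have p4 : 0 ≤ C4 * K := by positivity
  have p5 : 0 ≤ ℓ * K := by positivity
  refine ⟨Z, C, hZ, ?_⟩
  constructor
  · linarith
  · exact hpZ
  · exact fun s hs t ht => (LX s hs t ht).trans (by gcongr; linarith)
  · exact fun s hs t ht => (LZ s hs t ht).trans (by gcongr; linarith)
  · exact fun s hs t ht => (LA s hs t ht).trans (by gcongr; linarith)
  · exact fun s hs t ht => (LP s hs t ht).trans (by gcongr; linarith)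
  · exact fun s hs t ht => (LN s hs t ht).trans (by gcongr; linarith)
  · exact fun s hs => (hKA s hs).trans (by linarith)
  · exact fun s hs => (hKP s hs).trans (by linarith)
  · exact fun s hs => (hKN s hs).trans (by linarith)
  · exact fun s hs => (hKg s hs).trans (by linarith)
  · exact fun s hs => (hK s hs).trans (by linarith)
  · intro s hs
    have := hK s hs
    have h1 := dv_le hG (x.toFun s) (x.deriv s)
    have h2 : ℓ * ‖x.deriv s‖ ≤ ℓ * K := by gcongr
    exact h1.trans (by linarith)
  · intro s hs t ht v₁ v₂
    refine (H5 _ _ v₁ v₂ (hR s hs) (hR t ht)).trans ?_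
    have : C5 ≤ C := by linarith
    gcongr

theorem quad {α K₁ K₂ h D : ℝ} (hα : 0 < α) (h1 : 0 ≤ K₁) (h2 : 0 ≤ K₂) (hh : 0 ≤ h) (hD : 0 ≤ D)
    (H : α * D ^ 2 ≤ K₁ * h * D + K₂ * h ^ 2) : D ≤ ((K₁ + K₂) / α + 1) * h := by
  have hp : 0 ≤ (K₁ + K₂) / α := by positivity
  by_cases hDh : D ≤ h
  · nlinarith
  push Not at hDh
  have hD0 : 0 < D := hh.trans_lt hDh
  have h3 : K₂ * h ^ 2 ≤ K₂ * h * D := by nlinarith [mul_nonneg h2 hh]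
  have h4 : α * D * D ≤ ((K₁ + K₂) * h) * D := by nlinarith
  have h5 := le_of_mul_le_mul_right h4 hD0
  have h6 : D ≤ (K₁ + K₂) / α * h := by
    rw [div_mul_eq_mul_div, le_div_iff₀ hα]; linarith
  linarith

variable {x : H1Curve n 0 1} {Z : ℝ → Evec n →L[ℝ] ℝ} {C : ℝ}

/-- strong monotonicity with moving base point -/
theorem mono_move (hG : IsFinslerEnergy n G ℓ α) (hP : Pack G Φ x Z C) {s t : ℝ}
    (hs : s ∈ Sset G Φ x) (ht : t ∈ Sset G Φ x) (hst : s ≤ t) :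
    α * ‖x.deriv t - x.deriv s‖ ^ 2 ≤ (pN G x t - pN G x s) (x.deriv t - x.deriv s) +
      C ^ 3 * (t - s) * ‖x.deriv t - x.deriv s‖ := by
  have hC := hP.nonneg
  have hsI := Ioo_subset_Icc_self hs.1
  have htI := Ioo_subset_Icc_self ht.1
  have h1 := mono_strong hG (x.toFun t) (x.deriv s) (x.deriv t)
  have h2 := hP.dv_lip s hsI t htI (x.deriv s) (x.deriv s)
  have h3 := hP.x_lip s hsI t htI
  rw [abs_of_nonneg (by linarith : 0 ≤ t - s)] at h3
  rw [norm_sub_rev] at h3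
  have h4 := hP.u_bd s hs
  have h5 : ‖dvCLM G (x.toFun s) (x.deriv s) - dvCLM G (x.toFun t) (x.deriv s)‖ ≤
      C ^ 3 * (t - s) := by
    refine h2.trans ?_
    rw [sub_self, norm_zero, mul_zero, zero_add]
    calc _ ≤ C * C * (C * (t - s)) := by gcongr
      _ = _ := by ring
  have h6 := (Real.le_norm_self _).trans ((dvCLM G (x.toFun s) (x.deriv s) -
    dvCLM G (x.toFun t) (x.deriv s)).le_opNorm (x.deriv t - x.deriv s))
  have h7 := mul_le_mul_of_nonneg_right h5 (norm_nonneg (x.deriv t - x.deriv s))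
  have h8 : dvCLM G (x.toFun t) (x.deriv t) - dvCLM G (x.toFun t) (x.deriv s) =
      (pN G x t - pN G x s) + (dvCLM G (x.toFun s) (x.deriv s) -
    dvCLM G (x.toFun t) (x.deriv s)) := by unfold pN; abel
  rw [h8, _root_.add_apply] at h1
  linarith

theorem W_lip (hP : Pack G Φ x Z C) {s t : ℝ}
    (hs : s ∈ Icc (0:ℝ) 1) (ht : t ∈ Icc (0:ℝ) 1) (hst : s ≤ t) :
    ‖(Z t + AN G Φ x t • dP Φ x t) - (Z s + AN G Φ x s • dP Φ x s)‖ ≤ (C + 2 * C ^ 2) * (t - s) := by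
  have hC := hP.nonneg
  have e1 := hP.Z_lip s hs t ht
  have e2 := hP.A_lip s hs t ht
  have e3 := hP.dP_lip s hs t ht
  have e4 := hP.A_bd s hs
  have e5 := hP.dP_bd t ht
  rw [abs_of_nonneg (by linarith : 0 ≤ t - s)] at e1 e2 e3
  have : (Z t + AN G Φ x t • dP Φ x t) - (Z s + AN G Φ x s • dP Φ x s) =
    (Z t - Z s) + (AN G Φ x t - AN G Φ x s) • dP Φ x t + AN G Φ x s • (dP Φ x t - dP Φ x s) := by
    module
  rw [this]
  refine (norm_add₃_le).trans ?_
  rw [norm_smul, norm_smul]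
  have h0 : 0 ≤ t - s := by linarith
  calc _ ≤ C * (t - s) + C * (t - s) * C + C * (C * (t - s)) := by gcongr
    _ = _ := by ring

theorem p_split (hP : Pack G Φ x Z C) {s : ℝ} (hs : s ∈ Sset G Φ x) :
    pN G x s = (Z s + AN G Φ x s • dP Φ x s) + gN G Φ x s • dP Φ x s := by
  rw [hP.p_eq s hs]
  unfold gN
  module

theorem key_est (hG : IsFinslerEnergy n G ℓ α) (hP : Pack G Φ x Z C) :
    ∃ K, 0 ≤ K ∧ ∀ s ∈ Sset G Φ x, ∀ t ∈ Sset G Φ x, s ≤ t → gN G Φ x s ≤ gN G Φ x t →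
      0 ≤ sig Φ x s → sig Φ x t ≤ 0 → gN G Φ x t - gN G Φ x s ≤ K * (t - s) := by
  have hC := hP.nonneg
  have hα := hG.alpha_pos
  set L₁ := C ^ 4 + C ^ 2 + C with hL₁
  set K₁ := (C + 3 * C ^ 2) + C ^ 3 + C ^ 2 * C ^ 2 with hK₁
  set K₂ := C ^ 2 * L₁ with hK₂
  have hL1 : 0 ≤ L₁ := by positivity
  have hk1 : 0 ≤ K₁ := by positivity
  have hk2 : 0 ≤ K₂ := by positivity
  refine ⟨C ^ 2 * ((K₁ + K₂) / α + 1) + L₁, by positivity, ?_⟩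
  intro s hs t ht hst hm hσs hσt
  have hsI := Ioo_subset_Icc_self hs.1
  have htI := Ioo_subset_Icc_self ht.1
  obtain ⟨h, hh⟩ : ∃ h, h = t - s := ⟨_, rfl⟩
  have hh0 : 0 ≤ h := by linarith
  obtain ⟨m, hmd⟩ : ∃ m, m = gN G Φ x t - gN G Φ x s := ⟨_, rfl⟩
  have hm0 : 0 ≤ m := by linarith
  obtain ⟨w, hw⟩ : ∃ w, w = x.deriv t - x.deriv s := ⟨_, rfl⟩
  have M := mono_move hG hP hs ht hst
  have e1 := W_lip hP hsI htI hst
  have e3 := hP.dP_lip s hsI t htI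
  have e4 := hP.N_lip s hsI t htI
  have e5 := hP.A_lip s hsI t htI
  have e6 := hP.x_lip s hsI t htI
  rw [abs_of_nonneg (by linarith : 0 ≤ t - s)] at e3 e4 e5 e6
  rw [← hh] at M e1 e3 e4 e5 e6
  rw [← hw] at M
  -- bound on Δp (Δu)
  have hp : pN G x t - pN G x s = ((Z t + AN G Φ x t • dP Φ x t) - (Z s + AN G Φ x s • dP Φ x s)) +
      gN G Φ x s • (dP Φ x t - dP Φ x s) + m • dP Φ x t := by
    rw [p_split hP hs, p_split hP ht, hmd]
    module
  have f1 : ((Z t + AN G Φ x t • dP Φ x t) - (Z s + AN G Φ x s • dP Φ x s)) w ≤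
      ((C + 2 * C ^ 2) * h) * ‖w‖ :=
    (Real.le_norm_self _).trans ((ContinuousLinearMap.le_opNorm _ _).trans (by gcongr))
  have f2 : (gN G Φ x s • (dP Φ x t - dP Φ x s)) w ≤ (C * (C * h)) * ‖w‖ := by
    refine (Real.le_norm_self _).trans ((ContinuousLinearMap.le_opNorm _ _).trans ?_)
    rw [norm_smul]
    have : ‖gN G Φ x s‖ ≤ C := hP.g_bd s hs
    gcongr
  have f3 : dP Φ x t w ≤ C ^ 2 * h := by
    have g1 : dP Φ x t w = sig Φ x t - sig Φ x s - (dP Φ x t - dP Φ x s) (x.deriv s) := by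
      rw [hw, map_sub]; simp only [sig, _root_.sub_apply]; ring
    have g2 : |(dP Φ x t - dP Φ x s) (x.deriv s)| ≤ (C * h) * C := by
      refine (ContinuousLinearMap.le_opNorm (dP Φ x t - dP Φ x s) (x.deriv s)).trans ?_
      have := hP.u_bd s hs
      gcongr
    have g3 := (abs_le.1 g2).1
    rw [g1]; linarith
  have f4 : (pN G x t - pN G x s) w ≤ ((C + 3 * C ^ 2) * h) * ‖w‖ + m * (C ^ 2 * h) := by
    have g1 : (m • dP Φ x t) w = m * dP Φ x t w := rfl
    rw [hp, _root_.add_apply, _root_.add_apply, g1]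
    have := mul_le_mul_of_nonneg_left f3 hm0
    linarith
  -- bound on m
  have f5 : m ≤ C ^ 2 * ‖w‖ + L₁ * h := by
    have g0 : bN G Φ x t - bN G Φ x s = (pN G x t - pN G x s) (nf Φ (x.toFun t)) +
        pN G x s (nf Φ (x.toFun t) - nf Φ (x.toFun s)) := by
      simp [bN, pN]
    have g1 : ‖pN G x t - pN G x s‖ ≤ C * ‖w‖ + C ^ 3 * h := by
      refine (hP.dv_lip t htI s hsI (x.deriv t) (x.deriv s)).trans ?_
      rw [← hw]
      have := hP.u_bd s hs
      calc _ ≤ C * ‖w‖ + C * C * (C * h) := by gcongr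
        _ = _ := by ring
    have g2 : (pN G x t - pN G x s) (nf Φ (x.toFun t)) ≤ (C * ‖w‖ + C ^ 3 * h) * C := by
      refine (Real.le_norm_self _).trans ((ContinuousLinearMap.le_opNorm _ _).trans ?_)
      have := hP.N_bd t htI
      gcongr
    have g3 : pN G x s (nf Φ (x.toFun t) - nf Φ (x.toFun s)) ≤ C * (C * h) := by
      refine (Real.le_norm_self _).trans ((ContinuousLinearMap.le_opNorm _ _).trans ?_)
      have := hP.p_bd s hs
      gcongr
    have g4 := (abs_le.1 e5).1
    have g5 : m = (bN G Φ x t - bN G Φ x s) - (AN G Φ x t - AN G Φ x s) := by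
      rw [hmd]; unfold gN; ring
    rw [g5, g0, hL₁]
    linarith
  have f6 : α * ‖w‖ ^ 2 ≤ K₁ * h * ‖w‖ + K₂ * h ^ 2 := by
    have g1 : m * (C ^ 2 * h) ≤ (C ^ 2 * ‖w‖ + L₁ * h) * (C ^ 2 * h) := by gcongr
    rw [hK₁, hK₂]
    linarith
  have f7 := quad hα hk1 hk2 hh0 (norm_nonneg w) f6
  rw [← hmd, ← hh]
  calc m ≤ C ^ 2 * (((K₁ + K₂) / α + 1) * h) + L₁ * h := f5.trans (by gcongr)
    _ = _ := by ring

theorem g_lip (hG : IsFinslerEnergy n G ℓ α) (hΦ : IsRegularDomain n Φ δ₀)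
    (hx : IsVCritical G Φ x) (hP : Pack G Φ x Z C) :
    ∃ K, 0 ≤ K ∧ ∀ s ∈ Sset G Φ x, ∀ t ∈ Sset G Φ x, s ≤ t →
      gN G Φ x t - gN G Φ x s ≤ K * (t - s) := by
  obtain ⟨K, hK0, hK⟩ := key_est hG hP
  refine ⟨K, hK0, fun s hs t ht hst => ?_⟩
  by_cases hc : noC Φ x s t
  · rw [g_const hG hΦ hx hs ht hst hc, sub_self]
    exact mul_nonneg hK0 (by linarith)
  · unfold noC at hc
    push Not at hc
    obtain ⟨c, hc, h0⟩ := hc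
    refine le_of_forall_pos_le_add fun ε hε => ?_
    set ε' := ε / (2 * (K + 1)) with hε'
    have he : 0 < ε' := by positivity
    obtain ⟨t', a1, a2, a3, a4, a5⟩ := lemU hG hΦ hx (hs.1.1.trans_le hc.1) ht hc.2 h0 he
    obtain ⟨s', b1, b2, b3, b4, b5⟩ := lemU' hG hΦ hx (hc.2.trans_lt ht.1.2) hs hc.1 h0 he
    have h1 := hK s' b1 t' a1 (b2.trans a2).le (g_mono hG hΦ hx b1 a1 (b2.trans a2).le) b5 a5
    have h2 : K * (t' - s') ≤ K * (t - s + 2 * ε') := by gcongr; linarith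
    have h3 : K * (2 * ε') ≤ ε := by
      have : (K + 1) * (2 * ε') = ε := by rw [hε']; field_simp
      nlinarith
    linarith

theorem u_lip (hG : IsFinslerEnergy n G ℓ α) (hΦ : IsRegularDomain n Φ δ₀)
    (hx : IsVCritical G Φ x) (hP : Pack G Φ x Z C) :
    ∃ K, 0 ≤ K ∧ ∀ s ∈ Sset G Φ x, ∀ t ∈ Sset G Φ x, s ≤ t →
      ‖x.deriv t - x.deriv s‖ ≤ K * (t - s) := by
  have hC := hP.nonneg
  have hα := hG.alpha_pos
  obtain ⟨K, hK0, hK⟩ := g_lip hG hΦ hx hP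
  set K₁ := (C + 2 * C ^ 2) + C * C + K * C + C ^ 3 with hK1
  have hk1 : 0 ≤ K₁ := by positivity
  refine ⟨(K₁ + 0) / α + 1, by positivity, fun s hs t ht hst => ?_⟩
  have hsI := Ioo_subset_Icc_self hs.1
  have htI := Ioo_subset_Icc_self ht.1
  have h0 : 0 ≤ t - s := by linarith
  refine quad hα hk1 le_rfl h0 (norm_nonneg _) ?_
  have M := mono_move hG hP hs ht hst
  have e1 := W_lip hP hsI htI hst
  have e3 := hP.dP_lip s hsI t htI
  rw [abs_of_nonneg (by linarith : 0 ≤ t - s)] at e3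
  have hp : pN G x t - pN G x s = ((Z t + AN G Φ x t • dP Φ x t) - (Z s + AN G Φ x s • dP Φ x s)) +
      gN G Φ x s • (dP Φ x t - dP Φ x s) + (gN G Φ x t - gN G Φ x s) • dP Φ x t := by
    rw [p_split hP hs, p_split hP ht]
    module
  have e4 : ‖pN G x t - pN G x s‖ ≤ ((C + 2 * C ^ 2) + C * C + K * C) * (t - s) := by
    rw [hp]
    refine norm_add₃_le.trans ?_
    rw [norm_smul, norm_smul]
    have a1 : ‖gN G Φ x s‖ ≤ C := hP.g_bd s hs
    have a2 : ‖gN G Φ x t - gN G Φ x s‖ ≤ K * (t - s) := by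
      rw [Real.norm_of_nonneg (by linarith [g_mono hG hΦ hx hs ht hst])]
      exact hK s hs t ht hst
    have a3 := hP.dP_bd t htI
    calc _ ≤ (C + 2 * C ^ 2) * (t - s) + C * (C * (t - s)) + (K * (t - s)) * C := by gcongr
      _ = _ := by ring
  have e5 := (Real.le_norm_self _).trans
    ((pN G x t - pN G x s).le_opNorm (x.deriv t - x.deriv s))
  have e6 := mul_le_mul_of_nonneg_right e4 (norm_nonneg (x.deriv t - x.deriv s))
  rw [hK1]
  linarith

end PartF


/-! ### Part H: conclusion -/

section PartH
set_option linter.unusedSectionVars false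
set_option linter.unusedVariables false
variable {n : ℕ} {G : Evec n → Evec n → ℝ} {ℓ α : ℝ} {Φ : Evec n → ℝ} {δ₀ : ℝ}
variable {x : H1Curve n 0 1} {Z : ℝ → Evec n →L[ℝ] ℝ} {C : ℝ}

theorem S_dense (hG : IsFinslerEnergy n G ℓ α) (hΦ : IsRegularDomain n Φ δ₀)
    (x : H1Curve n 0 1) {a b : ℝ} (ha : 0 ≤ a) (hb : b ≤ 1) :
    Ioo a b ⊆ closure (Sset G Φ x ∩ Ioo a b) := by
  intro s hs
  rw [Metric.mem_closure_iff]
  intro ε hε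
  obtain ⟨r, h1, h2, -⟩ := Sset_nonempty_Ioo hG hΦ x (P := fun _ => True) (by simp)
    (a := s) (b := min b (s + ε)) (lt_min hs.2 (by linarith)) (hs.2.trans_le hb)
    (lt_min (ha.trans_lt (hs.1.trans hs.2)) (by linarith [hs.1]))
  refine ⟨r, ⟨h1, hs.1.trans h2.1, h2.2.trans_le (min_le_left _ _)⟩, ?_⟩
  rw [dist_comm, Real.dist_eq, abs_of_pos (by linarith [h2.1])]
  linarith [h2.2.trans_le (min_le_right b (s + ε))]

theorem lip_on {F : Type*} [NormedAddCommGroup F] {S : Set ℝ} {f : ℝ → F} {K : ℝ} (hK : 0 ≤ K)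
    (h : ∀ s ∈ S, ∀ t ∈ S, s ≤ t → ‖f t - f s‖ ≤ K * (t - s)) :
    LipschitzOnWith K.toNNReal f S := by
  refine LipschitzOnWith.of_dist_le_mul fun s hs t ht => ?_
  rw [Real.coe_toNNReal K hK, dist_eq_norm, Real.dist_eq]
  rcases le_total s t with h1 | h1
  · rw [norm_sub_rev, abs_sub_comm, abs_of_nonneg (by linarith)]
    exact h s hs t ht h1
  · rw [abs_of_nonneg (by linarith)]
    exact h t ht s hs h1

theorem exists_ext (hG : IsFinslerEnergy n G ℓ α) (hΦ : IsRegularDomain n Φ δ₀)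
    (hx : IsVCritical G Φ x) (hP : Pack G Φ x Z C) :
    ∃ (v : ℝ → Evec n) (gh : ℝ → ℝ) (Kv Kg : NNReal), LipschitzWith Kv v ∧ LipschitzWith Kg gh ∧
      EqOn x.deriv v (Sset G Φ x) ∧ EqOn (gN G Φ x) gh (Sset G Φ x) := by
  obtain ⟨K, hK0, hK⟩ := g_lip hG hΦ hx hP
  obtain ⟨K', hK0', hK'⟩ := u_lip hG hΦ hx hP
  obtain ⟨v, hv, hv'⟩ := (lip_on hK0' hK').extend_finite_dimension
  obtain ⟨gh, hg, hg'⟩ := (lip_on (f := gN G Φ x) hK0 (fun s hs t ht hst => by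
    rw [Real.norm_of_nonneg (by linarith [g_mono hG hΦ hx hs ht hst])]
    exact hK s hs t ht hst)).extend_real
  exact ⟨v, gh, _, _, hv, hg, hv', hg'⟩

theorem lip_isAC {F : Type*} [NormedAddCommGroup F] [NormedSpace ℝ F] [FiniteDimensional ℝ F]
    {v : ℝ → F} {K : NNReal} (hv : LipschitzWith K v) : IsAC v (deriv v) := by
  have hc : CompleteSpace F := FiniteDimensional.complete ℝ F
  have : SecondCountableTopology F := by
    have : ProperSpace F := FiniteDimensional.proper ℝ F
    infer_instance
  borelize F
  refine isAC_of_ac hv.lipschitzOnWith.absolutelyContinuousOnInterval ?_ ?_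
  · rw [intervalIntegrable_iff, uIoc_of_le zero_le_one]
    refine Integrable.mono' (g := fun _ => (K:ℝ)) (integrable_const _)
      (measurable_deriv v).aestronglyMeasurable ?_
    exact ae_of_all _ fun s => norm_deriv_le_of_lipschitz hv
  · filter_upwards [hv.ae_differentiableAt (μ := volume)] with s hs _ using hs.hasDerivAt

variable {v : ℝ → Evec n} {gh : ℝ → ℝ} {Kv Kg : NNReal}

theorem gh_mono (hG : IsFinslerEnergy n G ℓ α) (hΦ : IsRegularDomain n Φ δ₀)
    (hx : IsVCritical G Φ x) (hg : LipschitzWith Kg gh) (hgS : EqOn (gN G Φ x) gh (Sset G Φ x)) :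
    MonotoneOn gh (Ioo 0 1) := by
  have h1 : ∀ s ∈ Sset G Φ x, ∀ t ∈ Ioo (0:ℝ) 1, s < t → gh s ≤ gh t := by
    intro s hs t ht hst
    have hcl : IsClosed {r | gh s ≤ gh r} := isClosed_le continuous_const hg.continuous
    have hsub : Sset G Φ x ∩ Ioo s 1 ⊆ {r | gh s ≤ gh r} := by
      rintro r ⟨hr, hr'⟩
      change gh s ≤ gh r
      rw [← hgS hs, ← hgS hr]
      exact g_mono hG hΦ hx hs hr hr'.1.le
    exact closure_minimal hsub hcl (S_dense hG hΦ x hs.1.1.le le_rfl ⟨hst, ht.2⟩)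
  intro s hs t ht hst
  rcases hst.eq_or_lt with rfl | hst
  · exact le_rfl
  have hcl : IsClosed {r | gh r ≤ gh t} := isClosed_le hg.continuous continuous_const
  have hsub : Sset G Φ x ∩ Ioo 0 t ⊆ {r | gh r ≤ gh t} := fun r hr => h1 r hr.1 t ht hr.2.2
  exact closure_minimal hsub hcl (S_dense hG hΦ x le_rfl ht.2.le ⟨hs.1, hst⟩)

theorem gh_deriv_nonneg (hG : IsFinslerEnergy n G ℓ α) (hΦ : IsRegularDomain n Φ δ₀)
    (hx : IsVCritical G Φ x) (hg : LipschitzWith Kg gh) (hgS : EqOn (gN G Φ x) gh (Sset G Φ x))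
    {s : ℝ} (hs : s ∈ Ioo (0:ℝ) 1) : 0 ≤ deriv gh s := by
  rw [← derivWithin_of_mem_nhds (Ioo_mem_nhds hs.1 hs.2)]
  exact (gh_mono hG hΦ hx hg hgS).derivWithin_nonneg

theorem gh_deriv_zero (hG : IsFinslerEnergy n G ℓ α) (hΦ : IsRegularDomain n Φ δ₀)
    (hx : IsVCritical G Φ x) (hg : LipschitzWith Kg gh) (hgS : EqOn (gN G Φ x) gh (Sset G Φ x))
    {s : ℝ} (hs : s ∈ Ioo (0:ℝ) 1) (h0 : Φ (x.toFun s) ≠ 0) : deriv gh s = 0 := by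
  have h1 : ContinuousAt (fun r => Φ (x.toFun r)) s :=
    (phi_cont hΦ x).continuousAt (Icc_mem_nhds hs.1 hs.2)
  have h2 := (h1.eventually_ne h0).and (Ioo_mem_nhds hs.1 hs.2)
  obtain ⟨a, b, hab, h3⟩ := mem_nhds_iff_exists_Ioo_subset.1 h2
  have ha : 0 ≤ a := by
    by_contra hcon
    push Not at hcon
    have := (h3 (show max a 0 / 2 + min s 0 / 2 ∈ Ioo a b by
      rw [max_eq_right hcon.le, min_eq_right hs.1.le]; exact ⟨by linarith, by linarith [hs.1, hab.2]⟩)).2.1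
    rw [max_eq_right hcon.le, min_eq_right hs.1.le] at this
    linarith
  have hb : b ≤ 1 := by
    by_contra hcon
    push Not at hcon
    have := (h3 (show (1:ℝ) ∈ Ioo a b from ⟨hab.1.trans hs.2, hcon⟩)).2.2
    linarith
  obtain ⟨r0, hr0, hr0', -⟩ := Sset_nonempty_Ioo hG hΦ x (P := fun _ => True) (by simp)
    (hab.1.trans hab.2) (hab.1.trans hs.2) (hs.1.trans hab.2)
  have hEq : EqOn gh (fun _ => gh r0) (Ioo a b) := by
    refine EqOn.of_subset_closure (s := Sset G Φ x ∩ Ioo a b) ?_ hg.continuous.continuousOn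
      continuousOn_const inter_subset_right (S_dense hG hΦ x ha hb)
    rintro r ⟨hr, hr'⟩
    change gh r = gh r0
    rw [← hgS hr, ← hgS hr0]
    rcases le_total r r0 with h | h
    · exact g_const hG hΦ hx hr hr0 h fun z hz =>
        (h3 ⟨hr'.1.trans_le hz.1, hz.2.trans_lt hr0'.2⟩).1
    · exact (g_const hG hΦ hx hr0 hr h fun z hz =>
        (h3 ⟨hr0'.1.trans_le hz.1, hz.2.trans_lt hr'.2⟩).1).symm
  have : gh =ᶠ[nhds s] fun _ => gh r0 :=
    Filter.eventuallyEq_of_mem (Ioo_mem_nhds hab.1 hab.2) hEq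
  rw [this.deriv_eq, deriv_const]

theorem phat_eq (hG : IsFinslerEnergy n G ℓ α) (hΦ : IsRegularDomain n Φ δ₀)
    (hZ : IsAC Z (aP G Φ x)) (hP : Pack G Φ x Z C)
    (hv : LipschitzWith Kv v) (hg : LipschitzWith Kg gh)
    (hvS : EqOn x.deriv v (Sset G Φ x)) (hgS : EqOn (gN G Φ x) gh (Sset G Φ x)) :
    EqOn (fun t => dvCLM G (x.toFun t) (v t))
      (fun t => Z t + (gh t + AN G Φ x t) • dP Φ x t) (Ioo 0 1) := by
  have hsub : Ioo (0:ℝ) 1 ⊆ Icc 0 1 := Ioo_subset_Icc_self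
  refine EqOn.of_subset_closure (s := Sset G Φ x ∩ Ioo 0 1) ?_ ?_ ?_ inter_subset_right
    (S_dense hG hΦ x le_rfl le_rfl)
  · rintro r ⟨hr, -⟩
    change dvCLM G (x.toFun r) (v r) = Z r + (gh r + AN G Φ x r) • dP Φ x r
    rw [← hvS hr, ← hgS hr]
    have := hP.p_eq r hr
    unfold pN at this
    rw [this]
    simp [gN]
  · exact (dv_continuous hG).comp_continuousOn
      (((x_isAC x).continuousOn.mono hsub).prodMk hv.continuous.continuousOn)
  · exact (hZ.continuousOn.mono hsub).add ((hg.continuous.continuousOn.add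
      ((AN_isAC hG hΦ x).continuousOn.mono hsub)).smul ((dP_isAC hΦ x).continuousOn.mono hsub))

/-- Euler-Lagrange equation almost everywhere. -/
theorem phat_deriv (hG : IsFinslerEnergy n G ℓ α) (hΦ : IsRegularDomain n Φ δ₀)
    (hZ : IsAC Z (aP G Φ x)) (hP : Pack G Φ x Z C)
    (hv : LipschitzWith Kv v) (hg : LipschitzWith Kg gh)
    (hvS : EqOn x.deriv v (Sset G Φ x)) (hgS : EqOn (gN G Φ x) gh (Sset G Φ x)) :
    ∀ᵐ s, s ∈ Icc (0:ℝ) 1 → HasDerivAt (fun t => dvCLM G (x.toFun t) (v t))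
      (dqCLM G (x.toFun s) (v s) + deriv gh s • dP Φ x s) s := by
  filter_upwards [Sset_ae hG hΦ x, hZ.ae_hasDerivAt, (AN_isAC hG hΦ x).ae_hasDerivAt,
    (dP_isAC hΦ x).ae_hasDerivAt, (lip_isAC hg).ae_hasDerivAt] with s h1 h2 h3 h4 h5 hs
  have hS := h1 hs
  have hd := (h2 hs).add (((h5 hs).add (h3 hs)).smul (h4 hs))
  have hd2 := hd.congr_of_eventuallyEq (f₁ := fun t => dvCLM G (x.toFun t) (v t))
    (Filter.eventuallyEq_of_mem (Ioo_mem_nhds hS.1.1 hS.1.2)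
      (phat_eq hG hΦ hZ hP hv hg hvS hgS))
  refine hd2.congr_deriv ?_
  have e1 : (gh + AN G Φ x) s = bN G Φ x s := by
    change gh s + AN G Φ x s = _
    rw [← hgS hS]; simp [gN]
  rw [e1, ← hvS hS]
  simp only [aP, aPq, aN, bN, dP]
  module

theorem energy_deriv (hG : IsFinslerEnergy n G ℓ α) (hΦ : IsRegularDomain n Φ δ₀)
    (hx : IsVCritical G Φ x) (hZ : IsAC Z (aP G Φ x)) (hP : Pack G Φ x Z C)
    (hv : LipschitzWith Kv v) (hg : LipschitzWith Kg gh)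
    (hvS : EqOn x.deriv v (Sset G Φ x)) (hgS : EqOn (gN G Φ x) gh (Sset G Φ x)) :
    ∀ᵐ s, s ∈ Icc (0:ℝ) 1 → HasDerivAt (fun t => dvCLM G (x.toFun t) (v t) (v t)) 0 s := by
  filter_upwards [Sset_ae hG hΦ x, phat_deriv hG hΦ hZ hP hv hg hvS hgS,
    (x_isAC x).ae_hasDerivAt, (lip_isAC hv).ae_hasDerivAt, (phi_isAC hΦ x).ae_hasDerivAt]
    with s h1 h2 h3 h4 h5 hs
  have hS := h1 hs
  have hd := (h2 hs).clm_apply (h4 hs)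
  by_cases h0 : v s = 0
  · refine hd.congr_deriv ?_
    rw [h0, dv_zero hG]; simp
  have hxs := h3 hs
  rw [hvS hS] at hxs
  have hE := (diffAt hG (q := x.toFun s) h0).hasFDerivAt.comp_hasDerivAt s (hxs.prodMk (h4 hs))
  have hE2 := hE.const_mul 2
  have heq : (fun t => dvCLM G (x.toFun t) (v t) (v t)) = fun t => 2 * ((fun p : Evec n × Evec n =>
      G p.1 p.2) ∘ fun t => (x.toFun t, v t)) t := by
    funext t; simp [euler hG]
  have hu := (heq ▸ hd).unique hE2
  have hF : fderiv ℝ (fun p : Evec n × Evec n => G p.1 p.2) (x.toFun s, v s) (v s, deriv v s) =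
      dqCLM G (x.toFun s) (v s) (v s) + dvCLM G (x.toFun s) (v s) (deriv v s) := by
    rw [dq_eq hG h0, dv_eq hG h0]
    simp only [ContinuousLinearMap.comp_apply, ContinuousLinearMap.inl_apply,
      ContinuousLinearMap.inr_apply]
    rw [← map_add]
    simp
  rw [hF] at hu
  have hz : deriv gh s * dP Φ x s (v s) = 0 := by
    by_cases hc : Φ (x.toFun s) = 0
    · have hmax : IsLocalMax (fun r => Φ (x.toFun r)) s := by
        filter_upwards [Icc_mem_nhds hS.1.1 hS.1.2] with r hr
        rw [hc]; exact hx.1.1 r hr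
      have := hmax.hasDerivAt_eq_zero (h5 hs)
      unfold sig at this
      rw [hvS hS] at this
      rw [this, mul_zero]
    · rw [gh_deriv_zero hG hΦ hx hg hgS hS.1 hc, zero_mul]
  refine hd.congr_deriv ?_
  have e : (dqCLM G (x.toFun s) (v s) + deriv gh s • dP Φ x s) (v s) =
    dqCLM G (x.toFun s) (v s) (v s) + deriv gh s * dP Φ x s (v s) := rfl
  rw [e] at hu ⊢
  linarith

theorem energy_const (hG : IsFinslerEnergy n G ℓ α) (hΦ : IsRegularDomain n Φ δ₀)
    (hx : IsVCritical G Φ x) (hZ : IsAC Z (aP G Φ x)) (hP : Pack G Φ x Z C)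
    (hv : LipschitzWith Kv v) (hg : LipschitzWith Kg gh)
    (hvS : EqOn x.deriv v (Sset G Φ x)) (hgS : EqOn (gN G Φ x) gh (Sset G Φ x)) :
    ∃ c, ∀ s ∈ Icc (0:ℝ) 1, dvCLM G (x.toFun s) (v s) (v s) = c := by
  have hl := ell_pos hG
  have hC := hP.nonneg
  obtain ⟨B, hB⟩ := (lip_isAC hv).bounded
  have hB0 : 0 ≤ B := (norm_nonneg _).trans (hB 0 (by simp))
  have hLip : LipschitzOnWith (ℓ * B * Kv + (C * Kv + C * B * C) * B).toNNReal
      (fun t => dvCLM G (x.toFun t) (v t) (v t)) (uIcc 0 1) := by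
    rw [uIcc_of_le zero_le_one]
    refine lip_on (by positivity) fun s hs t ht hst => ?_
    have h0 : 0 ≤ t - s := by linarith
    have e1 : ‖v t - v s‖ ≤ Kv * (t - s) := by
      have := hv.dist_le_mul t s
      rwa [dist_eq_norm, Real.dist_eq, abs_of_nonneg h0] at this
    have e2 := hP.x_lip s hs t ht
    rw [abs_of_nonneg h0] at e2
    have e3 : ‖dvCLM G (x.toFun t) (v t) - dvCLM G (x.toFun s) (v s)‖ ≤
        (C * Kv + C * B * C) * (t - s) := by
      refine (hP.dv_lip t ht s hs (v t) (v s)).trans ?_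
      have := hB s hs
      calc _ ≤ C * (Kv * (t - s)) + C * B * (C * (t - s)) := by gcongr
        _ = _ := by ring
    have e4 : ‖dvCLM G (x.toFun t) (v t)‖ ≤ ℓ * B :=
      (dv_le hG _ _).trans (by have := hB t ht; gcongr)
    have e5 : dvCLM G (x.toFun t) (v t) (v t) - dvCLM G (x.toFun s) (v s) (v s) =
      dvCLM G (x.toFun t) (v t) (v t - v s) +
        (dvCLM G (x.toFun t) (v t) - dvCLM G (x.toFun s) (v s)) (v s) := by
      simp
    rw [e5]
    refine (norm_add_le _ _).trans ?_
    have e6 := (dvCLM G (x.toFun t) (v t)).le_opNorm (v t - v s)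
    have e7 := (dvCLM G (x.toFun t) (v t) - dvCLM G (x.toFun s) (v s)).le_opNorm (v s)
    have := hB s hs
    calc _ ≤ (ℓ * B) * (Kv * (t - s)) + ((C * Kv + C * B * C) * (t - s)) * B :=
          add_le_add (e6.trans (by gcongr)) (e7.trans (by gcongr))
      _ = _ := by ring
  have := hLip.absolutelyContinuousOnInterval.const_of_ae_hasDerivAt_zero (by
    rw [uIcc_of_le zero_le_one]
    exact energy_deriv hG hΦ hx hZ hP hv hg hvS hgS)
  rwa [uIcc_of_le zero_le_one] at this

end PartH

theorem main {n : ℕ} (G : Evec n → Evec n → ℝ) (ℓ α : ℝ)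
    (hG : IsFinslerEnergy n G ℓ α)
    (Φ : Evec n → ℝ) (δ₀ : ℝ) (hΦ : IsRegularDomain n Φ δ₀)
    (x : H1Curve n 0 1) (hx : IsVCritical G Φ x) :
    ∃ (v xdd : ℝ → Evec n) (lam : ℝ → ℝ) (M : ℝ),
      (∀ᵐ s ∂(volume.restrict (Icc (0:ℝ) 1)), v s = x.deriv s) ∧
      (∀ t ∈ Icc (0:ℝ) 1, x.toFun t = x.toFun 0 + ∫ s in (0:ℝ)..t, v s) ∧
      IntegrableOn xdd (Icc (0:ℝ) 1) ∧
      (∀ t ∈ Icc (0:ℝ) 1, v t = v 0 + ∫ s in (0:ℝ)..t, xdd s) ∧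
      (∀ s ∈ Icc (0:ℝ) 1, ‖xdd s‖ ≤ M) ∧
      (∀ s ∈ Icc (0:ℝ) 1, |lam s| ≤ M) ∧
      (∀ᵐ s ∂(volume.restrict (Icc (0:ℝ) 1)), lam s ≤ 0) ∧
      (∀ s ∈ Icc (0:ℝ) 1, Φ (x.toFun s) ≠ 0 → lam s = 0) ∧
      (∀ᵐ s ∂(volume.restrict (Icc (0:ℝ) 1)),
        ∃ D : Evec n →L[ℝ] ℝ,
          HasDerivAt (fun t => dvCLM G (x.toFun t) (v t)) D s ∧
          ∀ w : Evec n,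
            dqCLM G (x.toFun s) (v s) w - D w = lam s * ⟪gradient Φ (x.toFun s), w⟫) ∧
      ((¬ ∃ c : Evec n, ∀ s ∈ Icc (0:ℝ) 1, x.toFun s = c) →
        ∀ s ∈ Icc (0:ℝ) 1, v s ≠ 0) := by
  classical
  obtain ⟨Z, C, hZ, hP⟩ := pack_exists hG hΦ hx
  obtain ⟨v, gh, Kv, Kg, hv, hg, hvS, hgS⟩ := exists_ext hG hΦ hx hP
  have hae : ∀ᵐ s, s ∈ Icc (0:ℝ) 1 → v s = x.deriv s := by
    filter_upwards [Sset_ae hG hΦ x] with s hs h using (hvS (hs h)).symm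
  have hxv : ∀ t ∈ Icc (0:ℝ) 1, x.toFun t = x.toFun 0 + ∫ s in (0:ℝ)..t, v s := by
    intro t ht
    rw [x.eq_add_integral t ht]
    congr 1
    refine intervalIntegral.integral_congr_ae ?_
    filter_upwards [hae] with s hs h
    rw [uIoc_of_le ht.1] at h
    exact (hs ⟨h.1.le, h.2.trans ht.2⟩).symm
  have hac := lip_isAC hv
  refine ⟨v, deriv v, fun s => if s ∈ Ioo (0:ℝ) 1 ∧ Φ (x.toFun s) = 0 then - deriv gh s else 0,
    Kv + Kg, (ae_restrict_iff' measurableSet_Icc).2 hae, hxv, ?_, ?_, ?_, ?_, ?_, ?_, ?_, ?_⟩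
  · exact (intervalIntegrable_iff_integrableOn_Icc_of_le zero_le_one).1 hac.1
  · exact hac.2
  · intro s _
    have : ‖deriv v s‖ ≤ Kv := norm_deriv_le_of_lipschitz hv
    have := Kg.coe_nonneg
    linarith
  · intro s _
    have h1 : ‖deriv gh s‖ ≤ Kg := norm_deriv_le_of_lipschitz hg
    have := Kv.coe_nonneg
    have := Kg.coe_nonneg
    rw [Real.norm_eq_abs] at h1
    dsimp only
    split_ifs
    · rw [abs_neg]; linarith
    · rw [abs_zero]; linarith
  · refine ae_of_all _ fun s => ?_
    dsimp only
    split_ifs with h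
    · have := gh_deriv_nonneg hG hΦ hx hg hgS h.1
      linarith
    · exact le_rfl
  · intro s _ h
    simp [h]
  · rw [ae_restrict_iff' measurableSet_Icc]
    filter_upwards [Sset_ae hG hΦ x, phat_deriv hG hΦ hZ hP hv hg hvS hgS] with s h1 h2 hs
    refine ⟨_, h2 hs, fun w => ?_⟩
    have hS := (h1 hs).1
    rw [inner_grad hΦ]
    change _ - (dqCLM G (x.toFun s) (v s) w + deriv gh s * dP Φ x s w) = _
    unfold dP
    by_cases hc : Φ (x.toFun s) = 0
    · rw [if_pos ⟨hS, hc⟩]; ring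
    · rw [if_neg (fun h => hc h.2), gh_deriv_zero hG hΦ hx hg hgS hS hc]; ring
  · intro hnc s0 hs0 h0
    apply hnc
    obtain ⟨c, hc⟩ := energy_const hG hΦ hx hZ hP hv hg hvS hgS
    have hc0 : c = 0 := by rw [← hc s0 hs0, h0, map_zero]
    have hv0 : ∀ s ∈ Icc (0:ℝ) 1, v s = 0 := by
      intro s hs
      have h1 := alpha_le hG (x.toFun s) (v s)
      rw [hc s hs, hc0] at h1
      by_contra hne
      have h2 : 0 < ‖v s‖ := norm_pos_iff.2 hne
      have h3 := hG.alpha_pos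
      have : 0 < α * ‖v s‖ ^ 2 := by positivity
      linarith
    refine ⟨x.toFun 0, fun t ht => ?_⟩
    rw [hxv t ht]
    have : ∫ s in (0:ℝ)..t, v s = ∫ s in (0:ℝ)..t, (0 : Evec n) := by
      refine intervalIntegral.integral_congr fun s hs => ?_
      rw [uIcc_of_le ht.1] at hs
      exact hv0 s ⟨hs.1, hs.2.trans ht.2⟩
    rw [this]; simp

end Fins

/-- Regularity of `V⁻`-critical curves: a `V⁻`-critical curve `x` for `J` on `Mf` has
`H^{2,∞}`-regularity (its derivative has an absolutely continuous representative `v` with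
essentially bounded derivative `xdd`), and there is `λ ∈ L^∞([0,1],ℝ)`, `λ ≤ 0` a.e.,
vanishing off `C_x = {s : Φ(x(s)) = 0}`, such that
`d_qG(x,ẋ) − (d/ds) d_vG(x,ẋ) = λ∇Φ(x)` a.e.; if `x` is non-constant then `ẋ(s) ≠ 0`
for every `s ∈ [0,1]`. -/
theorem stmt_4 {n : ℕ} (G : Evec n → Evec n → ℝ) (ℓ α : ℝ)
    (hG : IsFinslerEnergy n G ℓ α)
    (Φ : Evec n → ℝ) (δ₀ : ℝ) (hΦ : IsRegularDomain n Φ δ₀)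
    (x : H1Curve n 0 1) (hx : IsVCritical G Φ x) :
    ∃ (v xdd : ℝ → Evec n) (lam : ℝ → ℝ) (M : ℝ),
      (∀ᵐ s ∂(volume.restrict (Icc (0:ℝ) 1)), v s = x.deriv s) ∧
      (∀ t ∈ Icc (0:ℝ) 1, x.toFun t = x.toFun 0 + ∫ s in (0:ℝ)..t, v s) ∧
      IntegrableOn xdd (Icc (0:ℝ) 1) ∧
      (∀ t ∈ Icc (0:ℝ) 1, v t = v 0 + ∫ s in (0:ℝ)..t, xdd s) ∧
      (∀ s ∈ Icc (0:ℝ) 1, ‖xdd s‖ ≤ M) ∧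
      (∀ s ∈ Icc (0:ℝ) 1, |lam s| ≤ M) ∧
      (∀ᵐ s ∂(volume.restrict (Icc (0:ℝ) 1)), lam s ≤ 0) ∧
      (∀ s ∈ Icc (0:ℝ) 1, Φ (x.toFun s) ≠ 0 → lam s = 0) ∧
      (∀ᵐ s ∂(volume.restrict (Icc (0:ℝ) 1)),
        ∃ D : Evec n →L[ℝ] ℝ,
          HasDerivAt (fun t => dvCLM G (x.toFun t) (v t)) D s ∧
          ∀ w : Evec n,
            dqCLM G (x.toFun s) (v s) w - D w = lam s * ⟪gradient Φ (x.toFun s), w⟫) ∧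
      ((¬ ∃ c : Evec n, ∀ s ∈ Icc (0:ℝ) 1, x.toFun s = c) →
        ∀ s ∈ Icc (0:ℝ) 1, v s ≠ 0) := by
  exact Fins.main G ℓ α hG Φ δ₀ hΦ x hx

end
end

section
/- Suppose G is a Finsler-type energy on ℝ^n and Φ defines a regular bounded domain Ω with constant δ₀. Fix [a,b] ⊂ [0,1], p,q ∈ Ω̄ and δ ∈ (0,δ₀), and assume the set C_δ := {γ H¹ curve on [a,b] : γ(s) ∈ Ω_δ for all s, γ(a) = p, γ(b) = q} is nonempty. Then the penalized functional J_δ(γ) := (1/2)∫_a^b G(γ,γ̇) ds + ∫_a^b χ_δ(Φ(γ)) ds attains its minimum on C_δ. -/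
open MeasureTheory Set Filter RealInnerProductSpace

noncomputable section

lemma finsler_zero {n : ℕ} {G : Evec n → Evec n → ℝ} {ℓ α : ℝ} (hG : IsFinslerEnergy n G ℓ α)
    (q : Evec n) : G q 0 = 0 := by
  have h1 := hG.lower q 0
  have h2 := hG.upper q 0
  simp at h1 h2
  linarith

lemma finsler_nonneg {n : ℕ} {G : Evec n → Evec n → ℝ} {ℓ α : ℝ} (hG : IsFinslerEnergy n G ℓ α)
    (q v : Evec n) : 0 ≤ G q v := by
  have h1 := hG.lower q v
  have := hG.one_le_ell
  refine le_trans ?_ h1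
  positivity

lemma finsler_contDiffAt {n : ℕ} {G : Evec n → Evec n → ℝ} {ℓ α : ℝ}
    (hG : IsFinslerEnergy n G ℓ α) (q v : Evec n) (hv : v ≠ 0) :
    ContDiffAt ℝ 2 (fun p : Evec n × Evec n => G p.1 p.2) (q, v) := by
  refine hG.smooth.contDiffAt (IsOpen.mem_nhds ?_ hv)
  exact isOpen_ne_fun continuous_snd continuous_const

lemma finsler_contDiffAt_v {n : ℕ} {G : Evec n → Evec n → ℝ} {ℓ α : ℝ}
    (hG : IsFinslerEnergy n G ℓ α) (q v : Evec n) (hv : v ≠ 0) :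
    ContDiffAt ℝ 2 (fun w => G q w) v :=
  ContDiffAt.comp (g := fun p : Evec n × Evec n => G p.1 p.2) v (finsler_contDiffAt hG q v hv)
    (contDiffAt_const.prodMk contDiffAt_id)

lemma finsler_lip {n : ℕ} {G : Evec n → Evec n → ℝ} {ℓ α : ℝ} (hG : IsFinslerEnergy n G ℓ α)
    (q q' v : Evec n) : |G q v - G q' v| ≤ ℓ * (1 + ‖v‖ ^ 2) * ‖q - q'‖ := by
  have hd : ∀ z ∈ (univ : Set (Evec n)), DifferentiableAt ℝ (fun z => G z v) z := by
    intro z _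
    by_cases hv : v = 0
    · subst hv
      simp only [finsler_zero hG]
      exact differentiableAt_const _
    · have : ContDiffAt ℝ 2 (fun z => G z v) z :=
        ContDiffAt.comp (g := fun p : Evec n × Evec n => G p.1 p.2) z
          (finsler_contDiffAt hG z v hv) (contDiffAt_id.prodMk contDiffAt_const)
      exact this.differentiableAt (by norm_num)
  have := Convex.norm_image_sub_le_of_norm_fderiv_le (𝕜 := ℝ) hd
    (fun z _ => hG.dq_bound z v) convex_univ (mem_univ q') (mem_univ q)
  simpa using this

lemma finsler_euler {n : ℕ} {G : Evec n → Evec n → ℝ} {ℓ α : ℝ} (hG : IsFinslerEnergy n G ℓ α)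
    (q v : Evec n) (hv : v ≠ 0) : dvCLM G q v v = 2 * G q v := by
  have hd : HasFDerivAt (fun w => G q w) (dvCLM G q v) v :=
    ((finsler_contDiffAt_v hG q v hv).differentiableAt (by norm_num)).hasFDerivAt
  have h1 : HasDerivAt (fun t : ℝ => t • v) v 1 := by
    simpa using (hasDerivAt_id (1:ℝ)).smul_const v
  have hd' : HasFDerivAt (fun w => G q w) (dvCLM G q v) ((1:ℝ) • v) := by simpa using hd
  have h2 := hd'.comp_hasDerivAt (1:ℝ) h1
  have h3 : HasDerivAt (fun t : ℝ => t ^ 2 * G q v) (2 * G q v) 1 := by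
    simpa using (hasDerivAt_pow 2 (1:ℝ)).mul_const (G q v)
  refine h2.unique (h3.congr_of_eventuallyEq ?_)
  filter_upwards [lt_mem_nhds (show (0:ℝ) < 1 by norm_num)] with t ht
  exact hG.homog q v t ht

lemma finsler_tangent {n : ℕ} {G : Evec n → Evec n → ℝ} {ℓ α : ℝ} (hG : IsFinslerEnergy n G ℓ α)
    (q v w : Evec n) : G q v + dvCLM G q v (w - v) ≤ G q w := by
  by_cases hv : v = 0
  · subst hv
    have : dvCLM G q 0 = 0 := by
      apply IsLocalMin.fderiv_eq_zero
      refine Filter.Eventually.of_forall fun w => ?_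
      simp only [finsler_zero hG]
      exact finsler_nonneg hG q w
    rw [this, finsler_zero hG]
    simpa using finsler_nonneg hG q w
  by_cases hs : ∃ t ∈ Icc (0:ℝ) 1, v + t • (w - v) = 0
  · obtain ⟨t, ht, h0⟩ := hs
    have htpos : 0 < t := by
      rcases ht.1.lt_or_eq with h | h
      · exact h
      · subst h; simp at h0; exact absurd h0 hv
    have h1 : dvCLM G q v (v + t • (w - v)) = 0 := by rw [h0]; simp
    rw [map_add, map_smul, finsler_euler hG q v hv, smul_eq_mul] at h1
    have hg := finsler_nonneg hG q v
    have hg' := finsler_nonneg hG q w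
    have : dvCLM G q v (w - v) = -(2 * G q v) / t := by field_simp; linarith
    rw [this]
    have h2 : -(2 * G q v) / t ≤ - (2 * G q v) := by
      rw [div_le_iff₀ htpos]; nlinarith [ht.2]
    linarith
  · push Not at hs
    set d := w - v with hd
    have hline : ∀ t : ℝ, HasDerivAt (fun t : ℝ => v + t • d) d t := fun t => by
      simpa using ((hasDerivAt_id t).smul_const d).const_add v
    have h1 : ∀ t ∈ Icc (0:ℝ) 1, HasDerivAt (fun t : ℝ => G q (v + t • d))
        (dvCLM G q (v + t • d) d) t := by
      intro t ht
      have : HasFDerivAt (fun w => G q w) (dvCLM G q (v + t • d)) (v + t • d) :=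
        ((finsler_contDiffAt_v hG q _ (hs t ht)).differentiableAt (by norm_num)).hasFDerivAt
      exact this.comp_hasDerivAt t (hline t)
    have h2 : ∀ t ∈ Icc (0:ℝ) 1, HasDerivAt (fun t : ℝ => dvCLM G q (v + t • d) d)
        (fderiv ℝ (fun u => dvCLM G q u d) (v + t • d) d) t := by
      intro t ht
      have hc : ContDiffAt ℝ 1 (fun u => dvCLM G q u) (v + t • d) :=
        (finsler_contDiffAt_v hG q _ (hs t ht)).fderiv_right (by norm_num)
      have hdd : DifferentiableAt ℝ (fun u => dvCLM G q u d) (v + t • d) :=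
        (hc.differentiableAt (by norm_num)).clm_apply (differentiableAt_const d)
      exact hdd.hasFDerivAt.comp_hasDerivAt t (hline t)
    obtain ⟨ξ, hξ, hξe⟩ := exists_hasDerivAt_eq_slope (fun t : ℝ => G q (v + t • d))
      (fun t => dvCLM G q (v + t • d) d) (show (0:ℝ) < 1 by norm_num)
      (fun t ht => (h1 t ht).continuousAt.continuousWithinAt)
      (fun t ht => h1 t (Ioo_subset_Icc_self ht))
    obtain ⟨η, hη, hηe⟩ := exists_hasDerivAt_eq_slope (fun t : ℝ => dvCLM G q (v + t • d) d)
      (fun t => fderiv ℝ (fun u => dvCLM G q u d) (v + t • d) d) hξ.1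
      (fun t ht => (h2 t ⟨ht.1, ht.2.trans hξ.2.le⟩).continuousAt.continuousWithinAt)
      (fun t ht => h2 t ⟨ht.1.le, ht.2.le.trans hξ.2.le⟩)
    have hpos := hG.vv_convex q (v + η • d) (hs η ⟨hη.1.le, hη.2.le.trans hξ.2.le⟩) d
    have hα : 0 ≤ α * ‖d‖ ^ 2 := by have := hG.alpha_pos; positivity
    have h3 : 0 ≤ (dvCLM G q (v + ξ • d) d - dvCLM G q (v + (0:ℝ) • d) d) / (ξ - 0) := by
      rw [← hηe]; linarith
    have h4 : 0 ≤ dvCLM G q (v + ξ • d) d - dvCLM G q (v + (0:ℝ) • d) d := by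
      have := mul_nonneg h3 hξ.1.le
      rwa [sub_zero, div_mul_cancel₀ _ hξ.1.ne'] at this
    simp only [zero_smul, add_zero, one_smul, sub_zero, div_one] at h4 hξe
    have : v + d = w := by rw [hd]; abel
    rw [this] at hξe
    linarith

lemma chi_nonneg (δ t : ℝ) : 0 ≤ chi δ t := by
  unfold chi; split_ifs <;> positivity

lemma chi_continuousOn {δ : ℝ} (hδ : 0 < δ) : ContinuousOn (chi δ) (Iio δ) := by
  have : EqOn (chi δ) (fun t => (max t 0) ^ 2 / (δ - max t 0) ^ 2) (Iio δ) := by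
    intro t ht
    unfold chi
    split_ifs with h
    · simp [max_eq_right h]
    · simp only [max_eq_left (not_le.1 h).le]
  refine ContinuousOn.congr ?_ this
  refine ContinuousOn.div (by fun_prop) (by fun_prop) ?_
  intro t ht
  have : max t 0 < δ := max_lt ht hδ
  have : δ - max t 0 > 0 := by linarith
  positivity

lemma chi_lower {δ t : ℝ} (hδ : 0 < δ) (ht : t < δ) :
    (δ ^ 2 / 4) * (1 / (δ - t) ^ 2) - 1 ≤ chi δ t := by
  have h : 0 < δ - t := by linarith
  rcases le_or_gt t (δ / 2) with h1 | h1
  · refine le_trans ?_ (chi_nonneg δ t)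
    rw [mul_one_div, sub_nonpos, div_le_one (by positivity)]
    nlinarith
  · have : chi δ t = t ^ 2 / (δ - t) ^ 2 := by
      unfold chi; rw [if_neg]; linarith
    rw [this, mul_one_div]
    have : δ ^ 2 / 4 / (δ - t) ^ 2 ≤ t ^ 2 / (δ - t) ^ 2 := by
      gcongr; nlinarith
    linarith

lemma H1_intble {n : ℕ} {a b : ℝ} (γ : H1Curve n a b) {s t : ℝ} (hs : s ∈ Icc a b)
    (ht : t ∈ Icc a b) : IntervalIntegrable γ.deriv volume s t :=
  (γ.deriv_integrable.mono_set (uIcc_subset_Icc hs ht)).intervalIntegrable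

lemma H1_holder {n : ℕ} {a b : ℝ} (γ : H1Curve n a b) {B : ℝ}
    (hB : ∫ s in Icc a b, ‖γ.deriv s‖ ^ 2 ≤ B) {s t : ℝ} (hs : s ∈ Icc a b)
    (ht : t ∈ Icc a b) : ‖γ.toFun t - γ.toFun s‖ ^ 2 ≤ B * |t - s| := by
  wlog hst : s ≤ t generalizing s t
  · rw [norm_sub_rev, abs_sub_comm]; exact this ht hs (le_of_not_ge hst)
  rcases hst.eq_or_lt with h | h
  · subst h; simp
  have ha : a ∈ Icc a b := ⟨le_rfl, hs.1.trans hs.2⟩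
  have e1 : γ.toFun t - γ.toFun s = ∫ r in s..t, γ.deriv r := by
    rw [γ.eq_add_integral t ht, γ.eq_add_integral s hs, add_sub_add_left_eq_sub,
      intervalIntegral.integral_interval_sub_left (H1_intble γ ha ht) (H1_intble γ ha hs)]
  set I := ∫ r in s..t, ‖γ.deriv r‖ with hI
  have e2 : ‖γ.toFun t - γ.toFun s‖ ≤ I := by
    rw [e1]; exact intervalIntegral.norm_integral_le_integral_norm hst
  have hsub : Icc s t ⊆ Icc a b := Icc_subset_Icc hs.1 ht.2
  have i2 : IntervalIntegrable (fun r => ‖γ.deriv r‖ ^ 2) volume s t :=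
    (γ.deriv_sq_integrable.mono_set (uIcc_subset_Icc hs ht)).intervalIntegrable
  have e3 : ∫ r in s..t, ‖γ.deriv r‖ ^ 2 ≤ B := by
    refine le_trans ?_ hB
    rw [intervalIntegral.integral_of_le hst, ← integral_Icc_eq_integral_Ioc]
    exact setIntegral_mono_set γ.deriv_sq_integrable
      (Filter.Eventually.of_forall fun r => by positivity) hsub.eventuallyLE
  have e4 : 0 ≤ ∫ r in s..t, (‖γ.deriv r‖ - I / (t - s)) ^ 2 :=
    intervalIntegral.integral_nonneg hst fun r _ => by positivity
  have e5 : ∫ r in s..t, (‖γ.deriv r‖ - I / (t - s)) ^ 2 =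
      (∫ r in s..t, ‖γ.deriv r‖ ^ 2) - 2 * (I / (t - s)) * I + (I / (t - s)) ^ 2 * (t - s) := by
    have : ∀ r, (‖γ.deriv r‖ - I / (t - s)) ^ 2 =
      ‖γ.deriv r‖ ^ 2 - 2 * (I / (t - s)) * ‖γ.deriv r‖ + (I / (t - s)) ^ 2 := fun r => by ring
    simp only [this]
    have i1 := ((H1_intble γ hs ht).norm.const_mul (2 * (I / (t - s))))
    rw [intervalIntegral.integral_add (i2.sub i1) intervalIntegrable_const,
      intervalIntegral.integral_sub i2 i1, intervalIntegral.integral_const_mul, ← hI]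
    simp [mul_comm]
  have hts : 0 < t - s := by linarith
  have e6 : I ^ 2 / (t - s) ≤ B := by
    have : 2 * (I / (t - s)) * I - (I / (t - s)) ^ 2 * (t - s) = I ^ 2 / (t - s) := by
      field_simp; ring
    linarith
  rw [div_le_iff₀ hts] at e6
  rw [abs_of_pos hts]
  have := norm_nonneg (γ.toFun t - γ.toFun s)
  nlinarith

lemma H1_cont {n : ℕ} {a b : ℝ} (γ : H1Curve n a b) : ContinuousOn γ.toFun (Icc a b) := by
  intro s hs
  rw [ContinuousWithinAt, tendsto_iff_norm_sub_tendsto_zero]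
  have h : Tendsto (fun t => Real.sqrt ((∫ s in Icc a b, ‖γ.deriv s‖ ^ 2) * |t - s|))
      (nhdsWithin s (Icc a b)) (nhds 0) := by
    have : Continuous (fun t => Real.sqrt ((∫ s in Icc a b, ‖γ.deriv s‖ ^ 2) * |t - s|)) := by
      fun_prop
    have := this.tendsto s
    simp only [sub_self, abs_zero, mul_zero, Real.sqrt_zero] at this
    exact this.mono_left nhdsWithin_le_nhds
  refine squeeze_zero' (Filter.Eventually.of_forall fun t => norm_nonneg _) ?_ h
  filter_upwards [self_mem_nhdsWithin] with t ht
  exact Real.le_sqrt_of_sq_le (H1_holder γ le_rfl hs ht)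

lemma log_barrier {a b M C : ℝ} (hab : a < b) (hM : 0 < M) :
    ∃ m > 0, ∀ f : ℝ → ℝ, (∀ s ∈ Icc a b, 0 < f s) → ContinuousOn f (Icc a b) →
      (∀ s ∈ Icc a b, ∀ t ∈ Icc a b, (f s - f t) ^ 2 ≤ M * |s - t|) →
      ∫ s in Icc a b, 1 / (f s) ^ 2 ≤ C → ∀ s ∈ Icc a b, m ≤ f s := by
  set L := (b - a) / 2 with hL
  have hLpos : 0 < L := by rw [hL]; linarith
  refine ⟨Real.sqrt (M * L / Real.exp (2 * M * C)), by positivity, ?_⟩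
  intro f hf hfc hfh hfi s₀ hs₀
  refine Real.sqrt_le_iff.2 ⟨(hf s₀ hs₀).le, ?_⟩
  set c := f s₀ with hc
  have hcpos : 0 < c := hf s₀ hs₀
  have hint : ContinuousOn (fun s => 1 / (f s) ^ 2) (Icc a b) :=
    continuousOn_const.div (hfc.pow 2) fun s hs => by have := hf s hs; positivity
  have hlow : ∀ s ∈ Icc a b, 1 / (2 * c ^ 2 + 2 * M * |s - s₀|) ≤ 1 / (f s) ^ 2 := by
    intro s hs
    have h1 := hfh s hs s₀ hs₀
    have h2 := hf s hs
    apply one_div_le_one_div_of_le (by positivity)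
    nlinarith [sq_nonneg (f s - 2 * c)]
  have hsub : ∀ x y, a ≤ x → x ≤ y → y ≤ b →
      ∫ s in x..y, 1 / (2 * c ^ 2 + 2 * M * |s - s₀|) ≤ C := by
    intro x y hax hxy hyb
    have hxs : Icc x y ⊆ Icc a b := Icc_subset_Icc hax hyb
    refine le_trans ?_ hfi
    rw [intervalIntegral.integral_of_le hxy, ← integral_Icc_eq_integral_Ioc]
    have hi := hint.integrableOn_Icc (μ := volume)
    refine le_trans (setIntegral_mono_on ?_ (hi.mono_set hxs) measurableSet_Icc
      (fun s hs => hlow s (hxs hs))) (setIntegral_mono_set hi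
      (Filter.Eventually.of_forall fun r => by positivity) hxs.eventuallyLE)
    apply ContinuousOn.integrableOn_Icc
    apply Continuous.continuousOn
    refine continuous_const.div (by fun_prop) fun s => by positivity
  have key : (Real.log (2 * c ^ 2 + 2 * M * L) - Real.log (2 * c ^ 2)) / (2 * M) ≤ C := by
    have hd : ∀ y ≥ (0:ℝ), HasDerivAt (fun y => Real.log (2 * c ^ 2 + 2 * M * y) / (2 * M))
        (1 / (2 * c ^ 2 + 2 * M * y)) y := by
      intro y hy
      have h1 : HasDerivAt (fun y => 2 * c ^ 2 + 2 * M * y) (2 * M) y := by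
        simpa using ((hasDerivAt_id y).const_mul (2 * M)).const_add (2 * c ^ 2)
      have := (h1.log (by positivity)).div_const (2 * M)
      refine this.congr_deriv ?_
      rw [div_div_cancel_left' (by positivity), one_div]
    have hI : ∫ y in (0:ℝ)..L, 1 / (2 * c ^ 2 + 2 * M * |y|) =
        (Real.log (2 * c ^ 2 + 2 * M * L) - Real.log (2 * c ^ 2)) / (2 * M) := by
      have : ∫ y in (0:ℝ)..L, 1 / (2 * c ^ 2 + 2 * M * |y|) =
          ∫ y in (0:ℝ)..L, 1 / (2 * c ^ 2 + 2 * M * y) := by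
        apply intervalIntegral.integral_congr
        intro y hy
        rw [uIcc_of_le hLpos.le] at hy
        simp only [abs_of_nonneg hy.1]
      rw [this, intervalIntegral.integral_eq_sub_of_hasDerivAt (fun y hy => hd y ?_)]
      · simp; ring
      · apply ContinuousOn.intervalIntegrable
        intro y hy
        rw [uIcc_of_le hLpos.le] at hy
        have := hy.1
        apply ContinuousAt.continuousWithinAt
        refine continuousAt_const.div (by fun_prop) (by positivity)
      · rw [uIcc_of_le hLpos.le] at hy; exact hy.1
    rw [← hI]
    rcases le_or_gt s₀ ((a + b) / 2) with h | h
    · refine le_trans (le_of_eq ?_) (hsub s₀ (s₀ + L) hs₀.1 (by linarith) (by rw [hL]; linarith))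
      have := intervalIntegral.integral_comp_sub_right (a := s₀) (b := s₀ + L)
        (fun y => 1 / (2 * c ^ 2 + 2 * M * |y|)) s₀
      simp only [sub_self, add_sub_cancel_left] at this
      exact this.symm
    · refine le_trans (le_of_eq ?_) (hsub (s₀ - L) s₀ (by rw [hL]; linarith) (by linarith) hs₀.2)
      have := intervalIntegral.integral_comp_sub_left (a := s₀ - L) (b := s₀)
        (fun y => 1 / (2 * c ^ 2 + 2 * M * |y|)) s₀
      simp only [sub_self, sub_sub_cancel] at this
      rw [← this]
      simp only [abs_sub_comm]
  rw [← Real.log_div (by positivity) (by positivity), div_le_iff₀ (by positivity)] at key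
  have k2 : (2 * c ^ 2 + 2 * M * L) / (2 * c ^ 2) ≤ Real.exp (2 * M * C) := by
    rw [← Real.log_le_iff_le_exp (by positivity)]; linarith
  rw [div_le_iff₀ (by positivity)] at k2 ⊢
  nlinarith [sq_nonneg c]

lemma weak_limit {H : Type*} [NormedAddCommGroup H] [InnerProductSpace ℝ H] [CompleteSpace H]
    (U : Ultrafilter ℕ) (u : ℕ → H) (R : ℝ) (hu : ∀ k, ‖u k‖ ≤ R) :
    ∃ w : H, ∀ f : H, Tendsto (fun k => inner ℝ (u k) f) U (nhds (inner ℝ w f)) := by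
  have hc := WeakDual.isCompact_closedBall (𝕜 := ℝ) (E := H) 0 R
  let F : ℕ → WeakDual ℝ H := fun k =>
    StrongDual.toWeakDual (InnerProductSpace.toDual ℝ H (u k))
  obtain ⟨φ, -, hφ⟩ := hc.ultrafilter_le_nhds (U.map F) (by
    rw [le_principal_iff]
    refine Filter.Eventually.of_forall (f := (U : Filter ℕ)) (fun k => ?_)
    simpa [F] using hu k)
  refine ⟨(InnerProductSpace.toDual ℝ H).symm (WeakDual.toStrongDual φ), fun f => ?_⟩
  have h1 : Tendsto F U (nhds φ) := hφ
  have h2 := ((WeakDual.eval_continuous f).tendsto φ).comp h1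
  rw [InnerProductSpace.toDual_symm_apply]
  exact h2

lemma H1_memLp {n : ℕ} {a b : ℝ} (γ : H1Curve n a b) :
    MemLp γ.deriv 2 (volume.restrict (Icc a b)) :=
  (memLp_two_iff_integrable_sq_norm γ.deriv_integrable.aestronglyMeasurable).2
    γ.deriv_sq_integrable

lemma H1_weak {n : ℕ} {a b : ℝ} (U : Ultrafilter ℕ)
    (y : ℕ → H1Curve n a b) (p : Evec n) (hp : ∀ k, (y k).toFun a = p) (B : ℝ)
    (hB : ∀ k, ∫ s in Icc a b, ‖(y k).deriv s‖ ^ 2 ≤ B) :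
    ∃ x : H1Curve n a b, x.toFun a = p ∧
      (∀ t ∈ Icc a b, Tendsto (fun k => (y k).toFun t) U (nhds (x.toFun t))) ∧
      ∀ D : ℝ → Evec n, MemLp D 2 (volume.restrict (Icc a b)) →
        Tendsto (fun k => ∫ s in Icc a b, inner ℝ ((y k).deriv s) (D s)) U
          (nhds (∫ s in Icc a b, inner ℝ (x.deriv s) (D s))) := by
  obtain ⟨w, hw⟩ := weak_limit U (fun k => (H1_memLp (y k)).toLp) (Real.sqrt B) (by
    intro k
    apply Real.le_sqrt_of_sq_le
    rw [← real_inner_self_eq_norm_sq, L2.inner_def]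
    refine le_trans (le_of_eq (integral_congr_ae ?_)) (hB k)
    filter_upwards [(H1_memLp (y k)).coeFn_toLp] with s hs
    rw [hs, real_inner_self_eq_norm_sq])
  have hwL : MemLp (w : ℝ → Evec n) 2 (volume.restrict (Icc a b)) := Lp.memLp w
  have hwI : IntegrableOn (w : ℝ → Evec n) (Icc a b) := hwL.integrable (by norm_num)
  let x : H1Curve n a b :=
    { toFun := fun t => p + ∫ s in a..t, w s
      deriv := w
      deriv_integrable := hwI
      deriv_sq_integrable := (memLp_two_iff_integrable_sq_norm hwI.aestronglyMeasurable).1 hwL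
      eq_add_integral := by intro t _; simp }
  have hD : ∀ D : ℝ → Evec n, MemLp D 2 (volume.restrict (Icc a b)) →
        Tendsto (fun k => ∫ s in Icc a b, inner ℝ ((y k).deriv s) (D s)) U
          (nhds (∫ s in Icc a b, inner ℝ (x.deriv s) (D s))) := by
    intro D hDm
    have h := hw hDm.toLp
    simp only [L2.inner_def] at h
    have e1 : ∫ s in Icc a b, inner ℝ (w s) (hDm.toLp D s) =
        ∫ s in Icc a b, inner ℝ (x.deriv s) (D s) := by
      apply integral_congr_ae
      filter_upwards [hDm.coeFn_toLp] with s hs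
      rw [hs]
    have e2 : ∀ k, ∫ s in Icc a b, inner ℝ ((H1_memLp (y k)).toLp (y k).deriv s) (hDm.toLp D s) =
        ∫ s in Icc a b, inner ℝ ((y k).deriv s) (D s) := by
      intro k
      apply integral_congr_ae
      filter_upwards [hDm.coeFn_toLp, (H1_memLp (y k)).coeFn_toLp] with s hs hs'
      rw [hs, hs']
    rw [e1] at h
    simpa only [e2] using h
  refine ⟨x, by simp [x], ?_, hD⟩
  intro t ht
  have hrep : ∀ z : H1Curve n a b, z.toFun a = p → ∀ i : Fin n,
      z.toFun t i = p i + ∫ s in Icc a b, inner ℝ (z.deriv s)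
        ((Icc a t).indicator (fun _ => EuclideanSpace.single i (1:ℝ)) s) := by
    intro z hz i
    have e1 : ∀ s, inner ℝ (z.deriv s)
        ((Icc a t).indicator (fun _ => EuclideanSpace.single i (1:ℝ)) s) =
        (Icc a t).indicator (fun s => inner ℝ (EuclideanSpace.single i (1:ℝ)) (z.deriv s)) s := by
      intro s
      by_cases hs : s ∈ Icc a t
      · simp only [indicator_of_mem hs]; exact real_inner_comm _ _
      · simp only [indicator_of_notMem hs]; exact inner_zero_right _
    simp only [e1]
    have hsub : Icc a t ⊆ Icc a b := Icc_subset_Icc le_rfl ht.2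
    rw [integral_indicator measurableSet_Icc, Measure.restrict_restrict measurableSet_Icc,
      inter_eq_left.2 hsub, integral_inner (z.deriv_integrable.mono_set hsub),
      z.eq_add_integral t ht, hz, intervalIntegral.integral_of_le ht.1,
      integral_Icc_eq_integral_Ioc]
    simp [EuclideanSpace.inner_single_left]
  have hcoord : ∀ i, Tendsto (fun k => (y k).toFun t i) U (nhds (x.toFun t i)) := by
    intro i
    rw [hrep x (by simp [x]) i]
    simp only [fun k => hrep (y k) (hp k) i]
    refine tendsto_const_nhds.add (hD _ ?_)
    exact (memLp_const _).indicator measurableSet_Icc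
  have h3 : Tendsto (fun k => (EuclideanSpace.equiv (Fin n) ℝ) ((y k).toFun t)) U
      (nhds ((EuclideanSpace.equiv (Fin n) ℝ) (x.toFun t))) := tendsto_pi_nhds.2 hcoord
  have h4 := ((EuclideanSpace.equiv (Fin n) ℝ).symm.continuous.tendsto _).comp h3
  simpa [Function.comp_def] using h4

lemma H1_uniform {n : ℕ} {a b : ℝ} (U : Ultrafilter ℕ)
    (y : ℕ → H1Curve n a b) (x : H1Curve n a b) (B : ℝ)
    (hB : ∀ k, ∫ s in Icc a b, ‖(y k).deriv s‖ ^ 2 ≤ B)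
    (h : ∀ t ∈ Icc a b, Tendsto (fun k => (y k).toFun t) U (nhds (x.toFun t))) :
    TendstoUniformlyOn (fun k => (y k).toFun) x.toFun U (Icc a b) := by
  rw [← tendstoLocallyUniformlyOn_iff_tendstoUniformlyOn_of_compact isCompact_Icc,
    Metric.tendstoLocallyUniformlyOn_iff]
  intro ε hε t ht
  have hc : Tendsto (fun s => dist (x.toFun s) (x.toFun t)) (nhdsWithin t (Icc a b)) (nhds 0) :=
    tendsto_iff_dist_tendsto_zero.1 (H1_cont x t ht)
  have hB' : Tendsto (fun s => Real.sqrt (B * |s - t|)) (nhdsWithin t (Icc a b)) (nhds 0) := by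
    have : Continuous (fun s => Real.sqrt (B * |s - t|)) := by fun_prop
    have := this.tendsto t
    simp only [sub_self, abs_zero, mul_zero, Real.sqrt_zero] at this
    exact this.mono_left nhdsWithin_le_nhds
  have hε3 : 0 < ε / 3 := by positivity
  refine ⟨{s | s ∈ Icc a b ∧ dist (x.toFun s) (x.toFun t) < ε / 3 ∧
    Real.sqrt (B * |s - t|) < ε / 3}, ?_, ?_⟩
  · filter_upwards [self_mem_nhdsWithin, hc.eventually_lt_const hε3,
      hB'.eventually_lt_const hε3] with s h1 h2 h3
    exact ⟨h1, h2, h3⟩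
  · filter_upwards [(Metric.tendsto_nhds.1 (h t ht)) (ε / 3) hε3] with k hk s hs
    have h1 : dist ((y k).toFun s) ((y k).toFun t) ≤ Real.sqrt (B * |s - t|) := by
      rw [dist_eq_norm]
      exact Real.le_sqrt_of_sq_le (H1_holder (y k) (hB k) ht hs.1)
    have h2 := dist_triangle4 (x.toFun s) (x.toFun t) ((y k).toFun t) ((y k).toFun s)
    rw [dist_comm] at hk
    rw [dist_comm] at h1
    linarith [hs.2.1, hs.2.2]

lemma H1_G_int {n : ℕ} {G : Evec n → Evec n → ℝ} {ℓ α : ℝ} (hG : IsFinslerEnergy n G ℓ α)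
    {a b : ℝ} (x y : H1Curve n a b) :
    IntegrableOn (fun s => G (x.toFun s) (y.deriv s)) (Icc a b) := by
  refine Integrable.mono' (y.deriv_sq_integrable.const_mul ℓ) ?_ ?_
  · exact hG.continuous.comp_aestronglyMeasurable
      (((H1_cont x).aestronglyMeasurable measurableSet_Icc).prodMk
        y.deriv_integrable.aestronglyMeasurable)
  · refine Filter.Eventually.of_forall fun s => ?_
    rw [Real.norm_of_nonneg (finsler_nonneg hG _ _)]
    exact hG.upper _ _

lemma H1_D_memLp {n : ℕ} {G : Evec n → Evec n → ℝ} {ℓ α : ℝ} (hG : IsFinslerEnergy n G ℓ α)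
    {a b : ℝ} (x : H1Curve n a b) :
    MemLp (fun s => (InnerProductSpace.toDual ℝ (Evec n)).symm
      (dvCLM G (x.toFun s) (x.deriv s))) 2 (volume.restrict (Icc a b)) := by
  have hm : Measurable (fun z : Evec n × Evec n => dvCLM G z.1 z.2) :=
    measurable_fderiv_with_param (𝕜 := ℝ) (f := G) hG.continuous
  have hx : AEMeasurable (fun s => (x.toFun s, x.deriv s)) (volume.restrict (Icc a b)) :=
    (((H1_cont x).aestronglyMeasurable measurableSet_Icc).prodMk
        x.deriv_integrable.aestronglyMeasurable).aemeasurable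
  have hD : AEStronglyMeasurable (fun s => dvCLM G (x.toFun s) (x.deriv s))
      (volume.restrict (Icc a b)) := (hm.comp_aemeasurable hx).aestronglyMeasurable
  have hg : MemLp (fun s => ℓ * (1 + ‖x.deriv s‖)) 2 (volume.restrict (Icc a b)) :=
    ((memLp_const (1:ℝ)).add (H1_memLp x).norm).const_mul ℓ
  refine hg.mono' ((LinearIsometryEquiv.continuous _).comp_aestronglyMeasurable hD) ?_
  refine Filter.Eventually.of_forall fun s => ?_
  rw [LinearIsometryEquiv.norm_map]
  exact hG.dv_bound _ _

lemma Jpen_eq {n : ℕ} (G : Evec n → Evec n → ℝ) (Φ : Evec n → ℝ) (δ : ℝ) {a b : ℝ} (hab : a < b)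
    (γ : H1Curve n a b) : Jpen G Φ δ a b γ =
      (1 / 2) * (∫ s in Icc a b, G (γ.toFun s) (γ.deriv s)) +
        ∫ s in Icc a b, chi δ (Φ (γ.toFun s)) := by
  unfold Jpen
  rw [intervalIntegral.integral_of_le hab.le, intervalIntegral.integral_of_le hab.le,
    integral_Icc_eq_integral_Ioc, integral_Icc_eq_integral_Ioc]

lemma chi_cont_curve {n : ℕ} {Φ : Evec n → ℝ} (hΦ : Continuous Φ) {δ : ℝ} (hδ : 0 < δ) {a b : ℝ}
    (γ : H1Curve n a b) (hγ : ∀ s ∈ Icc a b, Φ (γ.toFun s) < δ) :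
    ContinuousOn (fun s => chi δ (Φ (γ.toFun s))) (Icc a b) :=
  (chi_continuousOn hδ).comp (hΦ.comp_continuousOn (H1_cont γ)) hγ

lemma H1_deriv_bound {n : ℕ} {G : Evec n → Evec n → ℝ} {ℓ α : ℝ} (hG : IsFinslerEnergy n G ℓ α)
    {a b : ℝ} (γ : H1Curve n a b) :
    ∫ s in Icc a b, ‖γ.deriv s‖ ^ 2 ≤ ℓ * ∫ s in Icc a b, G (γ.toFun s) (γ.deriv s) := by
  rw [← integral_const_mul]
  refine integral_mono γ.deriv_sq_integrable ((H1_G_int hG γ γ).const_mul ℓ) fun s => ?_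
  have h := hG.lower (γ.toFun s) (γ.deriv s)
  have hl : 0 < ℓ := by linarith [hG.one_le_ell]
  rw [one_div, inv_mul_le_iff₀ hl] at h
  exact h

/-- lower semicontinuity step for the kinetic part -/
lemma kinetic_step {n : ℕ} {G : Evec n → Evec n → ℝ} {ℓ α : ℝ} (hG : IsFinslerEnergy n G ℓ α)
    {a b : ℝ} (hab : a < b) (x y : H1Curve n a b) {B ε : ℝ}
    (hB : ∫ s in Icc a b, ‖y.deriv s‖ ^ 2 ≤ B) (hε : 0 < ε)
    (hxy : ∀ s ∈ Icc a b, ‖x.toFun s - y.toFun s‖ ≤ ε)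
    (hD : |(∫ s in Icc a b, inner ℝ (y.deriv s) ((InnerProductSpace.toDual ℝ (Evec n)).symm
      (dvCLM G (x.toFun s) (x.deriv s)))) - ∫ s in Icc a b, inner ℝ (x.deriv s)
        ((InnerProductSpace.toDual ℝ (Evec n)).symm (dvCLM G (x.toFun s) (x.deriv s)))| < ε) :
    ∫ s in Icc a b, G (x.toFun s) (x.deriv s) ≤
      (∫ s in Icc a b, G (y.toFun s) (y.deriv s)) + ε * (ℓ * ((b - a) + B) + 1) := by
  have hl : 0 < ℓ := by linarith [hG.one_le_ell]
  set D : ℝ → Evec n := fun s => (InnerProductSpace.toDual ℝ (Evec n)).symm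
      (dvCLM G (x.toFun s) (x.deriv s)) with hDdef
  have hDL : MemLp D 2 (volume.restrict (Icc a b)) := H1_D_memLp hG x
  have hint : ∀ z : H1Curve n a b, IntegrableOn (fun s => inner ℝ (z.deriv s) (D s)) (Icc a b) :=
    by
    intro z
    have hDi := (memLp_two_iff_integrable_sq_norm hDL.1).1 hDL
    refine Integrable.mono' (z.deriv_sq_integrable.add hDi) ?_ ?_
    · exact z.deriv_integrable.aestronglyMeasurable.inner hDL.1
    · refine Filter.Eventually.of_forall fun s => ?_
      have h := norm_inner_le_norm (𝕜 := ℝ) (z.deriv s) (D s)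
      simp only [Pi.add_apply]
      nlinarith [sq_nonneg (‖z.deriv s‖ - ‖D s‖), sq_nonneg (‖z.deriv s‖ + ‖D s‖)]
  have h1 : (∫ s in Icc a b, G (x.toFun s) (x.deriv s)) +
      ((∫ s in Icc a b, inner ℝ (y.deriv s) (D s)) - ∫ s in Icc a b, inner ℝ (x.deriv s) (D s)) ≤
      ∫ s in Icc a b, G (x.toFun s) (y.deriv s) := by
    have hsubi : IntegrableOn (fun s => inner ℝ (y.deriv s) (D s) - inner ℝ (x.deriv s) (D s))
      (Icc a b) := (hint y).sub (hint x)
    rw [← integral_sub (hint y) (hint x), ← integral_add (H1_G_int hG x x) hsubi]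
    refine integral_mono ((H1_G_int hG x x).add ((hint y).sub (hint x))) (H1_G_int hG x y)
      fun s => ?_
    have := finsler_tangent hG (x.toFun s) (x.deriv s) (y.deriv s)
    have e : inner ℝ (y.deriv s) (D s) - inner ℝ (x.deriv s) (D s) =
        dvCLM G (x.toFun s) (x.deriv s) (y.deriv s - x.deriv s) := by
      rw [← inner_sub_left, real_inner_comm, hDdef, InnerProductSpace.toDual_symm_apply]
    simp only [Pi.add_apply, Pi.sub_apply, e]
    exact this
  have h2 : ∫ s in Icc a b, G (x.toFun s) (y.deriv s) ≤
      (∫ s in Icc a b, G (y.toFun s) (y.deriv s)) +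
        ε * ℓ * ∫ s in Icc a b, (1 + ‖y.deriv s‖ ^ 2) := by
    have hi : IntegrableOn (fun s => 1 + ‖y.deriv s‖ ^ 2) (Icc a b) :=
      (integrable_const (1:ℝ)).add y.deriv_sq_integrable
    rw [← integral_const_mul, ← integral_add (H1_G_int hG y y) (hi.const_mul _)]
    refine setIntegral_mono_on (H1_G_int hG x y) ((H1_G_int hG y y).add (hi.const_mul _))
      measurableSet_Icc fun s hs => ?_
    have h3 := (abs_le.1 (finsler_lip hG (x.toFun s) (y.toFun s) (y.deriv s))).2
    have h4 : ℓ * (1 + ‖y.deriv s‖ ^ 2) * ‖x.toFun s - y.toFun s‖ ≤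
        ℓ * (1 + ‖y.deriv s‖ ^ 2) * ε := by
      have := hxy s hs
      gcongr
    nlinarith
  have h3 : ∫ s in Icc a b, (1 + ‖y.deriv s‖ ^ 2) ≤ (b - a) + B := by
    rw [integral_add (integrable_const (1:ℝ)) y.deriv_sq_integrable]
    have : ∫ _ in Icc a b, (1:ℝ) = b - a := by simp [hab.le]
    rw [this]; linarith
  have h4 : ε * ℓ * ∫ s in Icc a b, (1 + ‖y.deriv s‖ ^ 2) ≤ ε * ℓ * ((b - a) + B) := by
    gcongr
  have h5 := (abs_lt.1 hD).1
  nlinarith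

lemma sublevel_lipschitz {n : ℕ} {Φ : Evec n → ℝ} (hΦ : ContDiff ℝ 2 Φ) {K : Set (Evec n)}
    (hK : IsCompact K) : ∃ Λ : ℝ, ∀ z ∈ K, ∀ w ∈ K, |Φ z - Φ w| ≤ Λ * ‖z - w‖ := by
  obtain ⟨R, hR⟩ := hK.isBounded.subset_closedBall 0
  obtain ⟨Λ, hΛ⟩ := (isCompact_closedBall (0 : Evec n) R).exists_bound_of_continuousOn
    (hΦ.continuous_fderiv (by norm_num)).continuousOn
  refine ⟨Λ, fun z hz w hw => ?_⟩
  exact Convex.norm_image_sub_le_of_norm_fderiv_le (𝕜 := ℝ)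
    (fun u _ => hΦ.differentiable (by norm_num) u) hΛ (convex_closedBall _ _) (hR hw) (hR hz)

/-- uniform distance from the boundary of `Ω_δ` on sublevels of the penalized functional -/
lemma uniform_barrier {n : ℕ} {G : Evec n → Evec n → ℝ} {ℓ α : ℝ} (hG : IsFinslerEnergy n G ℓ α)
    {Φ : Evec n → ℝ} {δ₀ : ℝ} (hΦ : IsRegularDomain n Φ δ₀) {a b : ℝ} (hab : a < b)
    (p q : Evec n) {δ : ℝ} (hδ : δ ∈ Ioo (0:ℝ) δ₀) (J0 B : ℝ) (hB0 : 0 ≤ B) :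
    ∃ m > 0, ∀ y : H1Curve n a b, MemC Φ δ a b p q y → Jpen G Φ δ a b y ≤ J0 →
      ∫ s in Icc a b, ‖y.deriv s‖ ^ 2 ≤ B → ∀ s ∈ Icc a b, Φ (y.toFun s) ≤ δ - m := by
  have hcont : Continuous Φ := hΦ.smooth.continuous
  obtain ⟨Λ, hΛ⟩ := sublevel_lipschitz hΦ.smooth (hΦ.sublevel_compact δ ⟨hδ.1.le, hδ.2.le⟩)
  obtain ⟨m, hm, H⟩ := log_barrier (C := (J0 + (b - a)) / (δ ^ 2 / 4)) hab
    (show 0 < Λ ^ 2 * B + 1 by positivity)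
  refine ⟨m, hm, fun y hy hJ hB s hs => ?_⟩
  have hδ0 := hδ.1
  suffices m ≤ δ - Φ (y.toFun s) by linarith
  have hpos : ∀ s ∈ Icc a b, 0 < δ - Φ (y.toFun s) := fun s hs => by linarith [hy.1 s hs]
  have hfc : ContinuousOn (fun s => δ - Φ (y.toFun s)) (Icc a b) :=
    continuousOn_const.sub (hcont.comp_continuousOn (H1_cont y))
  refine H (fun s => δ - Φ (y.toFun s)) hpos hfc ?_ ?_ s hs
  · intro s hs t ht
    have h1 := hΛ (y.toFun s) (hy.1 s hs).le (y.toFun t) (hy.1 t ht).le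
    have h2 := H1_holder y hB ht hs
    have h3 : (Φ (y.toFun s) - Φ (y.toFun t)) ^ 2 ≤ (Λ * ‖y.toFun s - y.toFun t‖) ^ 2 :=
      sq_le_sq' (by linarith [(abs_le.1 h1).1]) (abs_le.1 h1).2
    have h4 : Λ ^ 2 * ‖y.toFun s - y.toFun t‖ ^ 2 ≤ Λ ^ 2 * (B * |s - t|) := by gcongr
    have h5 := abs_nonneg (s - t)
    calc (δ - Φ (y.toFun s) - (δ - Φ (y.toFun t))) ^ 2
        = (Φ (y.toFun s) - Φ (y.toFun t)) ^ 2 := by ring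
      _ ≤ (Λ ^ 2 * B + 1) * |s - t| := by nlinarith
  · have hi : IntegrableOn (fun s => 1 / (δ - Φ (y.toFun s)) ^ 2) (Icc a b) :=
      (continuousOn_const.div (hfc.pow 2) fun s hs =>
        pow_ne_zero 2 (hpos s hs).ne').integrableOn_Icc
    have hchi : ∫ s in Icc a b, chi δ (Φ (y.toFun s)) ≤ J0 := by
      rw [Jpen_eq G Φ δ hab] at hJ
      have : 0 ≤ ∫ s in Icc a b, G (y.toFun s) (y.deriv s) :=
        integral_nonneg fun s => finsler_nonneg hG _ _
      linarith
    have hle : ∫ s in Icc a b, ((δ ^ 2 / 4) * (1 / (δ - Φ (y.toFun s)) ^ 2) - 1) ≤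
        ∫ s in Icc a b, chi δ (Φ (y.toFun s)) :=
      setIntegral_mono_on ((hi.const_mul _).sub (integrable_const (1:ℝ)))
        (chi_cont_curve hcont hδ0 y hy.1).integrableOn_Icc measurableSet_Icc
        fun s hs => chi_lower hδ0 (hy.1 s hs)
    rw [integral_sub (hi.const_mul _) (integrable_const (1:ℝ)), integral_const_mul] at hle
    have : ∫ _ in Icc a b, (1:ℝ) = b - a := by simp [hab.le]
    rw [this] at hle
    rw [le_div_iff₀ (by positivity)]
    linarith

/-- The penalized functional `J_δ` attains its minimum on (nonempty)
`C_δ = C([a,b],p,q,Ω_δ)`, for `δ ∈ (0,δ₀)`. -/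
theorem stmt_6 {n : ℕ} (G : Evec n → Evec n → ℝ) (ℓ α : ℝ)
    (hG : IsFinslerEnergy n G ℓ α)
    (Φ : Evec n → ℝ) (δ₀ : ℝ) (hΦ : IsRegularDomain n Φ δ₀)
    (a b : ℝ) (h0a : 0 ≤ a) (hab : a < b) (hb1 : b ≤ 1)
    (p q : Evec n) (hp : Φ p ≤ 0) (hq : Φ q ≤ 0)
    (δ : ℝ) (hδ : δ ∈ Ioo (0:ℝ) δ₀)
    (hne : ∃ γ : H1Curve n a b, MemC Φ δ a b p q γ) :
    ∃ γ : H1Curve n a b, MemC Φ δ a b p q γ ∧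
      ∀ y : H1Curve n a b, MemC Φ δ a b p q y → Jpen G Φ δ a b γ ≤ Jpen G Φ δ a b y := by
  have hcont : Continuous Φ := hΦ.smooth.continuous
  have hδ0 := hδ.1
  have hl : 0 < ℓ := by linarith [hG.one_le_ell]
  have hJnn : ∀ y : H1Curve n a b, 0 ≤ Jpen G Φ δ a b y := by
    intro y
    rw [Jpen_eq G Φ δ hab]
    have h1 : 0 ≤ ∫ s in Icc a b, G (y.toFun s) (y.deriv s) :=
      integral_nonneg fun s => finsler_nonneg hG _ _
    have h2 : 0 ≤ ∫ s in Icc a b, chi δ (Φ (y.toFun s)) :=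
      integral_nonneg fun s => chi_nonneg _ _
    linarith
  set S : Set ℝ := {J | ∃ y : H1Curve n a b, MemC Φ δ a b p q y ∧ Jpen G Φ δ a b y = J} with hS
  have hSne : S.Nonempty := by
    obtain ⟨γ, hγ⟩ := hne
    exact ⟨_, γ, hγ, rfl⟩
  have hSb : BddBelow S := ⟨0, by rintro _ ⟨y, -, rfl⟩; exact hJnn y⟩
  obtain ⟨u, huA, hut, huS⟩ := exists_seq_tendsto_sInf hSne hSb
  choose y hyC hyJ using huS
  have hJ0 : ∀ k, Jpen G Φ δ a b (y k) ≤ u 0 := fun k => (hyJ k).trans_le (huA (Nat.zero_le k))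
  have hu0 : 0 ≤ u 0 := by rw [← hyJ 0]; exact hJnn _
  set B := ℓ * (2 * u 0) with hBdef
  have hB0 : 0 ≤ B := by positivity
  have hB : ∀ k, ∫ s in Icc a b, ‖(y k).deriv s‖ ^ 2 ≤ B := by
    intro k
    refine (H1_deriv_bound hG (y k)).trans ?_
    have h1 := hJ0 k
    rw [Jpen_eq G Φ δ hab] at h1
    have h2 : 0 ≤ ∫ s in Icc a b, chi δ (Φ ((y k).toFun s)) :=
      integral_nonneg fun s => chi_nonneg _ _
    rw [hBdef]
    gcongr
    linarith
  obtain ⟨m, hm, hbar⟩ := uniform_barrier hG hΦ hab p q hδ (u 0) B hB0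
  have hym : ∀ k, ∀ s ∈ Icc a b, Φ ((y k).toFun s) ≤ δ - m :=
    fun k => hbar (y k) (hyC k) (hJ0 k) (hB k)
  let U : Ultrafilter ℕ := Ultrafilter.of atTop
  have hU : (U : Filter ℕ) ≤ atTop := Ultrafilter.of_le atTop
  obtain ⟨x, hxa, hxt, hxD⟩ := H1_weak U y p (fun k => (hyC k).2.1) B hB
  have hunif := H1_uniform U y x B hB hxt
  have hxm : ∀ s ∈ Icc a b, Φ (x.toFun s) ≤ δ - m := fun s hs =>
    le_of_tendsto ((hcont.tendsto _).comp (hxt s hs))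
      (Filter.Eventually.of_forall fun k => hym k s hs)
  have hxlt : ∀ s ∈ Icc a b, Φ (x.toFun s) < δ := fun s hs => by linarith [hxm s hs]
  have hxb : x.toFun b = q := by
    refine tendsto_nhds_unique (hxt b ⟨hab.le, le_rfl⟩) ?_
    simp only [fun k => (hyC k).2.2]
    exact tendsto_const_nhds
  refine ⟨x, ⟨hxlt, hxa, hxb⟩, ?_⟩
  suffices Jpen G Φ δ a b x ≤ sInf S by
    intro z hz
    exact this.trans (csInf_le hSb ⟨z, hz, rfl⟩)
  have hK : IsCompact (Φ ⁻¹' Iic (δ - m)) := by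
    refine (hΦ.sublevel_compact δ ⟨hδ.1.le, hδ.2.le⟩).of_isClosed_subset
      (isClosed_Iic.preimage hcont) (preimage_mono (Iic_subset_Iic.2 (by linarith)))
  have huc : UniformContinuousOn (fun z => chi δ (Φ z)) (Φ ⁻¹' Iic (δ - m)) := by
    refine hK.uniformContinuousOn_of_continuous ?_
    refine (chi_continuousOn hδ0).comp hcont.continuousOn ?_
    intro z hz
    have : Φ z ≤ δ - m := hz
    exact show Φ z < δ by linarith
  set c := 1 + (b - a) + (ℓ * ((b - a) + B) + 1) / 2 with hc
  have hcpos : 0 < c := by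
    have : 0 < b - a := by linarith
    positivity
  have key : ∀ ε > 0, Jpen G Φ δ a b x ≤ sInf S + ε * c := by
    intro ε hε
    obtain ⟨η, hη, huη⟩ := Metric.uniformContinuousOn_iff.1 huc ε hε
    have ev1 := Metric.tendstoUniformlyOn_iff.1 hunif (min η ε) (lt_min hη hε)
    have ev2 := Metric.tendsto_nhds.1 (hxD _ (H1_D_memLp hG x)) ε hε
    have ev3 := (hut.mono_left hU).eventually_lt_const (show sInf S < sInf S + ε by linarith)
    obtain ⟨k, h1, h2, h3⟩ := (ev1.and (ev2.and ev3)).exists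
    have hkin := kinetic_step hG hab x (y k) (hB k) hε
      (fun s hs => by
        rw [← dist_eq_norm]; exact ((h1 s hs).trans_le (min_le_right _ _)).le)
      (by simpa [Real.dist_eq] using h2)
    have hci := (chi_cont_curve hcont hδ0 (y k) (hyC k).1).integrableOn_Icc (μ := volume)
    have hpen : ∫ s in Icc a b, chi δ (Φ (x.toFun s)) ≤
        (∫ s in Icc a b, chi δ (Φ ((y k).toFun s))) + ε * (b - a) := by
      have e : ∫ _ in Icc a b, ε = ε * (b - a) := by simp [hab.le, mul_comm]
      rw [← e, ← integral_add hci (integrable_const ε)]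
      refine setIntegral_mono_on (chi_cont_curve hcont hδ0 x hxlt).integrableOn_Icc
        (hci.add (integrable_const ε)) measurableSet_Icc fun s hs => ?_
      have := huη (x.toFun s) (hxm s hs) ((y k).toFun s) (hym k s hs)
        ((h1 s hs).trans_le (min_le_left _ _))
      rw [Real.dist_eq] at this
      linarith [(abs_lt.1 this).2]
    have hk := hyJ k
    rw [Jpen_eq G Φ δ hab] at hk ⊢
    rw [hc]
    nlinarith
  by_contra hcon
  push Not at hcon
  have := key ((Jpen G Φ δ a b x - sInf S) / (2 * c)) (by
    apply div_pos <;> linarith)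
  have e : (Jpen G Φ δ a b x - sInf S) / (2 * c) * c = (Jpen G Φ δ a b x - sInf S) / 2 := by
    field_simp
  rw [e] at this
  linarith

end
end
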